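/- The reduction relation → on SMLL nets is strongly normalizing: there is no infinite sequence of → reduction steps starting from an SMLL net. -/

import Mathlib

/-! # SMLL: multiplicative linear logic with synchronization

Formalization of the proof-structures, correctness criterion, reduction and
multi-token machine (SIAM) of Dal Lago, Faggian, Hasuo, Yoshimizu,
"The Geometry of Synchronization". -/

/-- SMLL formulas (in negation normal form):
`A ::= 1 | ⊥ | X | X⊥ | A ⊗ A | A ⅋ A`. -/
inductive Formula : Type
  | one : Formula
  | bot : Formula
  | var : ℕ → Formula
  | covar : ℕ → Formula
  | tens : Formula → Formula → Formula
  | parr : Formula → Formula → Formula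
  deriving DecidableEq

namespace Formula

/-- Linear negation. -/
def dual : Formula → Formula
  | one => bot
  | bot => one
  | var n => covar n
  | covar n => var n
  | tens A B => parr A.dual B.dual
  | parr A B => tens A.dual B.dual

/-- Positive formulas: `P ::= 1 | P ⊗ P`. -/
inductive Positive : Formula → Prop
  | one : Positive one
  | tens {A B : Formula} : Positive A → Positive B → Positive (tens A B)

/-- Negative formulas: `N ::= ⊥ | N ⅋ N`. -/
inductive Negative : Formula → Prop
  | bot : Negative bot
  | parr {A B : Formula} : Negative A → Negative B → Negative (parr A B)

/-- A formula is polarized when it is positive or negative. -/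
def Polarized (A : Formula) : Prop := Positive A ∨ Negative A

/-- Whether `⊥` occurs in a formula. -/
def hasBotB : Formula → Bool
  | one => false
  | bot => true
  | var _ => false
  | covar _ => false
  | tens A B => hasBotB A || hasBotB B
  | parr A B => hasBotB A || hasBotB B

/-- Addresses of occurrences inside a formula: `false` = left, `true` = right. -/
abbrev Addr := List Bool

/-- Subformula at a given address (if the address is meaningful). -/
def sub : Formula → Addr → Option Formula
  | A, [] => some A
  | tens A _, false :: m => sub A m
  | tens _ B, true :: m => sub B m
  | parr A _, false :: m => sub A m
  | parr _ B, true :: m => sub B m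
  | _, _ :: _ => none

def IsAtom : Formula → Prop
  | one => True
  | bot => True
  | var _ => True
  | covar _ => True
  | tens _ _ => False
  | parr _ _ => False

/-- `m` is the address of an occurrence of an atom in `A`. -/
def AtomOcc (A : Formula) (m : Addr) : Prop := ∃ a, sub A m = some a ∧ IsAtom a

/-- The atom occurrence at `m` in `A` is positive (it is `1` or `X`). -/
def PosOcc (A : Formula) (m : Addr) : Prop :=
  ∃ a, sub A m = some a ∧ (a = one ∨ ∃ n, a = var n)

/-- The atom occurrence at `m` in `A` is negative (it is `⊥` or `X⊥`). -/
def NegOcc (A : Formula) (m : Addr) : Prop :=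
  ∃ a, sub A m = some a ∧ (a = bot ∨ ∃ n, a = covar n)

theorem NegOcc.atomOcc {A : Formula} {m : Addr} (h : NegOcc A m) : AtomOcc A m := by
  obtain ⟨a, ha, h⟩ := h
  refine ⟨a, ha, ?_⟩
  rcases h with rfl | ⟨n, rfl⟩ <;> trivial

theorem PosOcc.atomOcc {A : Formula} {m : Addr} (h : PosOcc A m) : AtomOcc A m := by
  obtain ⟨a, ha, h⟩ := h
  refine ⟨a, ha, ?_⟩
  rcases h with rfl | ⟨n, rfl⟩ <;> trivial

end Formula

/-- The sorts of links of an SMLL structure. -/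
inductive LinkSort : Type
  | ax | cut | tens | parr | one | bot | sync
  deriving DecidableEq

/-- An SMLL proof-structure (with boxes): a finite directed multigraph whose
edges are typed by formulas and whose nodes are links.  Every edge is the
conclusion of exactly one link (its `src`); it is the premiss of the link
`tgt`, if any (edges with no target are the conclusions of the structure).
`pIdx` indexes an edge among the premisses of its target (for `⊗`/`⅋`-links:
`0` = left, `1` = right; for sync links it pairs premisses with conclusions);
`cIdx` indexes an edge among the conclusions of its source (for sync links,
the `i`-th conclusion corresponds to the `i`-th premiss).  Each `bot`-link is
the lock of a box; `box n` is the innermost box containing the node `n` and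
`boxes n` is the set of all boxes containing `n`. -/
structure Struct : Type 1 where
  Edge : Type
  Node : Type
  edgeFintype : Fintype Edge
  nodeFintype : Fintype Node
  edgeDecEq : DecidableEq Edge
  nodeDecEq : DecidableEq Node
  typ : Edge → Formula
  sort : Node → LinkSort
  src : Edge → Node
  tgt : Edge → Option Node
  pIdx : Edge → ℕ
  cIdx : Edge → ℕ
  box : Node → Option Node
  boxes : Node → Finset Node

attribute [instance] Struct.edgeFintype Struct.nodeFintype
attribute [instance] Struct.edgeDecEq Struct.nodeDecEq

namespace Struct

variable (S : Struct)

/-- The conclusions of a link. -/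
def concls (n : S.Node) : Finset S.Edge := Finset.univ.filter fun e => S.src e = n

/-- The premisses of a link. -/
def prems (n : S.Node) : Finset S.Edge := Finset.univ.filter fun e => S.tgt e = some n

/-- The conclusions of the structure. -/
def IsConcl (e : S.Edge) : Prop := S.tgt e = none

/-- Well-formedness of an SMLL structure: the constraints that the sort of a
link induces on the number and the types of its premisses and conclusions,
together with the coherence of the nesting of boxes. -/
def WF : Prop :=
  (∀ n, S.sort n = .ax → S.prems n = ∅ ∧
    ∃ e f, e ≠ f ∧ S.concls n = {e, f} ∧ S.typ f = (S.typ e).dual) ∧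
  (∀ n, S.sort n = .cut → S.concls n = ∅ ∧
    ∃ e f, e ≠ f ∧ S.prems n = {e, f} ∧ S.typ f = (S.typ e).dual) ∧
  (∀ n, S.sort n = .tens → ∃ e f g, e ≠ f ∧ S.prems n = {e, f} ∧
    S.pIdx e = 0 ∧ S.pIdx f = 1 ∧ S.concls n = {g} ∧
    S.typ g = .tens (S.typ e) (S.typ f)) ∧
  (∀ n, S.sort n = .parr → ∃ e f g, e ≠ f ∧ S.prems n = {e, f} ∧
    S.pIdx e = 0 ∧ S.pIdx f = 1 ∧ S.concls n = {g} ∧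
    S.typ g = .parr (S.typ e) (S.typ f)) ∧
  (∀ n, S.sort n = .one → S.prems n = ∅ ∧ ∃ e, S.concls n = {e} ∧ S.typ e = .one) ∧
  (∀ n, S.sort n = .bot → S.prems n = ∅ ∧ ∃ e, S.concls n = {e} ∧ S.typ e = .bot) ∧
  (∀ n, S.sort n = .sync →
    (∀ e ∈ S.prems n, (S.typ e).Polarized) ∧
    (∀ e ∈ S.prems n, ∃! f, f ∈ S.concls n ∧ S.cIdx f = S.pIdx e) ∧
    (∀ f ∈ S.concls n, ∃! e, e ∈ S.prems n ∧ S.pIdx e = S.cIdx f) ∧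
    (∀ e ∈ S.prems n, ∀ f ∈ S.concls n, S.cIdx f = S.pIdx e → S.typ f = S.typ e)) ∧
  (∀ n b, b ∈ S.boxes n → S.sort b = .bot) ∧
  (∀ n, S.box n = none → S.boxes n = ∅) ∧
  (∀ n b, S.box n = some b → b ∉ S.boxes b ∧ S.boxes n = insert b (S.boxes b)) ∧
  (∀ e n, S.tgt e = some n → S.boxes n ⊆ S.boxes (S.src e))

/-- `b` is the representative of the node `m` in the level-`ℓ` graph (the
graph in which each box strictly below level `ℓ` is collapsed to a single
box-node, identified with its `bot`-link).  For `ℓ = none` this is the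
`0`-graph. -/
def RepAt (ℓ : Option S.Node) (m b : S.Node) : Prop :=
  (S.box m = ℓ ∧ b = m) ∨ (b ∈ S.boxes m ∧ S.box b = ℓ)

/-- Edge `e` joins the nodes `u` and `v` (undirectedly) in the level-`ℓ` graph. -/
def ConnectsAt (ℓ : Option S.Node) (e : S.Edge) (u v : S.Node) : Prop :=
  ∃ t, S.tgt e = some t ∧ (S.box t = ℓ ∨ S.box (S.src e) = ℓ) ∧
    ((S.RepAt ℓ (S.src e) u ∧ S.RepAt ℓ t v) ∨
     (S.RepAt ℓ (S.src e) v ∧ S.RepAt ℓ t u))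

/-- The out-edges of a sync link are its positive conclusions and its negative
premisses. -/
def OutEdgeOf (l : S.Node) (e : S.Edge) : Prop :=
  S.sort l = .sync ∧
  ((S.src e = l ∧ (S.typ e).Positive) ∨ (S.tgt e = some l ∧ (S.typ e).Negative))

/-- There is a switching cycle in the level-`ℓ` graph: a cyclic undirected
simple path which uses at most one of the two premisses of each `⅋`-link and
at most one out-edge of each sync link. -/
def SwitchingCycleAt (ℓ : Option S.Node) : Prop :=
  ∃ (k : ℕ) (v : Fin (k + 1) → S.Node) (e : Fin (k + 1) → S.Edge),
    Function.Injective v ∧ Function.Injective e ∧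
    (∀ i, S.ConnectsAt ℓ (e i) (v i) (v (i + 1))) ∧
    (∀ p, S.sort p = .parr → Set.Subsingleton {i | S.tgt (e i) = some p}) ∧
    (∀ l, S.sort l = .sync → Set.Subsingleton {i | S.OutEdgeOf l (e i)})

/-- Correctness criterion: no switching cycle in the `0`-graph, and,
recursively, no switching cycle in the graph of the content of any box. -/
def Correct : Prop := ∀ ℓ : Option S.Node, ¬ S.SwitchingCycleAt ℓ

/-- A net is a well-formed correct structure. -/
def IsNet : Prop := S.WF ∧ S.Correct

/-! ## Sync paths and hereditary conclusions -/

/-- One step of a sync path: entering a sync link on a premiss and coming out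
on the corresponding conclusion. -/
def SyncStepE (e f : S.Edge) : Prop :=
  ∃ l, S.sort l = .sync ∧ S.tgt e = some l ∧ S.src f = l ∧ S.cIdx f = S.pIdx e

/-- `e` is a hereditary conclusion of the link `l`: there is a sync path from
a conclusion of `l` to `e`. -/
def HereditaryConcl (l : S.Node) (e : S.Edge) : Prop :=
  ∃ f, S.src f = l ∧ Relation.ReflTransGen S.SyncStepE f e

/-- The edge emerges from a box: its source is a `bot`-link (the edge is the
lock of a box) or lies inside some box. -/
def FromBox (e : S.Edge) : Prop := S.sort (S.src e) = .bot ∨ S.box (S.src e) ≠ none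

/-- `e` is a hereditary conclusion of a box. -/
def HereditaryBoxConcl (e : S.Edge) : Prop :=
  ∃ f, S.FromBox f ∧ Relation.ReflTransGen S.SyncStepE f e

/-- A ready cut: a cut at depth 0 neither of whose premisses is a hereditary
conclusion of a box. -/
def ReadyCut (c : S.Node) : Prop :=
  S.sort c = .cut ∧ S.box c = none ∧ ∀ e ∈ S.prems c, ¬ S.HereditaryBoxConcl e

/-! ## Polarized paths and the order on links -/

/-- A node is polarized when all of its conclusions are polarized. -/
def PolarizedNode (n : S.Node) : Prop := ∀ e ∈ S.concls n, (S.typ e).Polarized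

/-- A single step of a polarized path from link `a` to link `b` along the
polarized edge `e`: downwards on positive edges, upwards on negative edges,
connecting polarized nodes and never entering boxes. -/
def PolStep (e : S.Edge) (a b : S.Node) : Prop :=
  S.box a = none ∧ S.box b = none ∧ S.PolarizedNode a ∧ S.PolarizedNode b ∧
  (((S.typ e).Positive ∧ S.src e = a ∧ S.tgt e = some b) ∨
   ((S.typ e).Negative ∧ S.tgt e = some a ∧ S.src e = b))

/-- `a ≺ b` : there is a (simple) polarized path from `a` to `b`. -/
def prec (a b : S.Node) : Prop :=
  ∃ (k : ℕ) (v : Fin (k + 2) → S.Node) (e : Fin (k + 1) → S.Edge),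
    v 0 = a ∧ v (Fin.last _) = b ∧
    Function.Injective v ∧ Function.Injective e ∧
    ∀ i : Fin (k + 1), S.PolStep (e i) (v i.castSucc) (v i.succ)

/-- SMLL⁰ structures: no unit links (hence no boxes). -/
def UnitFree : Prop := ∀ n : S.Node, S.sort n ≠ .one ∧ S.sort n ≠ .bot

/-- Closed structures: no `⊥` occurs in the conclusions. -/
def Closed : Prop := ∀ e : S.Edge, S.tgt e = none → (S.typ e).hasBotB = false

end Struct

/-! ## Reduction -/

/-- A partial injection `j` whose (some-)range is exactly `X`. -/
def PInjOnto {α β : Type*} (j : α → Option β) (X : Set β) : Prop :=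
  (∀ a a' b, j a = some b → j a' = some b → a = a') ∧
  (∀ a b, j a = some b → b ∈ X) ∧
  (∀ b ∈ X, ∃ a, j a = some b)

/-- `j` is total. -/
def JTotal {α β : Type*} (j : α → Option β) : Prop := ∀ a, j a ≠ none

/-- The structures `Q` and `R` agree, along the correspondences `jN`, `jE`,
on all edges outside `XE` and all nodes outside `XN`. -/
def AgreesOn (Q R : Struct) (jN : Q.Node → Option R.Node)
    (jE : Q.Edge → Option R.Edge) (XE : Set R.Edge) (XN : Set R.Node) : Prop :=
  (∀ x y, jE x = some y → y ∉ XE →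
    Q.typ x = R.typ y ∧ jN (Q.src x) = some (R.src y) ∧
    (Q.tgt x).bind jN = R.tgt y ∧ Q.pIdx x = R.pIdx y ∧ Q.cIdx x = R.cIdx y) ∧
  (∀ n m, jN n = some m → m ∉ XN →
    Q.sort n = R.sort m ∧ (Q.box n).bind jN = R.box m ∧
    (∀ b b', jN b = some b' → (b ∈ Q.boxes n ↔ b' ∈ R.boxes m)))

/-- The `ax/cut` step: a cut between a conclusion `v` of an axiom `a` and the
dual premiss is removed together with the axiom; the remaining conclusion `u`
of the axiom and the remaining premiss `q` of the cut are merged. -/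
def AxCutStep (R Q : Struct) : Prop :=
  ∃ (a c : R.Node) (v u q : R.Edge),
    R.sort a = .ax ∧ R.sort c = .cut ∧ R.box a = none ∧ R.box c = none ∧
    v ≠ u ∧ v ≠ q ∧ u ≠ q ∧
    R.concls a = {v, u} ∧ R.prems c = {v, q} ∧
    ∃ (jN : Q.Node → Option R.Node) (jE : Q.Edge → Option R.Edge),
      JTotal jN ∧ JTotal jE ∧
      PInjOnto jN {n | n ≠ a ∧ n ≠ c} ∧
      PInjOnto jE {x | x ≠ v ∧ x ≠ u} ∧
      AgreesOn Q R jN jE {q} ∅ ∧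
      (∀ x, jE x = some q →
        Q.typ x = R.typ q ∧ jN (Q.src x) = some (R.src q) ∧
        (Q.tgt x).bind jN = R.tgt u ∧ Q.pIdx x = R.pIdx u ∧ Q.cIdx x = R.cIdx q)

/-- The `⊗/⅋` step: a cut between `A ⊗ B` and `A⊥ ⅋ B⊥` is replaced by two
cuts between the respective premisses. -/
def TensParrStep (R Q : Struct) : Prop :=
  ∃ (c t p : R.Node) (s s' a1 a2 b1 b2 : R.Edge),
    R.sort c = .cut ∧ R.sort t = .tens ∧ R.sort p = .parr ∧
    R.box c = none ∧ R.box t = none ∧ R.box p = none ∧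
    s ≠ s' ∧ R.prems c = {s, s'} ∧ R.concls t = {s} ∧ R.concls p = {s'} ∧
    a1 ≠ a2 ∧ R.prems t = {a1, a2} ∧ R.pIdx a1 = 0 ∧ R.pIdx a2 = 1 ∧
    b1 ≠ b2 ∧ R.prems p = {b1, b2} ∧ R.pIdx b1 = 0 ∧ R.pIdx b2 = 1 ∧
    ∃ (jN : Q.Node → Option R.Node) (jE : Q.Edge → Option R.Edge) (c' : Q.Node),
      JTotal jE ∧
      PInjOnto jN {n | n ≠ t ∧ n ≠ p} ∧
      PInjOnto jE {x | x ≠ s ∧ x ≠ s'} ∧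
      jN c' = none ∧ (∀ n, jN n = none → n = c') ∧
      Q.sort c' = .cut ∧ Q.box c' = none ∧ Q.boxes c' = ∅ ∧
      AgreesOn Q R jN jE {a1, a2, b1, b2} ∅ ∧
      (∀ x y, jE x = some y → y = a1 ∨ y = b1 →
        Q.typ x = R.typ y ∧ jN (Q.src x) = some (R.src y) ∧
        (Q.tgt x).bind jN = some c ∧ Q.cIdx x = R.cIdx y) ∧
      (∀ x y, jE x = some y → y = a2 ∨ y = b2 →
        Q.typ x = R.typ y ∧ jN (Q.src x) = some (R.src y) ∧
        Q.tgt x = some c' ∧ Q.cIdx x = R.cIdx y)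

/-- Commutation of a sync link with a `⊗` or `⅋` link: the sync link acting
on the conclusion `z` of the multiplicative link `m` (with corresponding sync
conclusion `w`) is pushed above `m`, now acting on the two premisses `x`, `y`
of `m` via two fresh sync positions (indices `i₁`, `i₂`) with fresh edges
`x'`, `y'`. -/
def SyncMultStep (R Q : Struct) : Prop :=
  ∃ (l m : R.Node) (z w x y : R.Edge) (i₁ i₂ : ℕ),
    R.sort l = .sync ∧ (R.sort m = .tens ∨ R.sort m = .parr) ∧
    R.box l = none ∧ R.box m = none ∧
    R.src z = m ∧ R.tgt z = some l ∧ R.src w = l ∧ R.cIdx w = R.pIdx z ∧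
    x ≠ y ∧ R.prems m = {x, y} ∧ R.pIdx x = 0 ∧ R.pIdx y = 1 ∧
    i₁ ≠ i₂ ∧
    (∀ e, R.tgt e = some l → R.pIdx e ≠ i₁ ∧ R.pIdx e ≠ i₂) ∧
    (∀ e, R.src e = l → R.cIdx e ≠ i₁ ∧ R.cIdx e ≠ i₂) ∧
    ∃ (jN : Q.Node → Option R.Node) (jE : Q.Edge → Option R.Edge)
      (l' m' : Q.Node) (x' y' : Q.Edge),
      JTotal jN ∧ PInjOnto jN Set.univ ∧
      PInjOnto jE {e | e ≠ z} ∧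
      jN l' = some l ∧ jN m' = some m ∧
      x' ≠ y' ∧ jE x' = none ∧ jE y' = none ∧ (∀ e, jE e = none → e = x' ∨ e = y') ∧
      AgreesOn Q R jN jE {x, y, w} ∅ ∧
      (∀ e, jE e = some x →
        Q.typ e = R.typ x ∧ jN (Q.src e) = some (R.src x) ∧
        Q.tgt e = some l' ∧ Q.pIdx e = i₁ ∧ Q.cIdx e = R.cIdx x) ∧
      (∀ e, jE e = some y →
        Q.typ e = R.typ y ∧ jN (Q.src e) = some (R.src y) ∧
        Q.tgt e = some l' ∧ Q.pIdx e = i₂ ∧ Q.cIdx e = R.cIdx y) ∧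
      (∀ e, jE e = some w →
        Q.typ e = R.typ w ∧ Q.src e = m' ∧
        (Q.tgt e).bind jN = R.tgt w ∧ Q.pIdx e = R.pIdx w ∧ Q.cIdx e = R.cIdx w) ∧
      (Q.typ x' = R.typ x ∧ Q.src x' = l' ∧ Q.tgt x' = some m' ∧
        Q.pIdx x' = 0 ∧ Q.cIdx x' = i₁) ∧
      (Q.typ y' = R.typ y ∧ Q.src y' = l' ∧ Q.tgt y' = some m' ∧
        Q.pIdx y' = 1 ∧ Q.cIdx y' = i₂)

/-- Commutation of a sync link with an axiom: a sync link acting on a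
positive conclusion `u` of an axiom (with corresponding conclusion `u'`) is
moved to the axiom's other conclusion `v` (of type `P⊥`), with a fresh sync
position of index `j` and fresh edge `v'`. -/
def SyncAxStep (R Q : Struct) : Prop :=
  ∃ (l a : R.Node) (u u' v : R.Edge) (j : ℕ),
    R.sort l = .sync ∧ R.sort a = .ax ∧ R.box l = none ∧ R.box a = none ∧
    (R.typ u).Positive ∧ u ≠ v ∧ R.concls a = {u, v} ∧
    R.tgt u = some l ∧ R.src u' = l ∧ R.cIdx u' = R.pIdx u ∧ u' ≠ u ∧ u' ≠ v ∧
    (∀ e, R.tgt e = some l → R.pIdx e ≠ j) ∧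
    (∀ e, R.src e = l → R.cIdx e ≠ j) ∧
    ∃ (jN : Q.Node → Option R.Node) (jE : Q.Edge → Option R.Edge)
      (l' a' : Q.Node) (v' : Q.Edge),
      JTotal jN ∧ PInjOnto jN Set.univ ∧ PInjOnto jE {e | e ≠ u} ∧
      jN l' = some l ∧ jN a' = some a ∧
      jE v' = none ∧ (∀ e, jE e = none → e = v') ∧
      AgreesOn Q R jN jE {u', v} ∅ ∧
      (∀ e, jE e = some u' →
        Q.typ e = R.typ u' ∧ Q.src e = a' ∧ Q.cIdx e = R.cIdx u ∧
        (Q.tgt e).bind jN = R.tgt u' ∧ Q.pIdx e = R.pIdx u') ∧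
      (∀ e, jE e = some v →
        Q.typ e = R.typ v ∧ Q.src e = a' ∧ Q.cIdx e = R.cIdx v ∧
        Q.tgt e = some l' ∧ Q.pIdx e = j) ∧
      (Q.typ v' = R.typ v ∧ Q.src v' = l' ∧ Q.cIdx v' = j ∧
        (Q.tgt v').bind jN = R.tgt v ∧ Q.pIdx v' = R.pIdx v)

/-- Commutation of a sync link with a cut: a sync link acting on the premiss
`d'` (of negative type `P⊥`) of a cut is moved to the other premiss `q`. -/
def SyncCutStep (R Q : Struct) : Prop :=
  ∃ (l c : R.Node) (d d' q : R.Edge) (j : ℕ),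
    R.sort l = .sync ∧ R.sort c = .cut ∧ R.box l = none ∧ R.box c = none ∧
    (R.typ d').Negative ∧
    R.src d' = l ∧ R.tgt d' = some c ∧ R.tgt d = some l ∧ R.pIdx d = R.cIdx d' ∧
    d' ≠ q ∧ d ≠ q ∧ d ≠ d' ∧ R.prems c = {d', q} ∧
    (∀ e, R.tgt e = some l → R.pIdx e ≠ j) ∧
    (∀ e, R.src e = l → R.cIdx e ≠ j) ∧
    ∃ (jN : Q.Node → Option R.Node) (jE : Q.Edge → Option R.Edge)
      (l' c' : Q.Node) (q' : Q.Edge),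
      JTotal jN ∧ PInjOnto jN Set.univ ∧ PInjOnto jE {e | e ≠ d'} ∧
      jN l' = some l ∧ jN c' = some c ∧
      jE q' = none ∧ (∀ e, jE e = none → e = q') ∧
      AgreesOn Q R jN jE {d, q} ∅ ∧
      (∀ e, jE e = some d →
        Q.typ e = R.typ d ∧ jN (Q.src e) = some (R.src d) ∧ Q.cIdx e = R.cIdx d ∧
        Q.tgt e = some c' ∧ Q.pIdx e = R.pIdx d') ∧
      (∀ e, jE e = some q →
        Q.typ e = R.typ q ∧ jN (Q.src e) = some (R.src q) ∧ Q.cIdx e = R.cIdx q ∧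
        Q.tgt e = some l' ∧ Q.pIdx e = j) ∧
      (Q.typ q' = R.typ q ∧ Q.src q' = l' ∧ Q.cIdx q' = j ∧
        Q.tgt q' = some c' ∧ Q.pIdx q' = R.pIdx q)

/-- Sync elimination: a sync link all of whose premisses are conclusions of
`one`-links is erased, merging each premiss with its corresponding
conclusion. -/
def SyncElimStep (R Q : Struct) : Prop :=
  ∃ l : R.Node, R.sort l = .sync ∧ R.box l = none ∧
    (∀ e ∈ R.prems l, R.sort (R.src e) = .one) ∧
    ∃ (jN : Q.Node → Option R.Node) (jE : Q.Edge → Option R.Edge),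
      JTotal jN ∧ JTotal jE ∧
      PInjOnto jN {n | n ≠ l} ∧
      PInjOnto jE {e | R.src e ≠ l} ∧
      AgreesOn Q R jN jE {e | R.tgt e = some l} ∅ ∧
      (∀ x e f, jE x = some e → R.tgt e = some l → R.src f = l →
        R.cIdx f = R.pIdx e →
        Q.typ x = R.typ e ∧ jN (Q.src x) = some (R.src e) ∧
        (Q.tgt x).bind jN = R.tgt f ∧ Q.pIdx x = R.pIdx f ∧ Q.cIdx x = R.cIdx e)

/-- The `one/⊥` step (box opening): a cut between the conclusion `o` of a
`one`-link `n₁` and the lock `k` of a box `b` removes the cut, the `one`-link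
and the `bot`-link, and opens the box. -/
def OneBotStep (R Q : Struct) : Prop :=
  ∃ (c n₁ b : R.Node) (o k : R.Edge),
    R.sort c = .cut ∧ R.sort n₁ = .one ∧ R.sort b = .bot ∧
    R.box c = none ∧ R.box n₁ = none ∧ R.box b = none ∧
    o ≠ k ∧ R.prems c = {o, k} ∧ R.src o = n₁ ∧ R.src k = b ∧
    ∃ (jN : Q.Node → Option R.Node) (jE : Q.Edge → Option R.Edge),
      JTotal jN ∧ JTotal jE ∧
      PInjOnto jN {n | n ≠ c ∧ n ≠ n₁ ∧ n ≠ b} ∧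
      PInjOnto jE {e | e ≠ o ∧ e ≠ k} ∧
      (∀ x e, jE x = some e →
        Q.typ x = R.typ e ∧ jN (Q.src x) = some (R.src e) ∧
        (Q.tgt x).bind jN = R.tgt e ∧ Q.pIdx x = R.pIdx e ∧ Q.cIdx x = R.cIdx e) ∧
      (∀ n m, jN n = some m →
        Q.sort n = R.sort m ∧
        (∀ b₀ b₀', jN b₀ = some b₀' → (b₀ ∈ Q.boxes n ↔ b₀' ∈ R.boxes m ∧ b₀' ≠ b)) ∧
        (R.box m = some b → Q.box n = none) ∧
        (R.box m ≠ some b → (Q.box n).bind jN = R.box m))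

/-- The sync-commutation and sync-elimination steps. -/
def SyncRed (R Q : Struct) : Prop :=
  SyncMultStep R Q ∨ SyncAxStep R Q ∨ SyncCutStep R Q ∨ SyncElimStep R Q

/-- The reduction relation `→` on SMLL structures (applied at depth 0 only). -/
def Step (R Q : Struct) : Prop :=
  AxCutStep R Q ∨ TensParrStep R Q ∨ SyncRed R Q ∨ OneBotStep R Q

/-- Isomorphism of structures. -/
def Isom (R Q : Struct) : Prop :=
  ∃ (en : R.Node ≃ Q.Node) (ee : R.Edge ≃ Q.Edge),
    (∀ e, Q.typ (ee e) = R.typ e) ∧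
    (∀ e, Q.src (ee e) = en (R.src e)) ∧
    (∀ e, Q.tgt (ee e) = (R.tgt e).map en) ∧
    (∀ e, Q.pIdx (ee e) = R.pIdx e) ∧
    (∀ e, Q.cIdx (ee e) = R.cIdx e) ∧
    (∀ n, Q.sort (en n) = R.sort n) ∧
    (∀ n, Q.box (en n) = (R.box n).map en) ∧
    (∀ n, Q.boxes (en n) = (R.boxes n).image en)

/-! ## The SIAM: a synchronous interaction abstract machine -/

namespace Struct

variable (S : Struct)

/-- The value of a token: either an occurrence of an atom on an edge, or a
position `(e, i)` on the lock `e` of a box (`BOTBOX`). -/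
inductive PosVal (S : Struct) : Type
  | atom : S.Edge → Formula.Addr → PosVal S
  | lock : S.Edge → ℕ → PosVal S

/-- Initial positions: negative atom occurrences in the conclusions. -/
def InitPos (p : S.Edge × Formula.Addr) : Prop :=
  S.tgt p.1 = none ∧ Formula.NegOcc (S.typ p.1) p.2

/-- Final positions: positive atom occurrences in the conclusions. -/
def FinPos (p : S.Edge × Formula.Addr) : Prop :=
  S.tgt p.1 = none ∧ Formula.PosOcc (S.typ p.1) p.2

/-- One positions: conclusions of `one`-links. -/
def OnePos (p : S.Edge × Formula.Addr) : Prop :=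
  S.sort (S.src p.1) = .one ∧ p.2 = []

/-- Valid token values: genuine atom occurrences, or positions on the lock of
a box. -/
def ValidVal : PosVal S → Prop
  | .atom e m => Formula.AtomOcc (S.typ e) m
  | .lock e _ => S.sort (S.src e) = .bot

end Struct

/-- A state of the SIAM machine `M_S`: a (partial) function from
`INIT(S) ∪ L` (with `L ⊆ ONES(S)`) to the positions of `S`; it records, for
each token, its origin and its current position. -/
structure SState (S : Struct) where
  f : S.Edge × Formula.Addr → Option (Struct.PosVal S)
  dom_subset : ∀ p, f p ≠ none → S.InitPos p ∨ S.OnePos p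
  init_total : ∀ p, S.InitPos p → f p ≠ none
  val_valid : ∀ p v, f p = some v → S.ValidVal v

namespace Struct

variable (S : Struct)

/-- The box `b` is unlocked in state `T`: some token sits on its lock. -/
def Unlocked (T : SState S) (b : S.Node) : Prop :=
  ∃ p e i, T.f p = some (.lock e i) ∧ S.src e = b

/-- A link is active: all the boxes containing it are unlocked. -/
def Active (T : SState S) (n : S.Node) : Prop :=
  ∀ b ∈ S.boxes n, S.Unlocked T b

end Struct

open Classical in
/-- The initial state `I_S`: the identity on the initial positions. -/
noncomputable def initState (S : Struct) : SState S where
  f := fun p => if S.InitPos p then some (.atom p.1 p.2) else none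
  dom_subset := by
    intro p hp
    by_cases h : S.InitPos p
    · exact Or.inl h
    · simp [h] at hp
  init_total := by intro p hp; simp [hp]
  val_valid := by
    intro p v hv
    by_cases h : S.InitPos p
    · simp only [if_pos h, Option.some.injEq] at hv
      subst hv
      exact h.2.atomOcc
    · simp [h] at hv

/-- The transition relation of the SIAM.  Tokens on negative atom occurrences
move upwards, tokens on positive atom occurrences move downwards; all tokens
cross a sync link simultaneously, when each of its in-edges is saturated;
active `one`-links may spawn a token; a token reaching the lock of a box
unlocks it.  Tokens may only cross active links (so they can enter a box only
when it is unlocked). -/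
inductive STrans (S : Struct) : SState S → SState S → Prop
  | axUp {T T' : SState S} {p : S.Edge × Formula.Addr} {e e' : S.Edge}
      {m : Formula.Addr} {a : S.Node} :
      T.f p = some (.atom e m) →
      Formula.NegOcc (S.typ e) m →
      S.src e = a → S.sort a = .ax → S.Active T a →
      S.src e' = a → e' ≠ e →
      (∀ q, q ≠ p → T'.f q = T.f q) →
      T'.f p = some (.atom e' m) →
      STrans S T T'
  | cutDown {T T' : SState S} {p : S.Edge × Formula.Addr} {e e' : S.Edge}
      {m : Formula.Addr} {c : S.Node} :
      T.f p = some (.atom e m) →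
      Formula.PosOcc (S.typ e) m →
      S.tgt e = some c → S.sort c = .cut → S.Active T c →
      S.tgt e' = some c → e' ≠ e →
      (∀ q, q ≠ p → T'.f q = T.f q) →
      T'.f p = some (.atom e' m) →
      STrans S T T'
  | multDown {T T' : SState S} {p : S.Edge × Formula.Addr} {e g : S.Edge}
      {m : Formula.Addr} {n : S.Node} {b : Bool} :
      T.f p = some (.atom e m) →
      Formula.PosOcc (S.typ e) m →
      S.tgt e = some n → (S.sort n = .tens ∨ S.sort n = .parr) → S.Active T n →
      S.src g = n →
      S.pIdx e = (if b then 1 else 0) →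
      (∀ q, q ≠ p → T'.f q = T.f q) →
      T'.f p = some (.atom g (b :: m)) →
      STrans S T T'
  | multUp {T T' : SState S} {p : S.Edge × Formula.Addr} {e g : S.Edge}
      {m : Formula.Addr} {n : S.Node} {b : Bool} :
      T.f p = some (.atom g (b :: m)) →
      Formula.NegOcc (S.typ g) (b :: m) →
      S.src g = n → (S.sort n = .tens ∨ S.sort n = .parr) → S.Active T n →
      S.tgt e = some n →
      S.pIdx e = (if b then 1 else 0) →
      (∀ q, q ≠ p → T'.f q = T.f q) →
      T'.f p = some (.atom e m) →
      STrans S T T'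
  | lockTok {T T' : SState S} {p : S.Edge × Formula.Addr} {e : S.Edge}
      {b' : S.Node} :
      T.f p = some (.atom e []) →
      S.typ e = .bot →
      S.src e = b' → S.sort b' = .bot → S.Active T b' →
      (∀ q, q ≠ p → T'.f q = T.f q) →
      T'.f p = some (.lock e 0) →
      STrans S T T'
  | oneSpawn {T T' : SState S} {n : S.Node} {e : S.Edge} :
      S.sort n = .one → S.Active T n → S.src e = n →
      T.f (e, []) = none →
      (∀ q, q ≠ (e, []) → T'.f q = T.f q) →
      T'.f (e, []) = some (.atom e []) →
      STrans S T T'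
  | syncCross {T T' : SState S} {l : S.Node} :
      S.sort l = .sync → S.Active T l →
      (∃ q e m, T.f q = some (.atom e m) ∧
        ((S.tgt e = some l ∧ (S.typ e).Positive) ∨
         (S.src e = l ∧ (S.typ e).Negative))) →
      (∀ e, ((S.tgt e = some l ∧ (S.typ e).Positive) ∨
             (S.src e = l ∧ (S.typ e).Negative)) →
        ∀ m, Formula.AtomOcc (S.typ e) m → ∃ q, T.f q = some (.atom e m)) →
      (∀ q e m, T.f q = some (.atom e m) → S.tgt e = some l → (S.typ e).Positive →
        ∃ e', S.src e' = l ∧ S.cIdx e' = S.pIdx e ∧ T'.f q = some (.atom e' m)) →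
      (∀ q e m, T.f q = some (.atom e m) → S.src e = l → (S.typ e).Negative →
        ∃ e', S.tgt e' = some l ∧ S.pIdx e' = S.cIdx e ∧ T'.f q = some (.atom e' m)) →
      (∀ q, (∀ e m, T.f q = some (.atom e m) →
          ¬(S.tgt e = some l ∧ (S.typ e).Positive) ∧
          ¬(S.src e = l ∧ (S.typ e).Negative)) →
        T'.f q = T.f q) →
      STrans S T T'

/-- A final state: its image consists of all the final positions together
with positions on the locks of boxes. -/
def SState.Final {S : Struct} (T : SState S) : Prop :=
  (∀ q v, T.f q = some v →
    (∃ e m, v = .atom e m ∧ S.FinPos (e, m)) ∨ (∃ e i, v = .lock e i)) ∧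
  (∀ e m, S.FinPos (e, m) → ∃ q, T.f q = some (.atom e m))

/-- The machine of `S` deadlocks: some maximal transition sequence from the
initial state ends in a non-final state. -/
def Deadlocks (S : Struct) : Prop :=
  ∃ T : SState S, Relation.ReflTransGen (STrans S) (initState S) T ∧
    (∀ T', ¬ STrans S T T') ∧ ¬ T.Final

/-- The machine of `S` is deadlock free: every maximal transition sequence
from the initial state ends in a final state. -/
def DeadlockFree (S : Struct) : Prop :=
  ∀ T : SState S, Relation.ReflTransGen (STrans S) (initState S) T →
    (∀ T', ¬ STrans S T T') → T.Final

/-! ## The closure of a net -/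

/-- A structure with a designated (main) conclusion. -/
structure PNet : Type 1 where
  S : Struct
  main : S.Edge

/-- The net consisting of a single `one`-link. -/
def oneNet : PNet where
  S :=
    { Edge := Unit
      Node := Unit
      edgeFintype := inferInstance
      nodeFintype := inferInstance
      edgeDecEq := inferInstance
      nodeDecEq := inferInstance
      typ := fun _ => .one
      sort := fun _ => .one
      src := fun _ => ()
      tgt := fun _ => none
      pIdx := fun _ => 0
      cIdx := fun _ => 0
      box := fun _ => none
      boxes := fun _ => ∅ }
  main := ()

/-- The net consisting of a single axiom of conclusions `A⊥, A`, with main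
conclusion `A`. -/
def axNet (A : Formula) : PNet where
  S :=
    { Edge := Bool
      Node := Unit
      edgeFintype := inferInstance
      nodeFintype := inferInstance
      edgeDecEq := inferInstance
      nodeDecEq := inferInstance
      typ := fun e => if e then A else A.dual
      sort := fun _ => .ax
      src := fun _ => ()
      tgt := fun _ => none
      pIdx := fun _ => 0
      cIdx := fun e => if e then 1 else 0
      box := fun _ => none
      boxes := fun _ => ∅ }
  main := true

/-- Joining the main conclusions of two nets by a binary link of sort `s`
and conclusion type `C`. -/
def joinNet (s : LinkSort) (C : Formula) (P Q : PNet) : PNet where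
  S :=
    { Edge := Option (P.S.Edge ⊕ Q.S.Edge)
      Node := Option (P.S.Node ⊕ Q.S.Node)
      edgeFintype := inferInstance
      nodeFintype := inferInstance
      edgeDecEq := inferInstance
      nodeDecEq := inferInstance
      typ := fun e =>
        match e with
        | none => C
        | some (.inl x) => P.S.typ x
        | some (.inr y) => Q.S.typ y
      sort := fun n =>
        match n with
        | none => s
        | some (.inl x) => P.S.sort x
        | some (.inr y) => Q.S.sort y
      src := fun e =>
        match e with
        | none => none
        | some (.inl x) => some (.inl (P.S.src x))
        | some (.inr y) => some (.inr (Q.S.src y))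
      tgt := fun e =>
        match e with
        | none => none
        | some (.inl x) =>
            if x = P.main then some none
            else (P.S.tgt x).map fun n => some (.inl n)
        | some (.inr y) =>
            if y = Q.main then some none
            else (Q.S.tgt y).map fun n => some (.inr n)
      pIdx := fun e =>
        match e with
        | none => 0
        | some (.inl x) => if x = P.main then 0 else P.S.pIdx x
        | some (.inr y) => if y = Q.main then 1 else Q.S.pIdx y
      cIdx := fun e =>
        match e with
        | none => 0
        | some (.inl x) => P.S.cIdx x
        | some (.inr y) => Q.S.cIdx y
      box := fun n =>
        match n with
        | none => none
        | some (.inl x) => (P.S.box x).map fun m => some (.inl m)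
        | some (.inr y) => (Q.S.box y).map fun m => some (.inr m)
      boxes := fun n =>
        match n with
        | none => ∅
        | some (.inl x) => (P.S.boxes x).image fun m => some (.inl m)
        | some (.inr y) => (Q.S.boxes y).image fun m => some (.inr m) }
  main := none

/-- The net `R°(A)`, by induction on `A`: it has conclusions `Γ, A` with no
occurrence of `⊥` in `Γ`, and main conclusion `A`. -/
def circNet : Formula → PNet
  | .one => oneNet
  | .bot => axNet .bot
  | .var n => axNet (.var n)
  | .covar n => axNet (.covar n)
  | .tens A B => joinNet .tens (.tens A B) (circNet A) (circNet B)
  | .parr A B => joinNet .parr (.parr A B) (circNet A) (circNet B)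

/-- The conclusions of `R` containing an occurrence of `⊥`. -/
abbrev BadC (R : Struct) :=
  {e : R.Edge // R.tgt e = none ∧ (R.typ e).hasBotB = true}

/-- The closure `R̂` of `R`: each conclusion `A` of `R` containing `⊥` is cut
against the main conclusion of a copy of `R°(A⊥)`. -/
def netClosure (R : Struct) : Struct where
  Edge := R.Edge ⊕ Σ e : BadC R, (circNet (R.typ e.val).dual).S.Edge
  Node := R.Node ⊕ ((Σ e : BadC R, (circNet (R.typ e.val).dual).S.Node) ⊕ BadC R)
  edgeFintype := inferInstance
  nodeFintype := inferInstance
  edgeDecEq := inferInstance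
  nodeDecEq := inferInstance
  typ := fun e =>
    match e with
    | .inl e => R.typ e
    | .inr ⟨b, x⟩ => (circNet (R.typ b.val).dual).S.typ x
  sort := fun n =>
    match n with
    | .inl n => R.sort n
    | .inr (.inl ⟨b, x⟩) => (circNet (R.typ b.val).dual).S.sort x
    | .inr (.inr _) => .cut
  src := fun e =>
    match e with
    | .inl e => .inl (R.src e)
    | .inr ⟨b, x⟩ => .inr (.inl ⟨b, (circNet (R.typ b.val).dual).S.src x⟩)
  tgt := fun e =>
    match e with
    | .inl e =>
        if h : R.tgt e = none ∧ (R.typ e).hasBotB = true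
        then some (.inr (.inr ⟨e, h⟩))
        else (R.tgt e).map Sum.inl
    | .inr ⟨b, x⟩ =>
        if x = (circNet (R.typ b.val).dual).main
        then some (.inr (.inr b))
        else ((circNet (R.typ b.val).dual).S.tgt x).map fun n => .inr (.inl ⟨b, n⟩)
  pIdx := fun e =>
    match e with
    | .inl e => R.pIdx e
    | .inr ⟨b, x⟩ =>
        if x = (circNet (R.typ b.val).dual).main then 1
        else (circNet (R.typ b.val).dual).S.pIdx x
  cIdx := fun e =>
    match e with
    | .inl e => R.cIdx e
    | .inr ⟨b, x⟩ => (circNet (R.typ b.val).dual).S.cIdx x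
  box := fun n =>
    match n with
    | .inl n => (R.box n).map Sum.inl
    | .inr (.inl ⟨b, x⟩) =>
        ((circNet (R.typ b.val).dual).S.box x).map fun m => .inr (.inl ⟨b, m⟩)
    | .inr (.inr _) => none
  boxes := fun n =>
    match n with
    | .inl n => (R.boxes n).image Sum.inl
    | .inr (.inl ⟨b, x⟩) =>
        ((circNet (R.typ b.val).dual).S.boxes x).image fun m => .inr (.inl ⟨b, m⟩)
    | .inr (.inr _) => ∅

set_option linter.unusedSectionVars false

section Generic
variable {V E : Type} [Fintype E] [DecidableEq V] [DecidableEq E]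

theorem z2_ne {x : ZMod 2} (h : x ≠ 0) : x = 1 := by revert x; decide
theorem z2_self (x : ZMod 2) : x + x = 0 := by revert x; decide

/-- mod 2 boundary of an edge set -/
def gbd (s t : E → V) (c : E → ZMod 2) (n : V) : ZMod 2 :=
  ∑ e, ((if s e = n then c e else 0) + (if t e = n then c e else 0))

def GAdj (s t : E → V) (d : E → ZMod 2) (u v : V) : Prop :=
  ∃ e, d e ≠ 0 ∧ ((s e = u ∧ t e = v) ∨ (s e = v ∧ t e = u))

theorem gbd_sum (s t : E → V) (c : E → ZMod 2) (K : Finset V) :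
    ∑ n ∈ K, gbd s t c n =
      ∑ e, ((if s e ∈ K then c e else 0) + (if t e ∈ K then c e else 0)) := by
  unfold gbd
  rw [Finset.sum_comm]
  refine Finset.sum_congr rfl fun e _ => ?_
  rw [Finset.sum_add_distrib]
  simp [Finset.sum_ite_eq]

theorem gbd_add (s t : E → V) (c d : E → ZMod 2) (n : V) :
    gbd s t (fun e => c e + d e) n = gbd s t c n + gbd s t d n := by
  unfold gbd
  rw [← Finset.sum_add_distrib]
  refine Finset.sum_congr rfl fun e _ => ?_
  split_ifs <;> ring

theorem gbd_single (s t : E → V) (e0 : E) (n : V) :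
    gbd s t (fun e => if e = e0 then 1 else 0) n =
      (if s e0 = n then 1 else 0) + (if t e0 = n then 1 else 0) := by
  unfold gbd
  rw [Finset.sum_eq_single e0]
  · simp
  · intro b _ hb; simp [hb]
  · simp

theorem gbd_reach [Fintype V] (s t : E → V) (d : E → ZMod 2) (x : V) (hx : gbd s t d x ≠ 0) :
    ∃ y, y ≠ x ∧ gbd s t d y ≠ 0 ∧ Relation.ReflTransGen (GAdj s t d) x y := by
  classical
  by_contra hcon
  push Not at hcon
  let K : Finset V := Finset.univ.filter fun y => Relation.ReflTransGen (GAdj s t d) x y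
  have h1 : ∑ n ∈ K, gbd s t d n = gbd s t d x := by
    apply Finset.sum_eq_single_of_mem
    · simp [K, Relation.ReflTransGen.refl]
    · intro b hb hbx
      by_contra h
      exact hcon b hbx h (by simpa [K] using hb)
  rw [gbd_sum] at h1
  apply hx
  rw [← h1]
  apply Finset.sum_eq_zero
  intro e _
  by_cases hd : d e = 0
  · simp [hd]
  have : s e ∈ K ↔ t e ∈ K := by
    simp only [K, Finset.mem_filter, Finset.mem_univ, true_and]
    exact ⟨fun h => h.tail ⟨e, hd, Or.inl ⟨rfl, rfl⟩⟩, fun h => h.tail ⟨e, hd, Or.inr ⟨rfl, rfl⟩⟩⟩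
  by_cases h : s e ∈ K
  · simp [h, this.1 h, z2_self]
  · simp [h, mt this.2 h]

theorem gbd_path (s t : E → V) (d : E → ZMod 2) (x y : V)
    (h : Relation.ReflTransGen (GAdj s t d) x y) :
    ∃ p : E → ZMod 2, (∀ e, p e ≠ 0 → d e ≠ 0) ∧
      ∀ n, gbd s t p n = (if x = n then 1 else 0) + (if y = n then 1 else 0) := by
  induction h with
  | refl => exact ⟨fun _ => 0, by simp, by intro n; simp [gbd, z2_self]⟩
  | @tail b c _ hbc ih =>
    obtain ⟨p, hp, hb⟩ := ih
    obtain ⟨e, he, hst⟩ := hbc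
    refine ⟨fun e' => p e' + if e' = e then 1 else 0, ?_, ?_⟩
    · intro e' h
      by_cases hh : e' = e
      · exact hh ▸ he
      · exact hp e' (by simpa [hh] using h)
    · intro n
      rw [gbd_add, hb, gbd_single]
      rcases hst with ⟨rfl, rfl⟩ | ⟨rfl, rfl⟩ <;> split_ifs <;> decide

/-- extraction of a simple cycle from a nonempty even edge set -/
theorem gbd_cycle [Fintype V] (s t : E → V) (c : E → ZMod 2) (hc : ∀ n, gbd s t c n = 0)
    (e0 : E) (he0 : c e0 ≠ 0) :
    ∃ (k : ℕ) (v : Fin (k + 1) → V) (e : Fin (k + 1) → E),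
      Function.Injective v ∧ Function.Injective e ∧ (∀ i, c (e i) ≠ 0) ∧
      ∀ i, (s (e i) = v i ∧ t (e i) = v (i + 1)) ∨ (s (e i) = v (i + 1) ∧ t (e i) = v i) := by
  classical
  by_cases hst : s e0 = t e0
  · refine ⟨0, fun _ => s e0, fun _ => e0, fun a b _ => Fin.ext (by omega),
      fun a b _ => Fin.ext (by omega), fun _ => he0, fun _ => Or.inl ⟨rfl, hst.symm⟩⟩
  let d : E → ZMod 2 := fun e => c e + if e = e0 then 1 else 0
  have hd : ∀ n, gbd s t d n = (if s e0 = n then 1 else 0) + (if t e0 = n then 1 else 0) := by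
    intro n; rw [gbd_add, hc, gbd_single, zero_add]
  have hde : ∀ e, d e ≠ 0 → c e ≠ 0 ∧ e ≠ e0 := by
    intro e h
    by_cases hh : e = e0
    · subst hh; simp only [d, if_true, z2_ne he0] at h; exact absurd (z2_self 1) h
    · exact ⟨by simpa [d, hh] using h, hh⟩
  obtain ⟨y, hy1, hy2, hy3⟩ := gbd_reach s t d (t e0) (by rw [hd]; simp [hst])
  have hy : y = s e0 := by
    rw [hd] at hy2
    by_contra h
    simp [Ne.symm h, Ne.symm hy1] at hy2
  subst hy
  let G : SimpleGraph V := SimpleGraph.fromRel (GAdj s t d)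
  have hreach : G.Reachable (t e0) (s e0) := by
    clear hy1 hy2
    generalize s e0 = y0 at hy3
    induction hy3 with
    | refl => exact SimpleGraph.Reachable.refl _
    | @tail b c' _ hbc ih =>
      refine ih.trans ?_
      by_cases hb : b = c'
      · subst hb; exact SimpleGraph.Reachable.refl _
      · exact SimpleGraph.Adj.reachable (by simp [G, SimpleGraph.fromRel_adj, hb, hbc])
  obtain ⟨p, hp⟩ := hreach.exists_isPath
  have hE : ∀ i, i < p.length → ∃ e, d e ≠ 0 ∧
      ((s e = p.getVert i ∧ t e = p.getVert (i+1)) ∨ (s e = p.getVert (i+1) ∧ t e = p.getVert i)) := by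
    intro i hi
    have := p.adj_getVert_succ hi
    simp only [G, SimpleGraph.fromRel_adj, GAdj] at this
    rcases this with ⟨_, ⟨e, he, h⟩ | ⟨e, he, h⟩⟩
    · exact ⟨e, he, h⟩
    · exact ⟨e, he, h.symm⟩
  haveI : Nonempty E := ⟨e0⟩
  choose! ee hee1 hee2 using hE
  have hinj : ∀ i j, i ≤ p.length → j ≤ p.length → p.getVert i = p.getVert j → i = j :=
    fun i j hi hj h => hp.getVert_injOn (by simpa using hi) (by simpa using hj) h
  refine ⟨p.length, fun i => p.getVert i, fun i => if (i : ℕ) < p.length then ee i else e0,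
    ?_, ?_, ?_, ?_⟩
  · intro i j h
    exact Fin.ext (hinj i j (by omega) (by omega) h)
  · intro i j h
    have hi := i.2
    have hj := j.2
    simp only at h
    apply Fin.ext
    split_ifs at h with h1 h2 h2
    · have a := hee2 i h1
      have b := hee2 j h2
      rw [h] at a
      have key : ∀ a b, a ≤ p.length → b ≤ p.length → p.getVert a = p.getVert b → a = b := hinj
      rcases a with ⟨a1, a2⟩ | ⟨a1, a2⟩ <;> rcases b with ⟨b1, b2⟩ | ⟨b1, b2⟩
      · exact key _ _ (by omega) (by omega) (a1.symm.trans b1)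
      · have := key _ _ (by omega) (by omega) (a1.symm.trans b1)
        have := key _ _ (by omega) (by omega) (a2.symm.trans b2)
        omega
      · have := key _ _ (by omega) (by omega) (a1.symm.trans b1)
        have := key _ _ (by omega) (by omega) (a2.symm.trans b2)
        omega
      · exact key _ _ (by omega) (by omega) (a2.symm.trans b2)
    · exact absurd h (hde _ (hee1 i h1)).2
    · exact absurd h.symm (hde _ (hee1 j h2)).2
    · omega
  · intro i
    simp only
    split_ifs with h
    · exact (hde _ (hee1 i h)).1
    · exact he0
  · intro i
    simp only
    split_ifs with h
    · have : ((i + 1 : Fin (p.length + 1)) : ℕ) = i + 1 := by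
        rw [Fin.val_add_one_of_lt' (by omega)]
      rw [this]
      exact hee2 i h
    · have hi : i = Fin.last _ := Fin.ext (by simp; omega)
      subst hi
      simp

end Generic

/-- A cut with at least three premisses: it can never be active. -/
def Dead (R : Struct) (n : R.Node) : Prop :=
  R.sort n = .cut ∧ ∃ e₁ e₂ e₃ : R.Edge, e₁ ≠ e₂ ∧ e₁ ≠ e₃ ∧ e₂ ≠ e₃ ∧
    R.tgt e₁ = some n ∧ R.tgt e₂ = some n ∧ R.tgt e₃ = some n

def bd (R : Struct) (c : R.Edge → ZMod 2) (n : R.Node) : ZMod 2 :=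
  (∑ e, if R.src e = n then c e else 0) + ∑ e, if R.tgt e = some n then c e else 0

structure OKat (R : Struct) (c : R.Edge → ZMod 2) (n : R.Node) : Prop where
  even : bd R c n = 0
  par : R.sort n = .parr → ∀ e f, R.tgt e = some n → R.tgt f = some n →
    c e ≠ 0 → c f ≠ 0 → e = f
  syn : R.sort n = .sync → ∀ e f, R.OutEdgeOf n e → R.OutEdgeOf n f →
    c e ≠ 0 → c f ≠ 0 → e = f

def Live (R : Struct) (c : R.Edge → ZMod 2) : Prop :=
  ∀ e, c e ≠ 0 → ∃ t, R.tgt e = some t ∧ ¬ Dead R t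

/-- Global, parity-based acyclicity criterion. -/
def GC (R : Struct) : Prop :=
  ∀ c : R.Edge → ZMod 2, Live R c → (∀ n, OKat R c n) → ∀ e, c e = 0

theorem bd_eq_gbd (R : Struct) (c : R.Edge → ZMod 2) (hc : ∀ e, c e ≠ 0 → R.tgt e ≠ none)
    (n : R.Node) : bd R c n = gbd R.src (fun e => (R.tgt e).getD (R.src e)) c n := by
  unfold bd gbd
  rw [← Finset.sum_add_distrib]
  refine Finset.sum_congr rfl fun e _ => ?_
  by_cases h : c e = 0
  · simp [h]
  · obtain ⟨t, ht⟩ := Option.ne_none_iff_exists'.1 (hc e h)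
    simp [ht]

theorem Live.ne {R : Struct} {c : R.Edge → ZMod 2} (h : Live R c) :
    ∀ e, c e ≠ 0 → R.tgt e ≠ none := by
  intro e he
  obtain ⟨t, ht, _⟩ := h e he
  simp [ht]

/-- handshake: evenness at all nodes but one suffices -/
theorem bd_last {R : Struct} {c : R.Edge → ZMod 2} (h : Live R c) (l : R.Node)
    (hn : ∀ n, n ≠ l → bd R c n = 0) : bd R c l = 0 := by
  have h1 : ∑ n, bd R c n = bd R c l := by
    apply Finset.sum_eq_single_of_mem _ (Finset.mem_univ _)
    intro b _ hb; exact hn b hb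
  rw [← h1]
  simp_rw [bd_eq_gbd R c h.ne]
  rw [gbd_sum]
  simp [z2_self]

section Boxes
variable {S : Struct} 
  (h0 : ∀ n, S.box n = none → S.boxes n = ∅)
  (h1 : ∀ n b, S.box n = some b → b ∉ S.boxes b ∧ S.boxes n = insert b (S.boxes b))
include h0 h1

theorem boxes_trans : ∀ (k : ℕ) (n b : S.Node), (S.boxes n).card = k → b ∈ S.boxes n →
    b ∉ S.boxes b ∧ S.boxes b ⊆ S.boxes n := by
  intro k
  induction k using Nat.strong_induction_on with
  | _ k ih =>
    intro n b hk hb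
    cases hn : S.box n with
    | none => simp [h0 n hn] at hb
    | some b1 =>
      obtain ⟨ha, hs⟩ := h1 n b1 hn
      rw [hs, Finset.mem_insert] at hb
      rcases hb with rfl | hb
      · exact ⟨ha, by rw [hs]; exact Finset.subset_insert _ _⟩
      · obtain ⟨p, q⟩ := ih (S.boxes b1).card (by rw [← hk, hs, Finset.card_insert_of_notMem ha]; omega)
          b1 b rfl hb
        exact ⟨p, q.trans (by rw [hs]; exact Finset.subset_insert _ _)⟩

theorem boxes_chain : ∀ (k : ℕ) (n b b' : S.Node), (S.boxes n).card = k → b ∈ S.boxes n →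
    b' ∈ S.boxes n → b = b' ∨ b ∈ S.boxes b' ∨ b' ∈ S.boxes b := by
  intro k
  induction k using Nat.strong_induction_on with
  | _ k ih =>
    intro n b b' hk hb hb'
    cases hn : S.box n with
    | none => simp [h0 n hn] at hb
    | some b1 =>
      obtain ⟨ha, hs⟩ := h1 n b1 hn
      rw [hs, Finset.mem_insert] at hb hb'
      rcases hb with rfl | hb <;> rcases hb' with rfl | hb'
      · exact Or.inl rfl
      · exact Or.inr (Or.inr hb')
      · exact Or.inr (Or.inl hb)
      · exact ih (S.boxes b1).card (by rw [← hk, hs, Finset.card_insert_of_notMem ha]; omega)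
          b1 b b' rfl hb hb'

theorem boxes_rep : ∀ (k : ℕ) (n : S.Node) (ℓ : Option S.Node), (S.boxes n).card = k →
    (∀ b, ℓ = some b → b ∈ S.boxes n) → S.box n = ℓ ∨ ∃ b ∈ S.boxes n, S.box b = ℓ := by
  intro k
  induction k using Nat.strong_induction_on with
  | _ k ih =>
    intro n ℓ hk hl
    cases hn : S.box n with
    | none =>
      left
      cases ℓ with
      | none => rfl
      | some b => have := hl b rfl; simp [h0 n hn] at this
    | some b1 =>
      obtain ⟨ha, hs⟩ := h1 n b1 hn
      by_cases hb : ℓ = some b1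
      · exact Or.inl hb.symm
      right
      have := ih (S.boxes b1).card (by rw [← hk, hs, Finset.card_insert_of_notMem ha]; omega)
        b1 ℓ rfl (by
          intro b hb'
          have := hl b hb'
          rw [hs, Finset.mem_insert] at this
          rcases this with rfl | h
          · exact absurd hb' hb
          · exact h)
      rcases this with h | ⟨b, hb, h⟩
      · exact ⟨b1, by simp [hs], h⟩
      · exact ⟨b, by simp [hs, hb], h⟩

theorem boxes_eq_of_box {n m : S.Node} (h : S.box n = S.box m) : S.boxes n = S.boxes m := by
  cases hn : S.box n with
  | none => rw [h0 n hn, h0 m (h ▸ hn)]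
  | some b => rw [(h1 n b hn).2, (h1 m b (h ▸ hn)).2]

theorem box_eq_of_boxes {n m : S.Node} (h : S.boxes n = S.boxes m) : S.box n = S.box m := by
  cases hn : S.box n with
  | none =>
    cases hm : S.box m with
    | none => rfl
    | some b => 
      have := (h1 m b hm).2
      rw [← h, h0 n hn] at this
      exact absurd this.symm (Finset.insert_ne_empty _ _)
  | some b =>
    cases hm : S.box m with
    | none =>
      have := (h1 n b hn).2
      rw [h, h0 m hm] at this
      exact absurd this.symm (Finset.insert_ne_empty _ _)
    | some b' =>
      obtain ⟨a1, a2⟩ := h1 n b hn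
      obtain ⟨b1, b2⟩ := h1 m b' hm
      by_contra hne
      have hne : b ≠ b' := fun h => hne (by rw [h])
      have e : insert b (S.boxes b) = insert b' (S.boxes b') := by rw [← a2, ← b2, h]
      have c1 : b ∈ S.boxes b' := by
        have : b ∈ insert b' (S.boxes b') := e ▸ Finset.mem_insert_self _ _
        simpa [hne] using this
      have c2 : b' ∈ S.boxes b := by
        have : b' ∈ insert b (S.boxes b) := e ▸ Finset.mem_insert_self _ _
        simpa [Ne.symm hne] using this
      exact a1 ((boxes_trans h0 h1 _ b b' rfl c2).2 c1)

theorem boxes_comp {n m t : S.Node} (hm : S.boxes m ⊆ S.boxes n) (ht : S.boxes t ⊆ S.boxes n)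
    (hc : (S.boxes m).card ≤ (S.boxes t).card) : S.boxes m ⊆ S.boxes t := by
  cases hbm : S.box m with
  | none => simp [h0 m hbm]
  | some b =>
    obtain ⟨a1, a2⟩ := h1 m b hbm
    cases hbt : S.box t with
    | none =>
      rw [h0 t hbt, a2, Finset.card_insert_of_notMem a1] at hc
      simp at hc
    | some b' =>
      obtain ⟨b1, b2⟩ := h1 t b' hbt
      rcases boxes_chain h0 h1 _ n b b' rfl (hm (by simp [a2])) (ht (by simp [b2])) with h | h | h
      · subst h; rw [a2, b2]
      · rw [a2, b2]
        refine Finset.insert_subset (Finset.mem_insert_of_mem h) ?_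
        exact (boxes_trans h0 h1 _ b' b rfl h).2.trans (Finset.subset_insert _ _)
      · exfalso
        have : insert b' (S.boxes b') ⊆ S.boxes b :=
          Finset.insert_subset h (boxes_trans h0 h1 _ b b' rfl h).2
        have := Finset.card_le_card this
        rw [a2, b2, Finset.card_insert_of_notMem a1] at hc
        omega
end Boxes

theorem gc_of_correct (S : Struct) (hW : S.WF) (hC : S.Correct) : GC S := by
  classical
  obtain ⟨-, -, -, -, -, -, -, -, h0, h1, h2⟩ := hW
  intro c hL hO e00
  by_contra he00
  let T : S.Edge → S.Node := fun e => (S.tgt e).getD (S.src e)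
  have hT : ∀ e, c e ≠ 0 → S.tgt e = some (T e) := by
    intro e he
    obtain ⟨t, ht, _⟩ := hL e he
    simp [T, ht]
  have hsub : ∀ e, c e ≠ 0 → S.boxes (T e) ⊆ S.boxes (S.src e) := fun e he => h2 e _ (hT e he)
  -- the touched node of minimal depth
  let A : Finset S.Edge := Finset.univ.filter fun e => c e ≠ 0
  obtain ⟨es, hes, hmin⟩ := A.exists_min_image (fun e => (S.boxes (T e)).card) ⟨e00, by simpa [A] using he00⟩
  have hes : c es ≠ 0 := by simpa [A] using hes
  have hmin : ∀ e, c e ≠ 0 → (S.boxes (T es)).card ≤ (S.boxes (T e)).card :=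
    fun e he => hmin e (by simpa [A] using he)
  let ns := T es
  let ℓ := S.box ns
  let rep : S.Node → S.Node := fun n =>
    if S.box n = ℓ then n else if h : ∃ b, b ∈ S.boxes n ∧ S.box b = ℓ then h.choose else ns
  have hrep1 : ∀ n, S.box n = ℓ → rep n = n := fun n h => by simp [rep, h]
  have hnot : ∀ n b, b ∈ S.boxes n → S.box b = ℓ → S.box n ≠ ℓ := by
    intro n b hb hbl hn
    have := boxes_eq_of_box h0 h1 (hbl.trans hn.symm)
    exact (boxes_trans h0 h1 _ n b rfl hb).1 (this ▸ hb)
  have hrep2 : ∀ n b, b ∈ S.boxes n → S.box b = ℓ → rep n = b := by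
    intro n b hb hbl
    have hn := hnot n b hb hbl
    have hex : ∃ b, b ∈ S.boxes n ∧ S.box b = ℓ := ⟨b, hb, hbl⟩
    have : rep n = hex.choose := by simp only [rep, if_neg hn, dif_pos hex]
    rw [this]
    obtain ⟨p, q⟩ := hex.choose_spec
    have hq := boxes_eq_of_box h0 h1 (q.trans hbl.symm)
    rcases boxes_chain h0 h1 _ n _ b rfl p hb with h | h | h
    · exact h
    · exact absurd (hq ▸ h) (boxes_trans h0 h1 _ n _ rfl p).1
    · exact absurd (hq ▸ h) (boxes_trans h0 h1 _ n b rfl hb).1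
  have hrep3 : ∀ n, S.box n ≠ ℓ → (¬ ∃ b, b ∈ S.boxes n ∧ S.box b = ℓ) → rep n = ns := by
    intro n h h'; simp only [rep, if_neg h, dif_neg h']
  have hU : ∀ n, (S.box n = ℓ ∨ ∃ b ∈ S.boxes n, S.box b = ℓ) ↔ S.boxes ns ⊆ S.boxes n := by
    intro n
    constructor
    · rintro (h | ⟨b, hb, h⟩)
      · rw [boxes_eq_of_box h0 h1 h]
      · rw [← boxes_eq_of_box h0 h1 h]; exact (boxes_trans h0 h1 _ n b rfl hb).2
    · intro h
      apply boxes_rep h0 h1 _ n ℓ rfl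
      intro b hb
      apply h
      rw [(h1 ns b hb).2]; simp
  have hint : ∀ e, c e ≠ 0 → S.box (T e) ≠ ℓ → rep (S.src e) = rep (T e) := by
    intro e he hb
    by_cases hex : ∃ b, b ∈ S.boxes (T e) ∧ S.box b = ℓ
    · obtain ⟨b, hb, hbl⟩ := hex
      rw [hrep2 _ b hb hbl, hrep2 _ b (hsub e he hb) hbl]
    · rw [hrep3 _ hb hex]
      have : ¬ (S.box (S.src e) = ℓ ∨ ∃ b ∈ S.boxes (S.src e), S.box b = ℓ) := by
        rw [hU]
        intro h
        have := (hU (T e)).2 (boxes_comp h0 h1 h (hsub e he) (hmin e he))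
        rcases this with h | ⟨b, h, h'⟩
        · exact hb h
        · exact hex ⟨b, h, h'⟩
      push Not at this
      exact hrep3 _ this.1 (by rintro ⟨b, h, h'⟩; exact this.2 b h h')
  let c2 : S.Edge → ZMod 2 := fun e => if S.box (T e) = ℓ then c e else 0
  have hc2 : ∀ e, c2 e ≠ 0 → c e ≠ 0 ∧ S.box (T e) = ℓ := by
    intro e he
    by_cases h : S.box (T e) = ℓ <;> simp [c2, h] at he ⊢
    exact he
  have hev : ∀ b, gbd (fun e => rep (S.src e)) (fun e => rep (T e)) c2 b = 0 := by
    intro b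
    have : gbd (fun e => rep (S.src e)) (fun e => rep (T e)) c2 b
        = ∑ n ∈ Finset.univ.filter (fun n => rep n = b), gbd S.src T c n := by
      rw [gbd_sum]
      unfold gbd
      refine Finset.sum_congr rfl fun e _ => ?_
      simp only [Finset.mem_filter, Finset.mem_univ, true_and]
      by_cases hce : c e = 0
      · simp [c2, hce]
      by_cases hb : S.box (T e) = ℓ
      · simp [c2, hb]
      · simp [hint e hce hb, c2, hb, z2_self]
    rw [this]
    apply Finset.sum_eq_zero
    intro n _
    rw [← bd_eq_gbd S c hL.ne]
    exact (hO n).even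
  obtain ⟨k, v, e, hv, he, hce, hst⟩ := gbd_cycle _ _ c2 hev es (by simpa [c2, ns, ℓ] using hes)
  refine hC ℓ ⟨k, v, e, hv, he, ?_, ?_, ?_⟩
  · intro i
    obtain ⟨hc1, hb⟩ := hc2 _ (hce i)
    have hr1 : S.RepAt ℓ (T (e i)) (rep (T (e i))) := Or.inl ⟨hb, hrep1 _ hb⟩
    have hr2 : S.RepAt ℓ (S.src (e i)) (rep (S.src (e i))) := by
      have := (hU (S.src (e i))).2 ((boxes_eq_of_box h0 h1 hb) ▸ hsub _ hc1)
      rcases this with h | ⟨b, h, h'⟩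
      · exact Or.inl ⟨h, hrep1 _ h⟩
      · rw [hrep2 _ b h h']; exact Or.inr ⟨h, h'⟩
    refine ⟨T (e i), hT _ hc1, Or.inl hb, ?_⟩
    rcases hst i with ⟨a1, a2⟩ | ⟨a1, a2⟩
    · left; rw [← a1, ← a2]; exact ⟨hr2, hr1⟩
    · right; rw [← a1, ← a2]; exact ⟨hr2, hr1⟩
  · intro p hp i hi j hj
    exact he ((hO p).par hp _ _ hi hj (hc2 _ (hce i)).1 (hc2 _ (hce j)).1)
  · intro p hp i hi j hj
    exact he ((hO p).syn hp _ _ hi hj (hc2 _ (hce i)).1 (hc2 _ (hce j)).1)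

theorem pos_not_neg {A : Formula} (h : A.Positive) (h' : A.Negative) : False := by
  cases h <;> cases h'

structure GoodAt (R : Struct) (n : R.Node) : Prop where
  ax : R.sort n = .ax → (∀ e, R.tgt e ≠ some n) ∧
    ∀ u v, R.src u = n → R.src v = n → u ≠ v → R.typ v = (R.typ u).dual
  cut : R.sort n = .cut → (∀ e, R.src e ≠ n) ∧
    (¬ Dead R n → ∀ u v, R.tgt u = some n → R.tgt v = some n → u ≠ v →
      R.typ v = (R.typ u).dual)
  tens : R.sort n = .tens → ∀ z, R.src z = n → (∀ z', R.src z' = n → z' = z) ∧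
    ∀ x y, R.tgt x = some n → R.tgt y = some n → R.pIdx x = 0 → R.pIdx y = 1 →
      R.typ z = .tens (R.typ x) (R.typ y)
  parr : R.sort n = .parr → ∀ z, R.src z = n → (∀ z', R.src z' = n → z' = z) ∧
    ∀ x y, R.tgt x = some n → R.tgt y = some n → R.pIdx x = 0 → R.pIdx y = 1 →
      R.typ z = .parr (R.typ x) (R.typ y)
  one : R.sort n = .one → (∀ e, R.tgt e ≠ some n) ∧
    ∀ u v, R.src u = n → R.src v = n → u = v
  sync : R.sort n = .sync →
    (∀ e, R.tgt e = some n → (R.typ e).Polarized) ∧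
    (∀ e, R.tgt e = some n → ∃ f, R.src f = n ∧ R.cIdx f = R.pIdx e) ∧
    (∀ f, R.src f = n → ∃ e, R.tgt e = some n ∧ R.pIdx e = R.cIdx f) ∧
    (∀ e e', R.tgt e = some n → R.tgt e' = some n → R.pIdx e = R.pIdx e' → e = e') ∧
    (∀ f f', R.src f = n → R.src f' = n → R.cIdx f = R.cIdx f' → f = f') ∧
    (∀ e f, R.tgt e = some n → R.src f = n → R.cIdx f = R.pIdx e → R.typ f = R.typ e)

/-- Local correspondence between the node `n` of `Q` and the node `m` of `R`. -/
structure Loc (Q R : Struct) (up lo : Q.Edge → R.Edge) (n : Q.Node) (m : R.Node) : Prop where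
  sort : Q.sort n = R.sort m
  um : ∀ x, Q.src x = n → R.src (up x) = m
  ui : ∀ x x', Q.src x = n → Q.src x' = n → up x = up x' → x = x'
  us : ∀ y, R.src y = m → ∃ x, Q.src x = n ∧ up x = y
  ut : ∀ x, Q.src x = n → Q.typ x = R.typ (up x)
  uc : Q.sort n = .sync → ∀ x, Q.src x = n → Q.cIdx x = R.cIdx (up x)
  lm : ∀ x, Q.tgt x = some n → R.tgt (lo x) = some m
  li : ∀ x x', Q.tgt x = some n → Q.tgt x' = some n → lo x = lo x' → x = x'
  ls : ∀ y, R.tgt y = some m → ∃ x, Q.tgt x = some n ∧ lo x = y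
  lt : ∀ x, Q.tgt x = some n → Q.typ x = R.typ (lo x)
  lp : ∀ x, Q.tgt x = some n → Q.pIdx x = R.pIdx (lo x)

theorem Loc.dead {Q R : Struct} {up lo : Q.Edge → R.Edge} {n : Q.Node} {m : R.Node}
    (h : Loc Q R up lo n m) : Dead Q n ↔ Dead R m := by
  unfold Dead
  rw [h.sort]
  refine and_congr Iff.rfl ⟨?_, ?_⟩
  · rintro ⟨a, b, c, h1, h2, h3, ha, hb, hc⟩
    exact ⟨lo a, lo b, lo c, fun e => h1 (h.li _ _ ha hb e), fun e => h2 (h.li _ _ ha hc e),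
      fun e => h3 (h.li _ _ hb hc e), h.lm _ ha, h.lm _ hb, h.lm _ hc⟩
  · rintro ⟨a, b, c, h1, h2, h3, ha, hb, hc⟩
    obtain ⟨a, k_a, rfl⟩ := h.ls a ha; replace ha := k_a
    obtain ⟨b, k_b, rfl⟩ := h.ls b hb; replace hb := k_b
    obtain ⟨c, k_c, rfl⟩ := h.ls c hc; replace hc := k_c
    exact ⟨a, b, c, fun e => h1 (e ▸ rfl), fun e => h2 (e ▸ rfl), fun e => h3 (e ▸ rfl), ha, hb, hc⟩

theorem Loc.good {Q R : Struct} {up lo : Q.Edge → R.Edge} {n : Q.Node} {m : R.Node}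
    (h : Loc Q R up lo n m) (g : GoodAt R m) : GoodAt Q n := by
  constructor
  · intro hs
    obtain ⟨g1, g2⟩ := g.ax (h.sort ▸ hs)
    refine ⟨fun e he => g1 _ (h.lm e he), fun u v hu hv huv => ?_⟩
    rw [h.ut u hu, h.ut v hv]
    exact g2 _ _ (h.um u hu) (h.um v hv) fun e => huv (h.ui _ _ hu hv e)
  · intro hs
    obtain ⟨g1, g2⟩ := g.cut (h.sort ▸ hs)
    refine ⟨fun e he => g1 _ (h.um e he), fun hD u v hu hv huv => ?_⟩
    rw [h.lt u hu, h.lt v hv]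
    exact g2 (fun hd => hD (h.dead.2 hd)) _ _ (h.lm u hu) (h.lm v hv)
      fun e => huv (h.li _ _ hu hv e)
  · intro hs z hz
    obtain ⟨g1, g2⟩ := g.tens (h.sort ▸ hs) _ (h.um z hz)
    refine ⟨fun z' hz' => h.ui _ _ hz' hz (g1 _ (h.um z' hz')), fun x y hx hy px py => ?_⟩
    rw [h.ut z hz, h.lt x hx, h.lt y hy]
    exact g2 _ _ (h.lm x hx) (h.lm y hy) (h.lp x hx ▸ px) (h.lp y hy ▸ py)
  · intro hs z hz
    obtain ⟨g1, g2⟩ := g.parr (h.sort ▸ hs) _ (h.um z hz)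
    refine ⟨fun z' hz' => h.ui _ _ hz' hz (g1 _ (h.um z' hz')), fun x y hx hy px py => ?_⟩
    rw [h.ut z hz, h.lt x hx, h.lt y hy]
    exact g2 _ _ (h.lm x hx) (h.lm y hy) (h.lp x hx ▸ px) (h.lp y hy ▸ py)
  · intro hs
    obtain ⟨g1, g2⟩ := g.one (h.sort ▸ hs)
    exact ⟨fun e he => g1 _ (h.lm e he), fun u v hu hv =>
      h.ui _ _ hu hv (g2 _ _ (h.um u hu) (h.um v hv))⟩
  · intro hs
    obtain ⟨g1, g2, g3, g4, g5, g6⟩ := g.sync (h.sort ▸ hs)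
    refine ⟨fun e he => ?_, fun e he => ?_, fun f hf => ?_, fun e e' he he' hp => ?_,
      fun f f' hf hf' hp => ?_, fun e f he hf hp => ?_⟩
    · rw [h.lt e he]; exact g1 _ (h.lm e he)
    · obtain ⟨f, hf, hc⟩ := g2 _ (h.lm e he)
      obtain ⟨f, k_f, rfl⟩ := h.us f hf; replace hf := k_f
      exact ⟨f, hf, by rw [h.uc hs f hf, h.lp e he, hc]⟩
    · obtain ⟨e, he, hc⟩ := g3 _ (h.um f hf)
      obtain ⟨e, k_e, rfl⟩ := h.ls e he; replace he := k_e
      exact ⟨e, he, by rw [h.uc hs f hf, h.lp e he, hc]⟩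
    · rw [h.lp e he, h.lp e' he'] at hp
      exact h.li _ _ he he' (g4 _ _ (h.lm e he) (h.lm e' he') hp)
    · rw [h.uc hs f hf, h.uc hs f' hf'] at hp
      exact h.ui _ _ hf hf' (g5 _ _ (h.um f hf) (h.um f' hf') hp)
    · rw [h.uc hs f hf, h.lp e he] at hp
      rw [h.ut f hf, h.lt e he]
      exact g6 _ _ (h.lm e he) (h.um f hf) hp

theorem bd_eq (R : Struct) (c : R.Edge → ZMod 2) (n : R.Node) :
    bd R c n = (∑ e ∈ R.concls n, c e) + ∑ e ∈ R.prems n, c e := by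
  simp only [bd, Struct.concls, Struct.prems, Finset.sum_filter]

theorem Loc.bd_eq {Q R : Struct} {up lo : Q.Edge → R.Edge} {n : Q.Node} {m : R.Node}
    (h : Loc Q R up lo n m) (c : Q.Edge → ZMod 2) (d : R.Edge → ZMod 2)
    (hu : ∀ x, Q.src x = n → c x = d (up x)) (hl : ∀ x, Q.tgt x = some n → c x = d (lo x)) :
    bd Q c n = bd R d m := by
  rw [_root_.bd_eq, _root_.bd_eq]
  congr 1
  · refine Finset.sum_bij (fun x _ => up x) ?_ ?_ ?_ ?_
    · intro x hx; simp only [Struct.concls, Finset.mem_filter, Finset.mem_univ, true_and] at hx ⊢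
      exact h.um x hx
    · intro x hx y hy; simp only [Struct.concls, Finset.mem_filter, Finset.mem_univ, true_and] at hx hy
      exact h.ui x y hx hy
    · intro y hy; simp only [Struct.concls, Finset.mem_filter, Finset.mem_univ, true_and] at hy ⊢
      obtain ⟨x, hx, e⟩ := h.us y hy
      exact ⟨x, hx, e⟩
    · intro x hx; simp only [Struct.concls, Finset.mem_filter, Finset.mem_univ, true_and] at hx
      exact hu x hx
  · refine Finset.sum_bij (fun x _ => lo x) ?_ ?_ ?_ ?_
    · intro x hx; simp only [Struct.prems, Finset.mem_filter, Finset.mem_univ, true_and] at hx ⊢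
      exact h.lm x hx
    · intro x hx y hy; simp only [Struct.prems, Finset.mem_filter, Finset.mem_univ, true_and] at hx hy
      exact h.li x y hx hy
    · intro y hy; simp only [Struct.prems, Finset.mem_filter, Finset.mem_univ, true_and] at hy ⊢
      obtain ⟨x, hx, e⟩ := h.ls y hy
      exact ⟨x, hx, e⟩
    · intro x hx; simp only [Struct.prems, Finset.mem_filter, Finset.mem_univ, true_and] at hx
      exact hl x hx

theorem Loc.ok {Q R : Struct} {up lo : Q.Edge → R.Edge} {n : Q.Node} {m : R.Node}
    (h : Loc Q R up lo n m) (c : Q.Edge → ZMod 2) (d : R.Edge → ZMod 2)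
    (hu : ∀ x, Q.src x = n → c x = d (up x)) (hl : ∀ x, Q.tgt x = some n → c x = d (lo x))
    (hk : OKat Q c n) : OKat R d m := by
  constructor
  · rw [← h.bd_eq c d hu hl]; exact hk.even
  · intro hs e f he hf hde hdf
    obtain ⟨e, k_e, rfl⟩ := h.ls e he; replace he := k_e
    obtain ⟨f, k_f, rfl⟩ := h.ls f hf; replace hf := k_f
    rw [hk.par (h.sort ▸ hs) e f he hf (by rwa [hl e he]) (by rwa [hl f hf])]
  · intro hs e f ⟨_, he⟩ ⟨_, hf⟩ hde hdf
    have hs' : Q.sort n = .sync := h.sort ▸ hs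
    rcases he with ⟨he, pe⟩ | ⟨he, pe⟩ <;> rcases hf with ⟨hf, pf⟩ | ⟨hf, pf⟩
    · obtain ⟨e, k_e, rfl⟩ := h.us e he; replace he := k_e
      obtain ⟨f, k_f, rfl⟩ := h.us f hf; replace hf := k_f
      rw [hk.syn hs' e f ⟨hs', .inl ⟨he, h.ut e he ▸ pe⟩⟩ ⟨hs', .inl ⟨hf, h.ut f hf ▸ pf⟩⟩
        (by rwa [hu e he]) (by rwa [hu f hf])]
    · obtain ⟨e, k_e, rfl⟩ := h.us e he; replace he := k_e
      obtain ⟨f, k_f, rfl⟩ := h.ls f hf; replace hf := k_f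
      refine (pos_not_neg (h.ut e he ▸ pe) ?_).elim
      rw [(hk.syn hs' e f ⟨hs', .inl ⟨he, h.ut e he ▸ pe⟩⟩ ⟨hs', .inr ⟨hf, h.lt f hf ▸ pf⟩⟩
        (by rwa [hu e he]) (by rwa [hl f hf])), h.lt f hf]
      exact pf
    · obtain ⟨e, k_e, rfl⟩ := h.ls e he; replace he := k_e
      obtain ⟨f, k_f, rfl⟩ := h.us f hf; replace hf := k_f
      refine (pos_not_neg (h.ut f hf ▸ pf) ?_).elim
      rw [(hk.syn hs' f e ⟨hs', .inl ⟨hf, h.ut f hf ▸ pf⟩⟩ ⟨hs', .inr ⟨he, h.lt e he ▸ pe⟩⟩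
        (by rwa [hu f hf]) (by rwa [hl e he])), h.lt e he]
      exact pe
    · obtain ⟨e, k_e, rfl⟩ := h.ls e he; replace he := k_e
      obtain ⟨f, k_f, rfl⟩ := h.ls f hf; replace hf := k_f
      rw [hk.syn hs' e f ⟨hs', .inr ⟨he, h.lt e he ▸ pe⟩⟩ ⟨hs', .inr ⟨hf, h.lt f hf ▸ pf⟩⟩
        (by rwa [hl e he]) (by rwa [hl f hf])]

theorem Loc.build {Q R : Struct} {jN : Q.Node → Option R.Node}
    (hinj : ∀ a a' b, jN a = some b → jN a' = some b → a = a')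
    {up lo : Q.Edge → R.Edge} {n : Q.Node} {m : R.Node} (hn : jN n = some m)
    (hs : Q.sort n = R.sort m)
    (hu : ∀ x, Q.src x = n → jN (Q.src x) = some (R.src (up x)) ∧ Q.typ x = R.typ (up x))
    (huc : R.sort m = .sync → ∀ x, Q.src x = n → Q.cIdx x = R.cIdx (up x))
    (hui : ∀ x x', Q.src x = n → Q.src x' = n → up x = up x' → x = x')
    (hus : ∀ y, R.src y = m → ∃ x, jN (Q.src x) = some (R.src y) ∧ up x = y)
    (hl : ∀ x, Q.tgt x = some n → (Q.tgt x).bind jN = R.tgt (lo x) ∧ Q.typ x = R.typ (lo x) ∧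
      Q.pIdx x = R.pIdx (lo x))
    (hli : ∀ x x', Q.tgt x = some n → Q.tgt x' = some n → lo x = lo x' → x = x')
    (hls : ∀ y, R.tgt y = some m → ∃ x, (Q.tgt x).bind jN = R.tgt y ∧ lo x = y) :
    Loc Q R up lo n m := by
  constructor
  · exact hs
  · intro x hx
    have := (hu x hx).1
    rw [hx, hn] at this
    exact (Option.some.inj this).symm
  · exact hui
  · intro y hy
    obtain ⟨x, h1, h2⟩ := hus y hy
    exact ⟨x, hinj _ _ _ h1 (hy ▸ hn), h2⟩
  · exact fun x hx => (hu x hx).2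
  · exact fun h => huc (hs ▸ h)
  · intro x hx
    have := (hl x hx).1
    rw [hx] at this
    rw [← this]; exact hn
  · exact hli
  · intro y hy
    obtain ⟨x, h1, h2⟩ := hls y hy
    refine ⟨x, ?_, h2⟩
    rw [hy] at h1
    obtain ⟨k, hk, hk'⟩ := Option.bind_eq_some_iff.1 h1
    rw [hk, hinj _ _ _ hk' hn]
  · exact fun x hx => (hl x hx).2.1
  · exact fun x hx => (hl x hx).2.2

theorem concls_iff {R : Struct} {n : R.Node} {s : Finset R.Edge} (h : R.concls n = s) (e : R.Edge) :
    R.src e = n ↔ e ∈ s := by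
  rw [← h]; simp [Struct.concls]

theorem prems_iff {R : Struct} {n : R.Node} {s : Finset R.Edge} (h : R.prems n = s) (e : R.Edge) :
    R.tgt e = some n ↔ e ∈ s := by
  rw [← h]; simp [Struct.prems]

theorem concls_of {R : Struct} {n : R.Node} {s : Finset R.Edge} (h : ∀ e, R.src e = n ↔ e ∈ s) :
    R.concls n = s := by
  ext e; simp [Struct.concls, h]

theorem prems_of {R : Struct} {n : R.Node} {s : Finset R.Edge} (h : ∀ e, R.tgt e = some n ↔ e ∈ s) :
    R.prems n = s := by
  ext e; simp [Struct.prems, h]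

theorem not_dead_pair {R : Struct} {n : R.Node} {x y : R.Edge} (h : R.prems n = {x, y}) :
    ¬ Dead R n := by
  rintro ⟨-, a, b, c, h1, h2, h3, ha, hb, hc⟩
  rw [prems_iff h] at ha hb hc
  simp only [Finset.mem_insert, Finset.mem_singleton] at ha hb hc
  grind

theorem not_dead_sort {R : Struct} {n : R.Node} (h : R.sort n ≠ .cut) : ¬ Dead R n :=
  fun hd => h hd.1

theorem ok_trivial {R : Struct} {c : R.Edge → ZMod 2} {n : R.Node} (h : bd R c n = 0)
    (h1 : R.sort n ≠ .parr) (h2 : R.sort n ≠ .sync) : OKat R c n :=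
  ⟨h, fun hh => absurd hh h1, fun hh => absurd hh h2⟩

def SInv (R : Struct) : Prop := (∀ n, GoodAt R n) ∧ GC R

theorem jtotal {α β : Type} {j : α → Option β} (h : JTotal j) : ∃ J : α → β, ∀ x, j x = some (J x) := by
  have : ∀ x, ∃ y, j x = some y := fun x => Option.ne_none_iff_exists'.1 (h x)
  choose J hJ using this
  exact ⟨J, hJ⟩

theorem inv_axcut {R Q : Struct} (hI : SInv R) (h : AxCutStep R Q) : SInv Q := by
  obtain ⟨a, c, v, u, q, sa, sc, -, -, hvu, hvq, huq, ca, pc, jN, jE, tN, tE, iN, iE, hA, hq⟩ := h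
  obtain ⟨J, hJ⟩ := jtotal tE
  obtain ⟨hG, hC⟩ := hI
  have ca' := fun e => concls_iff ca e
  have pc' := fun e => prems_iff pc e
  simp only [Finset.mem_insert, Finset.mem_singleton] at ca' pc'
  have ga := (hG a).ax sa
  have gc := (hG c).cut sc
  have hDc : ¬ Dead R c := not_dead_pair pc
  have typu : R.typ u = R.typ q := by
    rw [ga.2 v u ((ca' v).2 (.inl rfl)) ((ca' u).2 (.inr rfl)) hvu,
      gc.2 hDc v q ((pc' v).2 (.inl rfl)) ((pc' q).2 (.inr rfl)) hvq]
  have Jinj : ∀ x x', J x = J x' → x = x' := fun x x' e => iE.1 _ _ _ (hJ x) (e ▸ hJ x')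
  have Jne : ∀ x, J x ≠ v ∧ J x ≠ u := fun x => iE.2.1 _ _ (hJ x)
  have Jsurj : ∀ y, y ≠ v → y ≠ u → ∃ x, J x = y := by
    intro y h1 h2
    obtain ⟨x, hx⟩ := iE.2.2 y ⟨h1, h2⟩
    exact ⟨x, by simpa [hJ] using hx⟩
  have hA1 : ∀ x, J x ≠ q → Q.typ x = R.typ (J x) ∧ jN (Q.src x) = some (R.src (J x)) ∧
    (Q.tgt x).bind jN = R.tgt (J x) ∧ Q.pIdx x = R.pIdx (J x) ∧ Q.cIdx x = R.cIdx (J x) :=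
    fun x hx => hA.1 x _ (hJ x) hx
  have hq1 := fun x (hx : J x = q) => hq x (hx ▸ hJ x)
  have hloc : ∀ n m, jN n = some m →
      Loc Q R J (fun x => if J x = q then u else J x) n m := by
    intro n m hn
    have hm := iN.2.1 _ _ hn
    refine Loc.build iN.1 hn (hA.2 _ _ hn (by simp)).1 ?_ ?_ ?_ ?_ ?_ ?_ ?_
    · intro x _
      by_cases hx : J x = q
      · rw [hx]; exact ⟨(hq1 x hx).2.1, (hq1 x hx).1⟩
      · exact ⟨(hA1 x hx).2.1, (hA1 x hx).1⟩
    · intro _ x _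
      by_cases hx : J x = q
      · rw [hx]; exact (hq1 x hx).2.2.2.2
      · exact (hA1 x hx).2.2.2.2
    · exact fun x x' _ _ => Jinj x x'
    · intro y hy
      obtain ⟨x, hx⟩ := Jsurj y (by grind) (by grind)
      refine ⟨x, ?_, hx⟩
      grind
    · intro x _
      by_cases hx : J x = q
      · simp only [hx, if_true]
        refine ⟨(hq1 x hx).2.2.1, ?_, (hq1 x hx).2.2.2.1⟩
        rw [typu]; exact (hq1 x hx).1
      · simp only [hx, if_false]
        exact ⟨(hA1 x hx).2.2.1, (hA1 x hx).1, (hA1 x hx).2.2.2.1⟩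
    · intro x x' _ _ hxx
      grind
    · intro y hy
      by_cases hyu : y = u
      · obtain ⟨x, hx⟩ := Jsurj q (by grind) (by grind)
        exact ⟨x, by rw [hyu]; exact (hq1 x hx).2.2.1, by simp [hx, hyu]⟩
      · have hyq : y ≠ q := by rintro rfl; grind
        obtain ⟨x, hx⟩ := Jsurj y (by rintro rfl; grind) hyu
        exact ⟨x, by rw [← hx]; exact (hA1 x (hx ▸ hyq)).2.2.1, by simp [hx, hyq]⟩
  refine ⟨fun n => ?_, ?_⟩
  · obtain ⟨m, hm⟩ := Option.ne_none_iff_exists'.1 (tN n)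
    exact (hloc n m hm).good (hG m)
  intro d hL hO
  obtain ⟨xq, hxq⟩ := Jsurj q (Ne.symm hvq) (Ne.symm huq)
  have : ∀ y, ∃ x, (y ≠ v ∧ y ≠ u → J x = y) ∧ (y = v ∨ y = u → x = xq) := by
    intro y
    by_cases hy : y = v ∨ y = u
    · exact ⟨xq, by grind, fun _ => rfl⟩
    · obtain ⟨x, hx⟩ := Jsurj y (by grind) (by grind)
      exact ⟨x, fun _ => hx, by grind⟩
  choose K hK1 hK2 using this
  have hKJ : ∀ x, K (J x) = x := fun x => Jinj _ _ (hK1 _ (Jne x))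
  have key := hC (fun y => d (K y)) ?_ ?_
  · intro x
    have := key (J x)
    simpa [hKJ] using this
  · intro y hy
    obtain ⟨t, ht, htd⟩ := hL _ hy
    obtain ⟨m, hm⟩ := Option.ne_none_iff_exists'.1 (tN t)
    by_cases hyc : y = v ∨ y = q
    · exact ⟨c, (pc' y).2 hyc, hDc⟩
    · refine ⟨m, ?_, fun hd => htd ((hloc t m hm).dead.2 hd)⟩
      rw [← (hloc t m hm).lm _ ht]
      by_cases hyu : y = u
      · rw [hK2 y (.inr hyu)]; simp [hxq, hyu]
      · have := hK1 y (by grind)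
        simp only [this]; rw [if_neg (by grind)]
  · intro m
    by_cases hma : m = a
    · subst hma
      refine ok_trivial ?_ (by simp [sa]) (by simp [sa])
      rw [bd_eq, ca, prems_of (s := ∅) (by simpa using ga.1)]
      rw [Finset.sum_pair hvu]
      simp [hK2, z2_self]
    by_cases hmc : m = c
    · subst hmc
      refine ok_trivial ?_ (by simp [sc]) (by simp [sc])
      rw [bd_eq, pc, concls_of (s := ∅) (by simpa using gc.1)]
      rw [Finset.sum_pair hvq]
      have : K q = xq := by rw [← hxq, hKJ]
      simp [hK2, this, z2_self]
    obtain ⟨n, hn⟩ := iN.2.2 m ⟨hma, hmc⟩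
    refine (hloc n m hn).ok d _ ?_ ?_ (hO n)
    · intro x _; simp [hKJ]
    · intro x _
      by_cases hx : J x = q
      · simp only [hx, if_true, hK2 u (.inr rfl)]
        rw [Jinj x xq (hx.trans hxq.symm)]
      · simp [hx, hKJ]

theorem bd_zero {R : Struct} {c : R.Edge → ZMod 2} {n : R.Node}
    (h1 : ∀ e, R.src e = n → c e = 0) (h2 : ∀ e, R.tgt e = some n → c e = 0) : bd R c n = 0 := by
  unfold bd
  rw [Finset.sum_eq_zero, Finset.sum_eq_zero, add_zero]
  · intro e _; split_ifs with h
    · exact h2 e h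
    · rfl
  · intro e _; split_ifs with h
    · exact h1 e h
    · rfl

theorem ok_zero {R : Struct} {c : R.Edge → ZMod 2} {n : R.Node}
    (h1 : ∀ e, R.src e = n → c e = 0) (h2 : ∀ e, R.tgt e = some n → c e = 0) : OKat R c n := by
  refine ⟨bd_zero h1 h2, ?_, ?_⟩
  · intro _ e f he _ hc; exact absurd (h2 e he) hc
  · rintro _ e f ⟨_, he⟩ _ hc
    rcases he with ⟨he, _⟩ | ⟨he, _⟩
    · exact absurd (h1 e he) hc
    · exact absurd (h2 e he) hc

theorem inv_onebot {R Q : Struct} (hI : SInv R) (h : OneBotStep R Q) : SInv Q := by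
  obtain ⟨c, n₁, b, o, k, sc, sn, sb, -, -, -, hok, pc, so, sk, jN, jE, tN, tE, iN, iE, hA, hB⟩ := h
  obtain ⟨J, hJ⟩ := jtotal tE
  obtain ⟨hG, hC⟩ := hI
  have pc' := fun e => prems_iff pc e
  simp only [Finset.mem_insert, Finset.mem_singleton] at pc'
  have Jinj : ∀ x x', J x = J x' → x = x' := fun x x' e => iE.1 _ _ _ (hJ x) (e ▸ hJ x')
  have Jne : ∀ x, J x ≠ o ∧ J x ≠ k := fun x => iE.2.1 _ _ (hJ x)
  have Jsurj : ∀ y, y ≠ o → y ≠ k → ∃ x, J x = y := by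
    intro y h1 h2
    obtain ⟨x, hx⟩ := iE.2.2 y ⟨h1, h2⟩
    exact ⟨x, by simpa [hJ] using hx⟩
  have hA1 := fun x => hA x _ (hJ x)
  have hloc : ∀ n m, jN n = some m → Loc Q R J J n m := by
    intro n m hn
    have hm := iN.2.1 _ _ hn
    refine Loc.build iN.1 hn (hB _ _ hn).1 ?_ ?_ ?_ ?_ ?_ ?_ ?_
    · exact fun x _ => ⟨(hA1 x).2.1, (hA1 x).1⟩
    · exact fun _ x _ => (hA1 x).2.2.2.2
    · exact fun x x' _ _ => Jinj x x'
    · intro y hy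
      obtain ⟨x, hx⟩ := Jsurj y (by rintro rfl; grind) (by rintro rfl; grind)
      exact ⟨x, by rw [← hx]; exact (hA1 x).2.1, hx⟩
    · exact fun x _ => ⟨(hA1 x).2.2.1, (hA1 x).1, (hA1 x).2.2.2.1⟩
    · exact fun x x' _ _ => Jinj x x'
    · intro y hy
      obtain ⟨x, hx⟩ := Jsurj y (by rintro rfl; grind) (by rintro rfl; grind)
      exact ⟨x, by rw [← hx]; exact (hA1 x).2.2.1, hx⟩
  refine ⟨fun n => ?_, ?_⟩
  · obtain ⟨m, hm⟩ := Option.ne_none_iff_exists'.1 (tN n)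
    exact (hloc n m hm).good (hG m)
  intro d hL hO
  have : ∀ y, ∃ z : ZMod 2, (∀ x, J x = y → z = d x) ∧ (y = o ∨ y = k → z = 0) := by
    intro y
    by_cases hy : y = o ∨ y = k
    · exact ⟨0, by rintro x rfl; have := Jne x; grind, fun _ => rfl⟩
    · obtain ⟨x, hx⟩ := Jsurj y (by grind) (by grind)
      exact ⟨d x, fun x' hx' => by rw [Jinj x x' (hx.trans hx'.symm)], by grind⟩
  choose K hK1 hK2 using this
  have hKJ : ∀ x, K (J x) = d x := fun x => hK1 _ _ rfl
  have hKy : ∀ y, K y ≠ 0 → ∃ x, J x = y := by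
    intro y hy
    by_cases h : y = o ∨ y = k
    · exact absurd (hK2 y h) hy
    · exact Jsurj y (by grind) (by grind)
  have key := hC K ?_ ?_
  · intro x
    rw [← hKJ]; exact key _
  · intro y hy
    obtain ⟨x, rfl⟩ := hKy y hy
    obtain ⟨t, ht, htd⟩ := hL x (by rwa [← hKJ])
    obtain ⟨m, hm⟩ := Option.ne_none_iff_exists'.1 (tN t)
    exact ⟨m, (hloc t m hm).lm _ ht, fun hd => htd ((hloc t m hm).dead.2 hd)⟩
  · intro m
    by_cases hm : m ≠ c ∧ m ≠ n₁ ∧ m ≠ b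
    · obtain ⟨n, hn⟩ := iN.2.2 m hm
      exact (hloc n m hn).ok d _ (fun x _ => (hKJ x).symm) (fun x _ => (hKJ x).symm) (hO n)
    · apply ok_zero
      · intro y hy
        by_contra hy0
        obtain ⟨x, rfl⟩ := hKy y hy0
        have := iN.2.1 _ _ (hA1 x).2.1
        exact hm (hy ▸ this)
      · intro y hy
        by_contra hy0
        obtain ⟨x, rfl⟩ := hKy y hy0
        have h1 := (hA1 x).2.2.1
        rw [hy] at h1
        obtain ⟨t, _, ht⟩ := Option.bind_eq_some_iff.1 h1
        exact hm (iN.2.1 _ _ ht)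

theorem inv_syncelim {R Q : Struct} (hI : SInv R) (h : SyncElimStep R Q) : SInv Q := by
  obtain ⟨l, sl, -, hone, jN, jE, tN, tE, iN, iE, hA, hB⟩ := h
  obtain ⟨J, hJ⟩ := jtotal tE
  obtain ⟨hG, hC⟩ := hI
  obtain ⟨g1, g2, g3, g4, g5, g6⟩ := (hG l).sync sl
  have hone' : ∀ e, R.tgt e = some l → R.sort (R.src e) = .one :=
    fun e he => hone e ((prems_iff rfl e).1 he)
  have honel : ∀ e, R.tgt e = some l → R.src e ≠ l := by
    intro e he h
    have := hone' e he
    rw [h, sl] at this; cases this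
  have Jinj : ∀ x x', J x = J x' → x = x' := fun x x' e => iE.1 _ _ _ (hJ x) (e ▸ hJ x')
  have Jne : ∀ x, R.src (J x) ≠ l := fun x => iE.2.1 _ _ (hJ x)
  have Jsurj : ∀ y, R.src y ≠ l → ∃ x, J x = y := by
    intro y h1
    obtain ⟨x, hx⟩ := iE.2.2 y h1
    exact ⟨x, by simpa [hJ] using hx⟩
  have : ∀ e, ∃ f, R.tgt e = some l → R.src f = l ∧ R.cIdx f = R.pIdx e := by
    intro e
    by_cases he : R.tgt e = some l
    · obtain ⟨f, hf⟩ := g2 e he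
      exact ⟨f, fun _ => hf⟩
    · exact ⟨e, fun h => absurd h he⟩
  choose M hM using this
  have hA1 := fun x hx => hA.1 x _ (hJ x) hx
  simp only [Set.mem_setOf_eq] at hA1
  have hB1 := fun x hx => hB x _ (M (J x)) (hJ x) hx (hM _ hx).1 (hM _ hx).2
  have hloc : ∀ n m, jN n = some m →
      Loc Q R J (fun x => if R.tgt (J x) = some l then M (J x) else J x) n m := by
    intro n m hn
    have hm : m ≠ l := iN.2.1 _ _ hn
    refine Loc.build iN.1 hn (hA.2 _ _ hn (by simp)).1 ?_ ?_ ?_ ?_ ?_ ?_ ?_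
    · intro x _
      by_cases hx : R.tgt (J x) = some l
      · exact ⟨(hB1 x hx).2.1, (hB1 x hx).1⟩
      · exact ⟨(hA1 x hx).2.1, (hA1 x hx).1⟩
    · intro _ x _
      by_cases hx : R.tgt (J x) = some l
      · exact (hB1 x hx).2.2.2.2
      · exact (hA1 x hx).2.2.2.2
    · exact fun x x' _ _ => Jinj x x'
    · intro y hy
      obtain ⟨x, rfl⟩ := Jsurj y (by grind)
      refine ⟨x, ?_, rfl⟩
      by_cases hx : R.tgt (J x) = some l
      · exact (hB1 x hx).2.1
      · exact (hA1 x hx).2.1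
    · intro x _
      by_cases hx : R.tgt (J x) = some l
      · simp only [hx, if_true]
        refine ⟨(hB1 x hx).2.2.1, ?_, (hB1 x hx).2.2.2.1⟩
        rw [g6 _ _ hx (hM _ hx).1 (hM _ hx).2]; exact (hB1 x hx).1
      · simp only [hx, if_false]
        exact ⟨(hA1 x hx).2.2.1, (hA1 x hx).1, (hA1 x hx).2.2.2.1⟩
    · intro x x' _ _ hxx
      by_cases hx : R.tgt (J x) = some l <;> by_cases hx' : R.tgt (J x') = some l <;>
        simp only [hx, hx', if_true, if_false] at hxx
      · apply Jinj
        apply g4 _ _ hx hx'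
        rw [← (hM _ hx).2, ← (hM _ hx').2, hxx]
      · exact absurd (hxx ▸ (hM _ hx).1) (Jne x')
      · exact absurd (hxx ▸ (hM _ hx').1) (Jne x)
      · exact Jinj _ _ hxx
    · intro y hy
      by_cases hyl : R.src y = l
      · obtain ⟨e, he, hp⟩ := g3 y hyl
        obtain ⟨x, rfl⟩ := Jsurj e (honel e he)
        have : M (J x) = y := g5 _ _ (hM _ he).1 hyl (by rw [(hM _ he).2, hp])
        exact ⟨x, by rw [← this]; exact (hB1 x he).2.2.1, by simp [he, this]⟩
      · obtain ⟨x, rfl⟩ := Jsurj y hyl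
        have : R.tgt (J x) ≠ some l := by rw [hy]; simpa using hm
        exact ⟨x, (hA1 x this).2.2.1, by simp [this]⟩
  have hGQ : ∀ n, GoodAt Q n := by
    intro n
    obtain ⟨m, hm⟩ := Option.ne_none_iff_exists'.1 (tN n)
    exact (hloc n m hm).good (hG m)
  refine ⟨hGQ, ?_⟩
  intro d hL hO
  have hd0 : ∀ x, R.tgt (J x) = some l → d x = 0 := by
    intro x hx
    have h1 := hone' _ hx
    have hn := (hB1 x hx).2.1
    have hs := (hloc _ _ hn).sort
    obtain ⟨o1, o2⟩ := (hGQ (Q.src x)).one (hs.trans h1)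
    have := (hO (Q.src x)).even
    rw [bd_eq, concls_of (s := {x}) (by intro e; simp; exact ⟨fun h => o2 _ _ h rfl, fun h => h ▸ rfl⟩),
      prems_of (s := ∅) (by simpa using o1)] at this
    simpa using this
  have : ∀ y, ∃ z : ZMod 2, (∀ x, J x = y → z = d x) ∧ (R.src y = l → z = 0) := by
    intro y
    by_cases hy : R.src y = l
    · exact ⟨0, by rintro x rfl; exact absurd hy (Jne x), fun _ => rfl⟩
    · obtain ⟨x, hx⟩ := Jsurj y hy
      exact ⟨d x, fun x' hx' => by rw [Jinj x x' (hx.trans hx'.symm)], fun h => absurd h hy⟩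
  choose K hK1 hK2 using this
  have hKJ : ∀ x, K (J x) = d x := fun x => hK1 _ _ rfl
  have hKy : ∀ y, K y ≠ 0 → ∃ x, J x = y := fun y hy => Jsurj y fun h => hy (hK2 y h)
  have key := hC K ?_ ?_
  · intro x
    rw [← hKJ]; exact key _
  · intro y hy
    obtain ⟨x, rfl⟩ := hKy y hy
    rw [hKJ] at hy
    obtain ⟨t, ht, htd⟩ := hL x hy
    obtain ⟨m, hm⟩ := Option.ne_none_iff_exists'.1 (tN t)
    refine ⟨m, ?_, fun hd => htd ((hloc t m hm).dead.2 hd)⟩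
    rw [← (hloc t m hm).lm _ ht, if_neg (fun h => hy (hd0 x h))]
  · intro m
    by_cases hm : m ≠ l
    · obtain ⟨n, hn⟩ := iN.2.2 m hm
      refine (hloc n m hn).ok d _ (fun x _ => (hKJ x).symm) (fun x _ => ?_) (hO n)
      by_cases hx : R.tgt (J x) = some l
      · simp only [hx, if_true]
        rw [hK2 _ (hM _ hx).1, hd0 x hx]
      · simp [hx, hKJ]
    · push Not at hm
      subst hm
      refine ok_zero (fun e he => hK2 e he) ?_
      intro y hy
      obtain ⟨x, rfl⟩ := Jsurj y (honel y hy)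
      rw [hKJ, hd0 x hy]

theorem tp_exists {Q : Struct} {n0 c' : Q.Node} {A1 A2 B1 B2 : Q.Edge}
    (p0 : Q.prems n0 = {A1, B1}) (k0 : ∀ e, Q.src e ≠ n0) (k1 : ∀ e, Q.src e ≠ c')
    (tA2 : Q.tgt A2 = some c') (tB2 : Q.tgt B2 = some c')
    (pc : ¬ Dead Q c' → Q.prems c' = {A2, B2})
    (h12 : A1 ≠ A2) (h13 : A1 ≠ B1) (h14 : A1 ≠ B2) (h23 : A2 ≠ B1) (h24 : A2 ≠ B2) (h34 : B1 ≠ B2)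
    (d : Q.Edge → ZMod 2) (hL : Live Q d) (hO : ∀ n, OKat Q d n) :
    ∃ d' : Q.Edge → ZMod 2, Live Q d' ∧ (∀ n, n ≠ n0 → n ≠ c' → OKat Q d' n) ∧
      d' A1 + d' A2 = d' B1 + d' B2 ∧ ¬ (d' B1 ≠ 0 ∧ d' B2 ≠ 0) ∧
      ((∀ e, d' e = 0) → ∀ e, d e = 0) := by
  classical
  have p0' := fun e => prems_iff p0 e
  simp only [Finset.mem_insert, Finset.mem_singleton] at p0'
  have hD : d A2 ≠ 0 ∨ d B2 ≠ 0 → ¬ Dead Q c' := by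
    rintro (h | h) hd
    · obtain ⟨t, ht, htd⟩ := hL _ h
      rw [tA2] at ht; cases ht; exact htd hd
    · obtain ⟨t, ht, htd⟩ := hL _ h
      rw [tB2] at ht; cases ht; exact htd hd
  have e1 : d A1 = d B1 := by
    have := (hO n0).even
    rw [bd_eq, p0, concls_of (s := ∅) (by simpa using k0), Finset.sum_pair h13] at this
    rw [Finset.sum_empty, zero_add] at this
    exact CharTwo.add_eq_zero.1 this
  have e2 : d A2 = d B2 := by
    by_cases h : d A2 ≠ 0 ∨ d B2 ≠ 0
    · have := (hO c').even
      rw [bd_eq, pc (hD h), concls_of (s := ∅) (by simpa using k1), Finset.sum_pair h24] at this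
      rw [Finset.sum_empty, zero_add] at this
      exact CharTwo.add_eq_zero.1 this
    · push Not at h; rw [h.1, h.2]
  by_cases hb : d B1 ≠ 0 ∧ d B2 ≠ 0
  swap
  · exact ⟨d, hL, fun n _ _ => hO n, by rw [e1, e2], hb, id⟩
  have hcD := hD (.inr hb.2)
  have pc' := fun e => prems_iff (pc hcD) e
  simp only [Finset.mem_insert, Finset.mem_singleton] at pc'
  let T : Q.Edge → Q.Node := fun e => (Q.tgt e).getD (Q.src e)
  have TA1 : T A1 = n0 := by simp [T, (p0' A1).2 (.inl rfl)]
  have TB1 : T B1 = n0 := by simp [T, (p0' B1).2 (.inr rfl)]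
  have TA2 : T A2 = c' := by simp [T, tA2]
  have TB2 : T B2 = c' := by simp [T, tB2]
  let d0 : Q.Edge → ZMod 2 := fun e => if e = A1 ∨ e = A2 ∨ e = B1 ∨ e = B2 then 0 else d e
  have hdd : d = fun e => d0 e + ((if e = A1 then 1 else 0) + ((if e = A2 then 1 else 0) +
      ((if e = B1 then 1 else 0) + (if e = B2 then 1 else 0)))) := by
    have hB1 := z2_ne hb.1
    have hB2 := z2_ne hb.2
    have hA1 := e1.trans hB1
    have hA2 := e2.trans hB2
    funext e
    by_cases q1 : e = A1
    · subst q1; simp [d0, hA1, h12, h13, h14]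
    by_cases q2 : e = A2
    · subst q2; simp [d0, hA2, h12.symm, h23, h24]
    by_cases q3 : e = B1
    · subst q3; simp [d0, hB1, h13.symm, h23.symm, h34]
    by_cases q4 : e = B2
    · subst q4; simp [d0, hB2, h14.symm, h24.symm, h34.symm]
    simp [d0, q1, q2, q3, q4]
  have g0 : ∀ n, n ≠ n0 → n ≠ c' → gbd Q.src T d0 n =
      (if Q.src A1 = n then 1 else 0) + (if Q.src A2 = n then 1 else 0) +
      (if Q.src B1 = n then 1 else 0) + (if Q.src B2 = n then 1 else 0) := by
    intro n h1 h2
    have := (hO n).even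
    rw [bd_eq_gbd _ _ hL.ne] at this
    change gbd Q.src T d n = 0 at this
    rw [hdd, gbd_add, gbd_add, gbd_add, gbd_add, gbd_single, gbd_single, gbd_single, gbd_single] at this
    simp only [TA1, TA2, TB1, TB2, h1.symm, h2.symm, if_false, add_zero] at this
    rw [CharTwo.add_eq_zero.1 this]; ring
  have hd0 : ∀ e, d0 e ≠ 0 → d e ≠ 0 ∧ e ≠ A1 ∧ e ≠ A2 ∧ e ≠ B1 ∧ e ≠ B2 := by
    intro e he
    simp only [d0] at he
    split_ifs at he with h
    · exact absurd rfl he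
    · push Not at h; exact ⟨he, h⟩
  have hT : ∀ e, d e ≠ 0 → Q.tgt e = some (T e) := by
    intro e he
    obtain ⟨t, ht, _⟩ := hL e he
    simp [T, ht]
  have gz : ∀ n, n = n0 ∨ n = c' → gbd Q.src T d0 n = 0 := by
    intro n hn
    apply Finset.sum_eq_zero
    intro e _
    by_cases he : d0 e = 0
    · simp [he]
    · obtain ⟨a, b1, b2, b3, b4⟩ := hd0 e he
      have h1 : Q.src e ≠ n := by rcases hn with rfl | rfl; exacts [k0 e, k1 e]
      have h2 : T e ≠ n := by
        intro h
        have := hT e a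
        rw [h] at this
        rcases hn with rfl | rfl
        · have := (p0' e).1 this; grind
        · have := (pc' e).1 this; grind
      simp [h1, h2]
  have main : ∃ z, (z = A2 ∨ z = B1 ∨ z = B2) ∧ ∃ p : Q.Edge → ZMod 2, (∀ e, p e ≠ 0 → d0 e ≠ 0) ∧
      ∀ n, gbd Q.src T p n = (if Q.src A1 = n then 1 else 0) + (if Q.src z = n then 1 else 0) := by
    by_cases hz : ∃ z, (z = A2 ∨ z = B1 ∨ z = B2) ∧ Q.src z = Q.src A1
    · obtain ⟨z, hz, hs⟩ := hz
      refine ⟨z, hz, fun _ => 0, by simp, ?_⟩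
      intro n; rw [hs, z2_self]; simp [gbd]
    push Not at hz
    have a2 := hz A2 (.inl rfl)
    have a3 := hz B1 (.inr (.inl rfl))
    have a4 := hz B2 (.inr (.inr rfl))
    obtain ⟨y, hy, hy0, hr⟩ := gbd_reach Q.src T d0 (Q.src A1)
      (by rw [g0 _ (k0 _) (k1 _)]; simp [a2, a3, a4])
    have hyn : y ≠ n0 ∧ y ≠ c' := by
      constructor <;> intro h <;> exact hy0 (gz y (by simp [h]))
    rw [g0 y hyn.1 hyn.2] at hy0
    have : ∃ z, (z = A2 ∨ z = B1 ∨ z = B2) ∧ Q.src z = y := by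
      by_contra hcon
      push Not at hcon
      apply hy0
      simp [hcon A2 (.inl rfl), hcon B1 (.inr (.inl rfl)), hcon B2 (.inr (.inr rfl)), hy.symm]
    obtain ⟨z, hz, rfl⟩ := this
    exact ⟨z, hz, gbd_path _ _ _ _ _ hr⟩
  obtain ⟨z, hz, p, hp, hg⟩ := main
  let d' : Q.Edge → ZMod 2 := fun e => p e + ((if e = A1 then 1 else 0) + (if e = z then 1 else 0))
  have hp0 : ∀ e, (e = A1 ∨ e = A2 ∨ e = B1 ∨ e = B2) → p e = 0 := by
    intro e he
    by_contra h
    have := hd0 e (hp e h)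
    grind
  have hsup : ∀ e, d' e ≠ 0 → d e ≠ 0 := by
    intro e he
    by_cases h1 : p e = 0
    · have : e = A1 ∨ e = z := by
        by_contra h; push Not at h
        exact he (by simp [d', h1, h.1, h.2])
      rcases this with rfl | rfl
      · rw [e1]; exact hb.1
      · rcases hz with rfl | rfl | rfl
        · rw [e2]; exact hb.2
        · exact hb.1
        · exact hb.2
    · exact (hd0 e (hp e h1)).1
  have hL' : Live Q d' := fun e he => hL e (hsup e he)
  have dA1 : d' A1 = 1 := by
    have : A1 ≠ z := by rcases hz with rfl | rfl | rfl <;> assumption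
    simp [d', hp0 A1 (.inl rfl), this]
  refine ⟨d', hL', ?_, ?_, ?_, ?_⟩
  · intro n hn1 hn2
    refine ⟨?_, fun hs e f he hf hde hdf => (hO n).par hs e f he hf (hsup e hde) (hsup f hdf),
      fun hs e f he hf hde hdf => (hO n).syn hs e f he hf (hsup e hde) (hsup f hdf)⟩
    rw [bd_eq_gbd _ _ hL'.ne]
    change gbd Q.src T d' n = 0
    have Tz : T z = n0 ∨ T z = c' := by
      rcases hz with rfl | rfl | rfl <;> simp [TA2, TB1, TB2]
    have hTz : T z ≠ n := by grind
    rw [gbd_add, gbd_add, gbd_single, gbd_single, hg, TA1]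
    simp only [hn1.symm, hTz, if_false, add_zero]
    exact z2_self _
  · rw [dA1]
    simp only [d', hp0 A2 (by simp), hp0 B1 (by simp), hp0 B2 (by simp)]
    rcases hz with rfl | rfl | rfl
    · simp [h12.symm, h13.symm, h14.symm, h23.symm, h24.symm, z2_self]
    · simp [h12.symm, h13.symm, h14.symm, h23, h34.symm]
    · simp [h12.symm, h13.symm, h14.symm, h24, h34]
  · simp only [d', hp0 B1 (by simp), hp0 B2 (by simp)]
    rcases hz with rfl | rfl | rfl
    · simp [h13.symm, h23.symm]
    · simp [h14.symm, h34.symm]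
    · simp [h13.symm, h34]
  · intro h; exact absurd ((h A1).symm.trans dA1) (by decide)

theorem dual_dual (A : Formula) : A.dual.dual = A := by
  induction A with
  | one => rfl
  | bot => rfl
  | var => rfl
  | covar => rfl
  | tens a b ha hb => simp [Formula.dual, ha, hb]
  | parr a b ha hb => simp [Formula.dual, ha, hb]

theorem inv_tensparr {R Q : Struct} (hI : SInv R) (h : TensParrStep R Q) : SInv Q := by
  obtain ⟨c, t, p, s, s', a1, a2, b1, b2, sc, st, sp, -, -, -, hss, pc, ct, cp, ha, pt, pa1, pa2,
    hb, pp, pb1, pb2, jN, jE, c', tE, iN, iE, hc', hc'u, sc', -, -, hA, hB1, hB2⟩ := h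
  obtain ⟨J, hJ⟩ := jtotal tE
  obtain ⟨hG, hC⟩ := hI
  have hDc : ¬ Dead R c := not_dead_pair pc
  have pc' := fun e => prems_iff pc e
  have pt' := fun e => prems_iff pt e
  have pp' := fun e => prems_iff pp e
  have ct' := fun e => concls_iff ct e
  have cp' := fun e => concls_iff cp e
  simp only [Finset.mem_insert, Finset.mem_singleton] at pc' pt' pp' ct' cp'
  have hct : c ≠ t := by rintro rfl; rw [sc] at st; cases st
  have hcp : c ≠ p := by rintro rfl; rw [sc] at sp; cases sp
  have htp : t ≠ p := by rintro rfl; rw [st] at sp; cases sp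
  have gc := (hG c).cut sc
  have gt := (hG t).tens st s ((ct' s).2 rfl)
  have gp := (hG p).parr sp s' ((cp' s').2 rfl)
  have typs := gc.2 hDc s s' ((pc' s).2 (.inl rfl)) ((pc' s').2 (.inr rfl)) hss
  rw [gt.2 a1 a2 ((pt' a1).2 (.inl rfl)) ((pt' a2).2 (.inr rfl)) pa1 pa2,
    gp.2 b1 b2 ((pp' b1).2 (.inl rfl)) ((pp' b2).2 (.inr rfl)) pb1 pb2] at typs
  simp only [Formula.dual, Formula.parr.injEq] at typs
  obtain ⟨ty1, ty2⟩ := typs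
  have ta1 := (pt' a1).2 (.inl rfl)
  have ta2 := (pt' a2).2 (.inr rfl)
  have tb1 := (pp' b1).2 (.inl rfl)
  have tb2 := (pp' b2).2 (.inr rfl)
  have ts := (pc' s).2 (.inl rfl)
  have ts' := (pc' s').2 (.inr rfl)
  have ss := (ct' s).2 rfl
  have ss' := (cp' s').2 rfl
  have Jinj : ∀ x x', J x = J x' → x = x' := fun x x' e => iE.1 _ _ _ (hJ x) (e ▸ hJ x')
  have Jne : ∀ x, J x ≠ s ∧ J x ≠ s' := fun x => iE.2.1 _ _ (hJ x)
  have Jsurj : ∀ y, y ≠ s → y ≠ s' → ∃ x, J x = y := by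
    intro y h1 h2
    obtain ⟨x, hx⟩ := iE.2.2 y ⟨h1, h2⟩
    exact ⟨x, by simpa [hJ] using hx⟩
  have hA1 : ∀ x, J x ≠ a1 → J x ≠ a2 → J x ≠ b1 → J x ≠ b2 → _ :=
    fun x h1 h2 h3 h4 => hA.1 x _ (hJ x) (by simp [h1, h2, h3, h4])
  have hB1' := fun x => hB1 x _ (hJ x)
  have hB2' := fun x => hB2 x _ (hJ x)
  have hsrc : ∀ x, Q.typ x = R.typ (J x) ∧ jN (Q.src x) = some (R.src (J x)) ∧
      Q.cIdx x = R.cIdx (J x) := by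
    intro x
    by_cases h1 : J x = a1 ∨ J x = b1
    · have := hB1' x h1; exact ⟨this.1, this.2.1, this.2.2.2⟩
    by_cases h2 : J x = a2 ∨ J x = b2
    · have := hB2' x h2; exact ⟨this.1, this.2.1, this.2.2.2⟩
    push Not at h1 h2
    have := hA1 x h1.1 h2.1 h1.2 h2.2; exact ⟨this.1, this.2.1, this.2.2.2.2⟩
  obtain ⟨n0, hn0⟩ := iN.2.2 c ⟨hct, hcp⟩
  have hn0c : n0 ≠ c' := by rintro rfl; rw [hc'] at hn0; cases hn0
  obtain ⟨A1, hA1e⟩ := Jsurj a1 (by rintro rfl; grind) (by rintro rfl; grind)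
  obtain ⟨A2, hA2e⟩ := Jsurj a2 (by rintro rfl; grind) (by rintro rfl; grind)
  obtain ⟨B1, hB1e⟩ := Jsurj b1 (by rintro rfl; grind) (by rintro rfl; grind)
  obtain ⟨B2, hB2e⟩ := Jsurj b2 (by rintro rfl; grind) (by rintro rfl; grind)
  have k1 : ∀ e, Q.src e ≠ c' := by
    intro e he
    have := (hsrc e).2.1
    rw [he, hc'] at this; cases this
  have k0 : ∀ e, Q.src e ≠ n0 := by
    intro e he
    have := (hsrc e).2.1
    rw [he, hn0] at this
    exact gc.1 _ (Option.some.inj this).symm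
  have p0 : ∀ e, Q.tgt e = some n0 ↔ e = A1 ∨ e = B1 := by
    intro e
    constructor
    · intro he
      by_cases h1 : J e = a1
      · left; exact Jinj _ _ (h1.trans hA1e.symm)
      by_cases h2 : J e = b1
      · right; exact Jinj _ _ (h2.trans hB1e.symm)
      exfalso
      by_cases h3 : J e = a2 ∨ J e = b2
      · have := (hB2' e h3).2.2.1
        rw [he] at this; exact hn0c (Option.some.inj this)
      push Not at h3
      have := (hA1 e h1 h3.1 h2 h3.2).2.2.1
      rw [he] at this
      simp only [Option.bind_some, hn0] at this
      have := (pc' _).1 this.symm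
      have := Jne e
      grind
    · intro he
      have : (Q.tgt e).bind jN = some c := by
        rcases he with rfl | rfl
        · exact (hB1' _ (.inl hA1e)).2.2.1
        · exact (hB1' _ (.inr hB1e)).2.2.1
      obtain ⟨k, hk, hk'⟩ := Option.bind_eq_some_iff.1 this
      rw [hk, iN.1 _ _ _ hk' hn0]
  have tA2 : Q.tgt A2 = some c' := (hB2' _ (.inl hA2e)).2.2.1
  have tB2 : Q.tgt B2 = some c' := (hB2' _ (.inr hB2e)).2.2.1
  have h12 : A1 ≠ A2 := by rintro rfl; grind
  have h13 : A1 ≠ B1 := by rintro rfl; grind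
  have h14 : A1 ≠ B2 := by rintro rfl; grind
  have h23 : A2 ≠ B1 := by rintro rfl; grind
  have h24 : A2 ≠ B2 := by rintro rfl; grind
  have h34 : B1 ≠ B2 := by rintro rfl; grind
  have pcD : ¬ Dead Q c' → ∀ e, Q.tgt e = some c' ↔ e = A2 ∨ e = B2 := by
    intro hD e
    constructor
    · intro he
      by_contra hcon
      push Not at hcon
      exact hD ⟨sc', e, A2, B2, hcon.1, hcon.2, h24, he, tA2, tB2⟩
    · rintro (rfl | rfl) <;> assumption
  have hlA : ∀ x n m, jN n = some m → m ≠ c → Q.tgt x = some n →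
      J x ≠ a1 ∧ J x ≠ a2 ∧ J x ≠ b1 ∧ J x ≠ b2 := by
    intro x n m hn hm hx
    have q1 : ¬ (J x = a1 ∨ J x = b1) := by
      intro h1
      have := (hB1' x h1).2.2.1
      rw [hx] at this
      simp only [Option.bind_some, hn] at this
      exact hm (Option.some.inj this)
    have q2 : ¬ (J x = a2 ∨ J x = b2) := by
      intro h1
      have := (hB2' x h1).2.2.1
      rw [hx] at this
      cases this
      rw [hc'] at hn; cases hn
    push Not at q1 q2
    exact ⟨q1.1, q2.1, q1.2, q2.2⟩
  have hloc : ∀ n m, jN n = some m → m ≠ c → Loc Q R J J n m := by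
    intro n m hn hmc
    have hm := iN.2.1 _ _ hn
    refine Loc.build iN.1 hn (hA.2 _ _ hn (by simp)).1 ?_ ?_ ?_ ?_ ?_ ?_ ?_
    · exact fun x _ => ⟨(hsrc x).2.1, (hsrc x).1⟩
    · exact fun _ x _ => (hsrc x).2.2
    · exact fun x x' _ _ => Jinj x x'
    · intro y hy
      obtain ⟨x, rfl⟩ := Jsurj y (by rintro rfl; grind) (by rintro rfl; grind)
      exact ⟨x, (hsrc x).2.1, rfl⟩
    · intro x hx
      obtain ⟨q1, q2, q3, q4⟩ := hlA x n m hn hmc hx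
      have := hA1 x q1 q2 q3 q4
      exact ⟨this.2.2.1, this.1, this.2.2.2.1⟩
    · exact fun x x' _ _ => Jinj x x'
    · intro y hy
      have e1 : m ≠ t := hm.1
      have e2 : m ≠ p := hm.2
      obtain ⟨x, rfl⟩ := Jsurj y (by rintro rfl; grind) (by rintro rfl; grind)
      refine ⟨x, (hA1 x ?_ ?_ ?_ ?_).2.2.1, rfl⟩ <;> intro h <;> rw [h] at hy <;> grind
  refine ⟨fun n => ?_, ?_⟩
  · by_cases hnc : n = c'
    · subst hnc
      constructor <;> intro hh <;> try (rw [sc'] at hh; cases hh; done)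
      refine ⟨k1, fun hD u v hu hv huv => ?_⟩
      rw [pcD hD] at hu hv
      rw [(hsrc u).1, (hsrc v).1]
      rcases hu with rfl | rfl <;> rcases hv with rfl | rfl
      · exact absurd rfl huv
      · rw [hA2e, hB2e, ty2]
      · rw [hA2e, hB2e, ty2, dual_dual]
      · exact absurd rfl huv
    obtain ⟨m, hm⟩ := Option.ne_none_iff_exists'.1 (fun h => hnc (hc'u n h))
    by_cases hmc : m = c
    · have : n = n0 := iN.1 _ _ _ hm (hmc ▸ hn0)
      subst this
      have sn : Q.sort n = .cut := (hA.2 _ _ hn0 (by simp)).1.trans sc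
      constructor <;> intro hh <;> try (rw [sn] at hh; cases hh; done)
      refine ⟨k0, fun hD u v hu hv huv => ?_⟩
      rw [p0] at hu hv
      rw [(hsrc u).1, (hsrc v).1]
      rcases hu with rfl | rfl <;> rcases hv with rfl | rfl
      · exact absurd rfl huv
      · rw [hA1e, hB1e, ty1]
      · rw [hA1e, hB1e, ty1, dual_dual]
      · exact absurd rfl huv
    · exact (hloc n m hm hmc).good (hG m)
  intro d hL hO
  obtain ⟨d', hL', hO', hsum, hnb, hfin⟩ := tp_exists (prems_of (by simpa using p0)) k0 k1 tA2 tB2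
    (fun hD => prems_of (by simpa using pcD hD)) h12 h13 h14 h23 h24 h34 d hL hO
  apply hfin
  clear hfin hO hL
  have : ∀ y, ∃ z : ZMod 2, (∀ x, J x = y → z = d' x) ∧ (y = s ∨ y = s' → z = d' A1 + d' A2) := by
    intro y
    by_cases hy : y = s ∨ y = s'
    · exact ⟨_, by rintro x rfl; have := Jne x; grind, fun _ => rfl⟩
    · obtain ⟨x, hx⟩ := Jsurj y (by grind) (by grind)
      exact ⟨d' x, fun x' hx' => by rw [Jinj x x' (hx.trans hx'.symm)], by grind⟩
  choose K hK1 hK2 using this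
  have hKJ : ∀ x, K (J x) = d' x := fun x => hK1 _ _ rfl
  have key := hC K ?_ ?_
  · intro x
    rw [← hKJ]; exact key _
  · intro y hy
    by_cases hyc : y = s ∨ y = s'
    · exact ⟨c, (pc' y).2 hyc, hDc⟩
    by_cases hyt : y = a1 ∨ y = a2
    · exact ⟨t, (pt' y).2 hyt, not_dead_sort (by simp [st])⟩
    by_cases hyp : y = b1 ∨ y = b2
    · exact ⟨p, (pp' y).2 hyp, not_dead_sort (by simp [sp])⟩
    obtain ⟨x, rfl⟩ := Jsurj y (by grind) (by grind)
    rw [hKJ] at hy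
    obtain ⟨t', ht, htd⟩ := hL' x hy
    have h1 : t' ≠ c' := by
      rintro rfl
      have := (pcD htd x).1 ht
      grind
    obtain ⟨m, hm⟩ := Option.ne_none_iff_exists'.1 (fun h => h1 (hc'u _ h))
    have hmc : m ≠ c := by
      rintro rfl
      have : t' = n0 := iN.1 _ _ _ hm hn0
      subst this
      have := (p0 x).1 ht
      grind
    exact ⟨m, (hloc t' m hm hmc).lm _ ht, fun hd => htd ((hloc t' m hm hmc).dead.2 hd)⟩
  · have KA1 : K a1 = d' A1 := hK1 _ _ hA1e
    have KA2 : K a2 = d' A2 := hK1 _ _ hA2e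
    have KB1 : K b1 = d' B1 := hK1 _ _ hB1e
    have KB2 : K b2 = d' B2 := hK1 _ _ hB2e
    intro m
    by_cases hmt : m = t
    · subst hmt
      refine ok_trivial ?_ (by simp [st]) (by simp [st])
      rw [bd_eq, ct, pt, Finset.sum_singleton, Finset.sum_pair ha, hK2 s (.inl rfl), KA1, KA2, z2_self]
    by_cases hmp : m = p
    · subst hmp
      refine ⟨?_, ?_, ?_⟩
      · rw [bd_eq, cp, pp, Finset.sum_singleton, Finset.sum_pair hb, hK2 s' (.inr rfl), KB1, KB2, hsum,
          z2_self]
      · intro _ e f he hf hKe hKf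
        rw [pp'] at he hf
        rw [← KB1, ← KB2] at hnb
        grind
      · intro h; rw [sp] at h; cases h
    by_cases hmc : m = c
    · subst hmc
      refine ok_trivial ?_ (by simp [sc]) (by simp [sc])
      rw [bd_eq, pc, concls_of (s := ∅) (by simpa using gc.1), Finset.sum_pair hss,
        hK2 s (.inl rfl), hK2 s' (.inr rfl), Finset.sum_empty, zero_add, z2_self]
    obtain ⟨n, hn⟩ := iN.2.2 m ⟨hmt, hmp⟩
    refine (hloc n m hn hmc).ok d' _ (fun x _ => (hKJ x).symm) (fun x _ => (hKJ x).symm) (hO' n ?_ ?_)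
    · rintro rfl; exact hmc (Option.some.inj (hn.symm.trans hn0))
    · rintro rfl; rw [hc'] at hn; cases hn

theorem cycle_of_trans {V : Type} [Fintype V] (D : V → V → Prop) (a : V)
    (h : Relation.TransGen D a a) : ∃ (C : Finset V) (s : V → V), C.Nonempty ∧
      (∀ m ∈ C, D m (s m)) ∧ Set.BijOn s C C := by
  classical
  have hs : ∀ m : {m // Relation.TransGen D m m}, ∃ m' : {m // Relation.TransGen D m m},
      D m.1 m'.1 := by
    rintro ⟨m, hm⟩
    obtain ⟨k, hk, hkm⟩ := Relation.TransGen.head'_iff.1 hm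
    exact ⟨⟨k, Relation.TransGen.tail' hkm hk⟩, hk⟩
  choose s hs using hs
  have hp : ∃ m, m ∈ Function.periodicPts s := by
    obtain ⟨i, j, hij, he⟩ := Finite.exists_ne_map_eq_of_infinite (fun n : ℕ => s^[n] ⟨a, h⟩)
    have aux : ∀ i j : ℕ, i < j → s^[i] ⟨a, h⟩ = s^[j] ⟨a, h⟩ → ∃ m, m ∈ Function.periodicPts s := by
      intro i j hl he
      refine ⟨s^[i] ⟨a, h⟩, j - i, by omega, ?_⟩
      unfold Function.IsPeriodicPt Function.IsFixedPt
      rw [← Function.iterate_add_apply, Nat.sub_add_cancel hl.le, he]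
    rcases lt_or_gt_of_ne hij with hl | hl
    · exact aux i j hl he
    · exact aux j i hl he.symm
  have hb := Function.bijOn_periodicPts s
  obtain ⟨m0, hm0⟩ := hp
  refine ⟨Finset.univ.filter fun v => ∃ hv : Relation.TransGen D v v, (⟨v, hv⟩ : {m // Relation.TransGen D m m}) ∈ Function.periodicPts s,
    fun v => if hv : Relation.TransGen D v v then (s ⟨v, hv⟩).1 else v, ⟨m0.1, ?_⟩, ?_, ?_, ?_, ?_⟩
  · simp only [Finset.mem_filter, Finset.mem_univ, true_and]; exact ⟨m0.2, hm0⟩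
  · intro m hm
    simp only [Finset.mem_filter, Finset.mem_univ, true_and] at hm
    obtain ⟨hv, hp⟩ := hm
    simp only [hv, dif_pos]
    exact hs ⟨m, hv⟩
  · intro m hm
    simp only [Finset.coe_filter, Finset.mem_univ, true_and, Set.mem_ofPred_eq] at hm ⊢
    obtain ⟨hv, hp⟩ := hm
    simp only [hv, dif_pos]
    exact ⟨(s ⟨m, hv⟩).2, hb.1 hp⟩
  · intro m hm m' hm' he
    simp only [Finset.coe_filter, Finset.mem_univ, true_and, Set.mem_ofPred_eq] at hm hm'
    obtain ⟨hv, hp⟩ := hm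
    obtain ⟨hv', hp'⟩ := hm'
    simp only [hv, hv', dif_pos] at he
    have := hb.2.1 hp hp' (Subtype.ext he)
    exact congrArg Subtype.val this
  · intro m hm
    simp only [Finset.coe_filter, Finset.mem_univ, true_and, Set.mem_ofPred_eq, Set.mem_image] at hm ⊢
    obtain ⟨hv, hp⟩ := hm
    obtain ⟨x, hx, he⟩ := hb.2.2 hp
    refine ⟨x.1, ⟨x.2, hx⟩, ?_⟩
    simp only [x.2, dif_pos]
    exact congrArg Subtype.val he

/-- dependency between links along polarized edges -/
def DE (R : Struct) (e : R.Edge) (n n' : R.Node) : Prop :=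
  ∃ t, R.tgt e = some t ∧ R.sort t ≠ .parr ∧ ¬ Dead R t ∧
    (((R.typ e).Positive ∧ t = n ∧ R.src e = n') ∨ ((R.typ e).Negative ∧ R.src e = n ∧ t = n'))

def DR (R : Struct) (n n' : R.Node) : Prop := ∃ e, DE R e n n'

theorem dr_acyclic {R : Struct} (hC : GC R) (a : R.Node) : ¬ Relation.TransGen (DR R) a a := by
  intro h
  obtain ⟨C, s, ⟨m0, hm0⟩, hD, hb⟩ := cycle_of_trans _ a h
  have : ∀ m, ∃ e, m ∈ C → DE R e m (s m) := by
    intro m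
    by_cases hm : m ∈ C
    · obtain ⟨e, he⟩ := hD m hm; exact ⟨e, fun _ => he⟩
    · obtain ⟨e, _⟩ := hD m0 hm0; exact ⟨e, fun h => absurd h hm⟩
  choose ε hε using this
  have einj : ∀ m ∈ C, ∀ m' ∈ C, ε m = ε m' → m = m' := by
    intro m hm m' hm' he
    obtain ⟨t, ht, -, -, h1⟩ := hε m hm
    obtain ⟨t', ht', -, -, h2⟩ := hε m' hm'
    rw [he] at h1 ht
    rw [ht] at ht'
    have ht' := Option.some.inj ht'
    rcases h1 with ⟨p, h1, _⟩ | ⟨p, h1, _⟩ <;> rcases h2 with ⟨p', h2, _⟩ | ⟨p', h2, _⟩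
    · rw [← h1, ← h2, ht']
    · exact (pos_not_neg p p').elim
    · exact (pos_not_neg p' p).elim
    · exact h1.symm.trans h2
  let c : R.Edge → ZMod 2 := fun e => ∑ m ∈ C, if ε m = e then 1 else 0
  have hc : ∀ e, c e ≠ 0 → ∃ m ∈ C, ε m = e := by
    intro e he
    obtain ⟨m, hm, h⟩ := Finset.exists_ne_zero_of_sum_ne_zero he
    exact ⟨m, hm, by by_contra h'; simp [h'] at h⟩
  have hc0 : c (ε m0) = 1 := by
    have : c (ε m0) = if ε m0 = ε m0 then 1 else 0 := by
      refine Finset.sum_eq_single_of_mem m0 hm0 ?_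
      intro m hm hne
      rw [if_neg]
      exact fun h => hne (einj _ hm _ hm0 h)
    simpa using this
  have := hC c ?_ ?_ (ε m0)
  · rw [hc0] at this; exact absurd this (by decide)
  · intro e he
    obtain ⟨m, hm, rfl⟩ := hc e he
    obtain ⟨t, ht, _, hd, _⟩ := hε m hm
    exact ⟨t, ht, hd⟩
  · intro n
    refine ⟨?_, ?_, ?_⟩
    · have e1 : (∑ e, if R.src e = n then c e else 0) = ∑ m ∈ C, if R.src (ε m) = n then 1 else 0 := by
        simp only [c]
        rw [← Finset.sum_filter, Finset.sum_comm]
        refine Finset.sum_congr rfl fun m _ => ?_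
        rw [Finset.sum_ite_eq]
        simp
      have e2 : (∑ e, if R.tgt e = some n then c e else 0) =
          ∑ m ∈ C, if R.tgt (ε m) = some n then 1 else 0 := by
        simp only [c]
        rw [← Finset.sum_filter, Finset.sum_comm]
        refine Finset.sum_congr rfl fun m _ => ?_
        rw [Finset.sum_ite_eq]
        simp
      unfold bd
      rw [e1, e2, ← Finset.sum_add_distrib]
      have e3 : ∀ m ∈ C, ((if R.src (ε m) = n then (1 : ZMod 2) else 0) +
          if R.tgt (ε m) = some n then 1 else 0) = (if m = n then 1 else 0) + if s m = n then 1 else 0 := by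
        intro m hm
        obtain ⟨t, ht, _, hd, h1⟩ := hε m hm
        rw [ht]
        rcases h1 with ⟨_, rfl, h2⟩ | ⟨_, h2, rfl⟩
        · rw [h2, add_comm]; simp
        · rw [h2]; simp
      rw [Finset.sum_congr rfl e3, Finset.sum_add_distrib]
      have e4 : (∑ m ∈ C, if s m = n then (1 : ZMod 2) else 0) = ∑ m ∈ C, if m = n then 1 else 0 := by
        refine Finset.sum_bij (fun m _ => s m) (fun m hm => hb.1 hm) (fun m hm m' hm' => hb.2.1 hm hm') ?_
          (fun _ _ => rfl)
        intro m hm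
        obtain ⟨x, hx, he⟩ := hb.2.2 hm
        exact ⟨x, hx, he⟩
      rw [e4, z2_self]
    · intro hs e f he _ hce _
      obtain ⟨m, hm, rfl⟩ := hc e hce
      obtain ⟨t, ht, hp, _⟩ := hε m hm
      rw [ht] at he
      exact absurd (Option.some.inj he ▸ hs) hp
    · intro hs e f he hf hce hcf
      have : ∀ e, c e ≠ 0 → R.OutEdgeOf n e → ∃ m ∈ C, ε m = e ∧ s m = n := by
        intro e hce he
        obtain ⟨m, hm, rfl⟩ := hc e hce
        refine ⟨m, hm, rfl, ?_⟩
        obtain ⟨t, ht, hp, _, h1⟩ := hε m hm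
        obtain ⟨_, he⟩ := he
        rcases h1 with ⟨p, h1, h2⟩ | ⟨p, h1, h2⟩ <;> rcases he with ⟨h3, p'⟩ | ⟨h3, p'⟩
        · rw [← h2, h3]
        · exact (pos_not_neg p p').elim
        · exact (pos_not_neg p' p).elim
        · rw [ht] at h3; rw [← h2]; exact Option.some.inj h3
      obtain ⟨m, hm, rfl, h1⟩ := this e hce he
      obtain ⟨m', hm', rfl, h2⟩ := this f hcf hf
      rw [hb.2.1 hm hm' (h1.trans h2.symm)]

structure ModelAt (R : Struct) (g : R.Edge → ℕ) (n : R.Node) : Prop where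
  tens : R.sort n = .tens → ∀ z x, R.src z = n → R.tgt x = some n → (R.typ z).Positive →
    (R.typ x).Positive → g x ≤ g z
  parr : R.sort n = .parr → ∀ x, R.tgt x = some n → (R.typ x).Negative → g x = 0
  ax : R.sort n = .ax → ∀ u v, R.src u = n → R.src v = n → (R.typ u).Positive →
    (R.typ v).Negative → g v < g u
  cut : R.sort n = .cut → ¬ Dead R n → ∀ d q, R.tgt d = some n → R.tgt q = some n →
    (R.typ d).Negative → (R.typ q).Positive → g q < g d
  sp : R.sort n = .sync → ∀ e f, R.tgt e = some n → R.src f = n → R.cIdx f = R.pIdx e →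
    (R.typ e).Positive → (R.typ f).Positive → g e ≤ g f
  sn : R.sort n = .sync → ∀ e f, R.tgt e = some n → R.src f = n → R.cIdx f = R.pIdx e →
    (R.typ e).Negative → (R.typ f).Negative → g f ≤ g e

def Model (R : Struct) (g : R.Edge → ℕ) : Prop := ∀ n, ModelAt R g n

theorem model_exists {R : Struct} (hC : GC R) : ∃ g, Model R g := by
  classical
  let r : R.Node → ℕ := fun n => (Finset.univ.filter fun n' => Relation.TransGen (DR R) n n').card
  have hr : ∀ n n', DR R n n' → r n' < r n := by
    intro n n' h
    refine Finset.card_lt_card ?_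
    rw [Finset.ssubset_iff_of_subset]
    · refine ⟨n', by simpa using Relation.TransGen.single h, ?_⟩
      simpa using dr_acyclic hC n'
    · intro k hk
      simp only [Finset.mem_filter, Finset.mem_univ, true_and] at hk ⊢
      exact Relation.TransGen.head h hk
  let nb : R.Edge → ℕ := fun e => match R.tgt e with
    | some t => if R.sort t ≠ .parr ∧ ¬ Dead R t then r t + 1 else 0
    | none => 0
  let g : R.Edge → ℕ := fun e => if (R.typ e).Positive then r (R.src e) + 1 else nb e
  have gp : ∀ e, (R.typ e).Positive → g e = r (R.src e) + 1 := fun e h => if_pos h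
  have gn : ∀ e, (R.typ e).Negative → g e = nb e := fun e h => if_neg fun h' => pos_not_neg h' h
  have gn1 : ∀ e t, (R.typ e).Negative → R.tgt e = some t → R.sort t ≠ .parr → ¬ Dead R t →
      g e = r t + 1 := by
    intro e t h ht h1 h2
    rw [gn e h]; simp only [nb, ht]; rw [if_pos ⟨h1, h2⟩]
  have gn2 : ∀ e, (R.typ e).Negative → g e ≤ r (R.src e) := by
    intro e h
    rw [gn e h]; simp only [nb]
    split
    · rename_i t ht
      split_ifs with h1
      · exact hr _ _ ⟨e, t, ht, h1.1, h1.2, .inr ⟨h, rfl, rfl⟩⟩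
      · exact Nat.zero_le _
    · exact Nat.zero_le _
  have gp2 : ∀ e t, (R.typ e).Positive → R.tgt e = some t → R.sort t ≠ .parr → ¬ Dead R t →
      g e ≤ r t := by
    intro e t h ht h1 h2
    rw [gp e h]
    exact hr _ _ ⟨e, t, ht, h1, h2, .inl ⟨h, rfl, rfl⟩⟩
  refine ⟨g, fun n => ⟨?_, ?_, ?_, ?_, ?_, ?_⟩⟩
  · intro hs z x hz hx pz px
    have := gp2 x n px hx (by simp [hs]) (not_dead_sort (by simp [hs]))
    rw [gp z pz, hz]; omega
  · intro hs x hx px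
    rw [gn x px]; simp only [nb, hx]; rw [if_neg (by simp [hs])]
  · intro hs u v hu hv pu pv
    have := gn2 v pv
    rw [gp u pu, hu]; rw [hv] at this; omega
  · intro hs hD d q hd hq pd pq
    have := gp2 q n pq hq (by simp [hs]) hD
    rw [gn1 d n pd hd (by simp [hs]) hD]; omega
  · intro hs e f he hf _ pe pf
    have := gp2 e n pe he (by simp [hs]) (not_dead_sort (by simp [hs]))
    rw [gp f pf, hf]; omega
  · intro hs e f he hf _ pe pf
    have := gn2 f pf
    rw [gn1 e n pe he (by simp [hs]) (not_dead_sort (by simp [hs]))]; rw [hf] at this; omega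

theorem Loc.model {Q R : Struct} {up lo : Q.Edge → R.Edge} {n : Q.Node} {m : R.Node}
    (h : Loc Q R up lo n m) (g : R.Edge → ℕ) (k : Q.Edge → ℕ)
    (hup : ∀ x, Q.src x = n → (Q.typ x).Positive → g (up x) ≤ k x)
    (hun : ∀ x, Q.src x = n → (Q.typ x).Negative → k x ≤ g (up x))
    (hlp : ∀ x, Q.tgt x = some n → (Q.typ x).Positive → k x ≤ g (lo x))
    (hln : ∀ x, Q.tgt x = some n → (Q.typ x).Negative → g (lo x) ≤ k x)
    (hpar : Q.sort n = .parr → ∀ x, Q.tgt x = some n → k x ≤ g (lo x))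
    (hM : ModelAt R g m) : ModelAt Q k n := by
  constructor
  · intro hs z x hz hx pz px
    have := hM.tens (h.sort ▸ hs) _ _ (h.um z hz) (h.lm x hx) (h.ut z hz ▸ pz) (h.lt x hx ▸ px)
    have := hup z hz pz
    have := hlp x hx px
    omega
  · intro hs x hx px
    have := hM.parr (h.sort ▸ hs) _ (h.lm x hx) (h.lt x hx ▸ px)
    have := hpar hs x hx
    omega
  · intro hs u v hu hv pu pv
    have := hM.ax (h.sort ▸ hs) _ _ (h.um u hu) (h.um v hv) (h.ut u hu ▸ pu) (h.ut v hv ▸ pv)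
    have := hup u hu pu
    have := hun v hv pv
    omega
  · intro hs hD d q hd hq pd pq
    have := hM.cut (h.sort ▸ hs) (fun hd => hD (h.dead.2 hd)) _ _ (h.lm d hd) (h.lm q hq)
      (h.lt d hd ▸ pd) (h.lt q hq ▸ pq)
    have := hln d hd pd
    have := hlp q hq pq
    omega
  · intro hs e f he hf hc pe pf
    have := hM.sp (h.sort ▸ hs) _ _ (h.lm e he) (h.um f hf)
      (by rw [← h.uc hs f hf, ← h.lp e he, hc]) (h.lt e he ▸ pe) (h.ut f hf ▸ pf)
    have := hlp e he pe
    have := hup f hf pf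
    omega
  · intro hs e f he hf hc pe pf
    have := hM.sn (h.sort ▸ hs) _ _ (h.lm e he) (h.um f hf)
      (by rw [← h.uc hs f hf, ← h.lp e he, hc]) (h.lt e he ▸ pe) (h.ut f hf ▸ pf)
    have := hln e he pe
    have := hun f hf pf
    omega

def fsz : Formula → ℕ
  | .tens A B => fsz A + fsz B + 1
  | .parr A B => fsz A + fsz B + 1
  | _ => 1

theorem fsz_dual (A : Formula) : fsz A.dual = fsz A := by
  induction A <;> simp_all [fsz, Formula.dual]

theorem fsz_pos (A : Formula) : 0 < fsz A := by
  cases A <;> simp [fsz]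

open Classical in
noncomputable def phi (R : Struct) (g : R.Edge → ℕ) (e : R.Edge) : ℕ :=
  if ((R.typ e).Positive ∧ R.sort (R.src e) = .sync) ∨
    ((R.typ e).Negative ∧ ∃ t, R.tgt e = some t ∧ R.sort t = .sync) then (g e + 1) * fsz (R.typ e) else 0

noncomputable def wt (R : Struct) (g : R.Edge → ℕ) : ℕ := ∑ e, phi R g e

theorem wt_lt {Q R : Struct} {g : R.Edge → ℕ} {k : Q.Edge → ℕ} (J : Q.Edge → R.Edge)
    (S : Finset Q.Edge) (r : R.Edge)
    (hinj : ∀ x x', x ∉ S → x' ∉ S → J x = J x' → x = x')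
    (hr : ∀ x, x ∉ S → J x ≠ r)
    (hle : ∀ x, x ∉ S → phi Q k x ≤ phi R g (J x))
    (hS : ∑ x ∈ S, phi Q k x < phi R g r) : wt Q k < wt R g := by
  unfold wt
  rw [← Finset.sum_add_sum_compl S, ← Finset.add_sum_erase _ _ (Finset.mem_univ r)]
  refine add_lt_add_of_lt_of_le hS ?_
  calc ∑ x ∈ Sᶜ, phi Q k x ≤ ∑ x ∈ Sᶜ, phi R g (J x) :=
        Finset.sum_le_sum fun x hx => hle x (by simpa using hx)
    _ = ∑ y ∈ Sᶜ.image J, phi R g y := by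
        rw [Finset.sum_image]
        intro x hx x' hx'
        exact hinj x x' (by simpa using hx) (by simpa using hx')
    _ ≤ _ := by
        refine Finset.sum_le_sum_of_subset ?_
        intro y hy
        obtain ⟨x, hx, rfl⟩ := Finset.mem_image.1 hy
        simp [hr x (by simpa using hx)]

theorem phi_le {Q R : Struct} {g : R.Edge → ℕ} {k : Q.Edge → ℕ} {x : Q.Edge} {y : R.Edge}
    (ht : Q.typ x = R.typ y) (hk : k x = g y)
    (h1 : (Q.typ x).Positive → Q.sort (Q.src x) = .sync → R.sort (R.src y) = .sync)
    (h2 : (Q.typ x).Negative → ∀ t, Q.tgt x = some t → Q.sort t = .sync →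
      ∃ t, R.tgt y = some t ∧ R.sort t = .sync) :
    phi Q k x ≤ phi R g y := by
  unfold phi
  split_ifs with h h'
  · rw [ht, hk]
  · exfalso
    apply h'
    rcases h with ⟨p, h⟩ | ⟨p, t, h, h3⟩
    · exact .inl ⟨ht ▸ p, h1 p h⟩
    · exact .inr ⟨ht ▸ p, h2 p t h h3⟩
  · exact Nat.zero_le _
  · exact le_rfl

theorem phi_le_self (R : Struct) (g : R.Edge → ℕ) (e : R.Edge) :
    phi R g e ≤ (g e + 1) * fsz (R.typ e) := by
  unfold phi; split_ifs <;> simp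

theorem phi_pos_src {R : Struct} {g : R.Edge → ℕ} {e : R.Edge} (hp : (R.typ e).Positive)
    (hs : R.sort (R.src e) = .sync) : phi R g e = (g e + 1) * fsz (R.typ e) :=
  if_pos (.inl ⟨hp, hs⟩)

theorem phi_neg_tgt {R : Struct} {g : R.Edge → ℕ} {e : R.Edge} {t : R.Node} (hp : (R.typ e).Negative)
    (ht : R.tgt e = some t) (hs : R.sort t = .sync) : phi R g e = (g e + 1) * fsz (R.typ e) :=
  if_pos (.inr ⟨hp, t, ht, hs⟩)

theorem phi_pos_zero {R : Struct} {g : R.Edge → ℕ} {e : R.Edge} (hp : (R.typ e).Positive)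
    (hs : R.sort (R.src e) ≠ .sync) : phi R g e = 0 := by
  refine if_neg ?_
  rintro (⟨_, h⟩ | ⟨p, _⟩)
  · exact hs h
  · exact pos_not_neg hp p

theorem phi_neg_zero {R : Struct} {g : R.Edge → ℕ} {e : R.Edge} {t : R.Node} (hp : (R.typ e).Negative)
    (ht : R.tgt e = some t) (hs : R.sort t ≠ .sync) : phi R g e = 0 := by
  refine if_neg ?_
  rintro (⟨p, _⟩ | ⟨_, t', h, h'⟩)
  · exact pos_not_neg p hp
  · rw [ht] at h; exact hs (Option.some.inj h ▸ h')

theorem good_of_wf {R : Struct} (h : R.WF) (n : R.Node) : GoodAt R n := by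
  obtain ⟨w1, w2, w3, w4, w5, w6, w7, -⟩ := h
  constructor
  · intro hs
    obtain ⟨h1, e, f, hne, h2, h3⟩ := w1 n hs
    refine ⟨fun x hx => by rw [prems_iff h1] at hx; simp at hx, fun u v hu hv huv => ?_⟩
    rw [concls_iff h2] at hu hv
    simp only [Finset.mem_insert, Finset.mem_singleton] at hu hv
    rcases hu with rfl | rfl <;> rcases hv with rfl | rfl
    · exact absurd rfl huv
    · exact h3
    · rw [h3, dual_dual]
    · exact absurd rfl huv
  · intro hs
    obtain ⟨h1, e, f, hne, h2, h3⟩ := w2 n hs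
    refine ⟨fun x hx => by rw [concls_iff h1] at hx; simp at hx, fun _ u v hu hv huv => ?_⟩
    rw [prems_iff h2] at hu hv
    simp only [Finset.mem_insert, Finset.mem_singleton] at hu hv
    rcases hu with rfl | rfl <;> rcases hv with rfl | rfl
    · exact absurd rfl huv
    · exact h3
    · rw [h3, dual_dual]
    · exact absurd rfl huv
  · intro hs z hz
    obtain ⟨e, f, g, hne, h1, pe, pf, h2, h3⟩ := w3 n hs
    have hc := fun x => concls_iff h2 x
    have hp := fun x => prems_iff h1 x
    simp only [Finset.mem_insert, Finset.mem_singleton] at hc hp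
    refine ⟨fun z' hz' => by grind, fun x y hx hy px py => ?_⟩
    have : x = e := by grind
    have : y = f := by grind
    have : z = g := by grind
    subst_vars; exact h3
  · intro hs z hz
    obtain ⟨e, f, g, hne, h1, pe, pf, h2, h3⟩ := w4 n hs
    have hc := fun x => concls_iff h2 x
    have hp := fun x => prems_iff h1 x
    simp only [Finset.mem_insert, Finset.mem_singleton] at hc hp
    refine ⟨fun z' hz' => by grind, fun x y hx hy px py => ?_⟩
    have : x = e := by grind
    have : y = f := by grind
    have : z = g := by grind
    subst_vars; exact h3
  · intro hs
    obtain ⟨h1, e, h2, h3⟩ := w5 n hs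
    refine ⟨fun x hx => by rw [prems_iff h1] at hx; simp at hx, fun u v hu hv => ?_⟩
    rw [concls_iff h2] at hu hv
    simp only [Finset.mem_singleton] at hu hv
    rw [hu, hv]
  · intro hs
    obtain ⟨h1, h2, h3, h4⟩ := w7 n hs
    simp only [Struct.prems, Struct.concls, Finset.mem_filter, Finset.mem_univ, true_and] at h1 h2 h3 h4
    refine ⟨h1, fun e he => (h2 e he).exists, fun f hf => (h3 f hf).exists, ?_, ?_, fun e f he hf => h4 e he f hf⟩
    · intro e e' he he' hp
      obtain ⟨f, hf, hc⟩ := (h2 e he).exists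
      exact (h3 f hf).unique ⟨he, hc.symm⟩ ⟨he', by rw [hc, hp]⟩
    · intro f f' hf hf' hp
      obtain ⟨e, he, hc⟩ := (h3 f hf).exists
      exact (h2 e he).unique ⟨hf, hc.symm⟩ ⟨hf', by rw [hc, hp]⟩

theorem sinv_init {R : Struct} (h : R.WF) (hC : R.Correct) : SInv R :=
  ⟨good_of_wf h, gc_of_correct R h hC⟩

theorem mult_aux {m1 m2 m3 a b gx gy gw : ℕ} (h1 : m1 ≤ (gx + 1) * a) (h2 : m2 ≤ (gy + 1) * b)
    (hx : gx ≤ gw) (hy : gy ≤ gw) (h3 : m3 = (gw + 1) * (a + b + 1)) : m1 + m2 < m3 := by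
  have := Nat.mul_le_mul_right a (Nat.succ_le_succ hx)
  have := Nat.mul_le_mul_right b (Nat.succ_le_succ hy)
  simp only [Nat.succ_eq_add_one] at *
  nlinarith

theorem no_loop {R : Struct} (hC : GC R) {w : R.Edge} {l : R.Node} (h1 : R.src w = l)
    (h2 : R.tgt w = some l) (hd : ¬ Dead R l) : False := by
  have key := hC (fun e => if e = w then 1 else 0) ?_ ?_ w
  · simp at key
  · intro e he
    have : e = w := by by_contra h; simp [h] at he
    exact ⟨l, this ▸ h2, hd⟩
  · have hw : ∀ e, (if e = w then (1 : ZMod 2) else 0) ≠ 0 → e = w := by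
      intro e he; by_contra h; simp [h] at he
    intro n
    refine ⟨?_, fun _ e f _ _ he hf => (hw e he).trans (hw f hf).symm,
      fun _ e f _ _ he hf => (hw e he).trans (hw f hf).symm⟩
    unfold bd
    rw [Finset.sum_eq_single_of_mem w (Finset.mem_univ _) (fun b _ hb => by simp [hb]),
      Finset.sum_eq_single_of_mem w (Finset.mem_univ _) (fun b _ hb => by simp [hb]), h1, h2]
    simp only [Option.some.injEq]
    exact z2_self _

theorem comm_mult {R Q : Struct} (hI : SInv R) (h : SyncMultStep R Q) :
    SInv Q ∧ ∀ g, Model R g → ∃ k, Model Q k ∧ wt Q k < wt R g := by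
  obtain ⟨l, m, z, w, x, y, i₁, i₂, sl, sm, -, -, srcz, tgtz, srcw, cw, hxy, pm, px, py, hi, hip, hic,
    jN, jE, l', m', x', y', tN, iN, iE, jl, jm, hx'y', jx', jy', jnone, hA, hx, hy, hw,
    ⟨tx', sx', gx', ppx', cx'⟩, ⟨ty', sy', gy', ppy', cy'⟩⟩ := h
  obtain ⟨hG, hC⟩ := hI
  have pm' := fun e => prems_iff pm e
  simp only [Finset.mem_insert, Finset.mem_singleton] at pm'
  have hlm : l ≠ m := by rintro rfl; rw [sl] at sm; simp at sm
  have hlm' : l' ≠ m' := by rintro rfl; rw [jl] at jm; exact hlm (Option.some.inj jm)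
  obtain ⟨g1, g2, g3, g4, g5, g6⟩ := (hG l).sync sl
  have typw : R.typ w = R.typ z := g6 z w tgtz srcw cw
  have tgx : R.tgt x = some m := (pm' x).2 (.inl rfl)
  have tgy : R.tgt y = some m := (pm' y).2 (.inr rfl)
  have conm : ∀ e, R.src e = m → e = z := by
    rcases sm with sm | sm
    · exact fun e he => ((hG m).tens sm z srcz).1 e he
    · exact fun e he => ((hG m).parr sm z srcz).1 e he
  have hfsz : fsz (R.typ z) = fsz (R.typ x) + fsz (R.typ y) + 1 := by
    rcases sm with sm | sm
    · rw [((hG m).tens sm z srcz).2 x y tgx tgy px py]; rfl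
    · rw [((hG m).parr sm z srcz).2 x y tgx tgy px py]; rfl
  have hpol : (R.sort m = .tens ∧ (R.typ z).Positive ∧ (R.typ x).Positive ∧ (R.typ y).Positive) ∨
      (R.sort m = .parr ∧ (R.typ z).Negative ∧ (R.typ x).Negative ∧ (R.typ y).Negative) := by
    have hz := g1 z tgtz
    rcases sm with sm | sm
    · left
      have := ((hG m).tens sm z srcz).2 x y tgx tgy px py
      rw [this] at hz ⊢
      rcases hz with hz | hz <;> cases hz
      rename_i h1 h2
      exact ⟨sm, .tens h1 h2, h1, h2⟩
    · right
      have := ((hG m).parr sm z srcz).2 x y tgx tgy px py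
      rw [this] at hz ⊢
      rcases hz with hz | hz <;> cases hz
      rename_i h1 h2
      exact ⟨sm, .parr h1 h2, h1, h2⟩
  let J : Q.Edge → R.Edge := fun e => (jE e).getD z
  have hJ : ∀ e, e ≠ x' → e ≠ y' → jE e = some (J e) := by
    intro e h1 h2
    obtain ⟨b, hb⟩ := Option.ne_none_iff_exists'.1 (fun h => (jnone e h).elim h1 h2)
    simp [J, hb]
  have Jx' : J x' = z := by simp [J, jx']
  have Jy' : J y' = z := by simp [J, jy']
  have Jne : ∀ e, e ≠ x' → e ≠ y' → J e ≠ z := fun e h1 h2 => iE.2.1 _ _ (hJ e h1 h2)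
  have Jinj : ∀ e e', e ≠ x' → e ≠ y' → e' ≠ x' → e' ≠ y' → J e = J e' → e = e' :=
    fun e e' h1 h2 h3 h4 h => iE.1 _ _ _ (hJ e h1 h2) (h ▸ hJ e' h3 h4)
  have Jsurj : ∀ y, y ≠ z → ∃ e, e ≠ x' ∧ e ≠ y' ∧ J e = y := by
    intro y hy
    obtain ⟨e, he⟩ := iE.2.2 y hy
    refine ⟨e, ?_, ?_, by simp [J, he]⟩
    · rintro rfl; rw [jx'] at he; cases he
    · rintro rfl; rw [jy'] at he; cases he
  clear_value J
  have hxz : x ≠ z := by rintro rfl; rw [tgtz] at tgx; exact hlm (Option.some.inj tgx)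
  have hyz : y ≠ z := by rintro rfl; rw [tgtz] at tgy; exact hlm (Option.some.inj tgy)
  have hwz : w ≠ z := by rintro rfl; exact hlm (srcw.symm.trans srcz)
  obtain ⟨X, X1, X2, JX⟩ := Jsurj x hxz
  obtain ⟨Y, Y1, Y2, JY⟩ := Jsurj y hyz
  obtain ⟨W, W1, W2, JW⟩ := Jsurj w hwz
  replace hx := hx X (JX ▸ hJ X X1 X2)
  replace hy := hy Y (JY ▸ hJ Y Y1 Y2)
  replace hw := hw W (JW ▸ hJ W W1 W2)
  have hxw : x ≠ w := by
    intro e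
    have : X = W := Jinj _ _ X1 X2 W1 W2 (by rw [JX, JW, e])
    have h1 := hx.2.1
    rw [this, hw.2.1, jm, e, srcw] at h1
    exact hlm (Option.some.inj h1).symm
  have hyw : y ≠ w := by
    intro e
    have : Y = W := Jinj _ _ Y1 Y2 W1 W2 (by rw [JY, JW, e])
    have h1 := hy.2.1
    rw [this, hw.2.1, jm, e, srcw] at h1
    exact hlm (Option.some.inj h1).symm
  have hXY : X ≠ Y := by rintro rfl; exact hxy (JX.symm.trans JY)
  have hXW : X ≠ W := by rintro rfl; exact hxw (JX.symm.trans JW)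
  have hYW : Y ≠ W := by rintro rfl; exact hyw (JY.symm.trans JW)
  have JXi : ∀ e, e ≠ x' → e ≠ y' → J e = x → e = X := fun e h1 h2 h => Jinj _ _ h1 h2 X1 X2 (h.trans JX.symm)
  have JYi : ∀ e, e ≠ x' → e ≠ y' → J e = y → e = Y := fun e h1 h2 h => Jinj _ _ h1 h2 Y1 Y2 (h.trans JY.symm)
  have JWi : ∀ e, e ≠ x' → e ≠ y' → J e = w → e = W := fun e h1 h2 h => Jinj _ _ h1 h2 W1 W2 (h.trans JW.symm)
  have hA1 : ∀ e, e ≠ x' → e ≠ y' → e ≠ X → e ≠ Y → e ≠ W → Q.typ e = R.typ (J e) ∧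
      jN (Q.src e) = some (R.src (J e)) ∧ (Q.tgt e).bind jN = R.tgt (J e) ∧
      Q.pIdx e = R.pIdx (J e) ∧ Q.cIdx e = R.cIdx (J e) := by
    intro e h1 h2 h3 h4 h5
    refine hA.1 e _ (hJ e h1 h2) ?_
    simp only [Set.mem_insert_iff, Set.mem_singleton_iff, not_or]
    exact ⟨fun h => h3 (JXi e h1 h2 h), fun h => h4 (JYi e h1 h2 h), fun h => h5 (JWi e h1 h2 h)⟩
  have hTyp : ∀ e, e ≠ x' → e ≠ y' → Q.typ e = R.typ (J e) := by
    intro e h1 h2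
    by_cases h3 : e = X
    · rw [h3, JX]; exact hx.1
    by_cases h4 : e = Y
    · rw [h4, JY]; exact hy.1
    by_cases h5 : e = W
    · rw [h5, JW]; exact hw.1
    exact (hA1 e h1 h2 h3 h4 h5).1
  have hSrc : ∀ e, e ≠ x' → e ≠ y' → e ≠ W → jN (Q.src e) = some (R.src (J e)) := by
    intro e h1 h2 h5
    by_cases h3 : e = X
    · rw [h3, JX]; exact hx.2.1
    by_cases h4 : e = Y
    · rw [h4, JY]; exact hy.2.1
    exact (hA1 e h1 h2 h3 h4 h5).2.1
  have hTgt : ∀ e, e ≠ x' → e ≠ y' → e ≠ X → e ≠ Y → (Q.tgt e).bind jN = R.tgt (J e) ∧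
      Q.pIdx e = R.pIdx (J e) := by
    intro e h1 h2 h3 h4
    by_cases h5 : e = W
    · rw [h5, JW]; exact ⟨hw.2.2.1, hw.2.2.2.1⟩
    exact ⟨(hA1 e h1 h2 h3 h4 h5).2.2.1, (hA1 e h1 h2 h3 h4 h5).2.2.2.1⟩
  have hCi : ∀ e, e ≠ x' → e ≠ y' → Q.cIdx e = R.cIdx (J e) := by
    intro e h1 h2
    by_cases h3 : e = X
    · rw [h3, JX]; exact hx.2.2.2.2
    by_cases h4 : e = Y
    · rw [h4, JY]; exact hy.2.2.2.2
    by_cases h5 : e = W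
    · rw [h5, JW]; exact hw.2.2.2.2
    exact (hA1 e h1 h2 h3 h4 h5).2.2.2.2
  have hSort : ∀ n mm, jN n = some mm → Q.sort n = R.sort mm := fun n mm hn => (hA.2 _ _ hn (by simp)).1
  have jNtgt : ∀ e n mm, e ≠ x' → e ≠ y' → e ≠ X → e ≠ Y → jN n = some mm →
      (Q.tgt e = some n ↔ R.tgt (J e) = some mm) := by
    intro e n mm h1 h2 h3 h4 hn
    rw [← (hTgt e h1 h2 h3 h4).1]
    constructor
    · intro h; rw [h]; exact hn
    · intro h
      obtain ⟨k, hk, hk'⟩ := Option.bind_eq_some_iff.1 h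
      rw [hk, iN.1 _ _ _ hk' hn]
  have jNsrc : ∀ e n mm, e ≠ x' → e ≠ y' → e ≠ W → jN n = some mm → (Q.src e = n ↔ R.src (J e) = mm) := by
    intro e n mm h1 h2 h3 hn
    have := hSrc e h1 h2 h3
    constructor
    · intro h; rw [h, hn] at this; exact (Option.some.inj this).symm
    · intro h; rw [h] at this; exact iN.1 _ _ _ this hn
  have tgl : ∀ e, Q.tgt e = some l' ↔ e = X ∨ e = Y ∨
      (e ≠ x' ∧ e ≠ y' ∧ e ≠ X ∧ e ≠ Y ∧ R.tgt (J e) = some l) := by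
    intro e
    by_cases h3 : e = X
    · simp [h3, hx.2.2.1]
    by_cases h4 : e = Y
    · simp [h4, hy.2.2.1]
    by_cases h1 : e = x'
    · rw [h1] at h3 h4; simp [h1, gx', h3, h4, hlm'.symm]
    by_cases h2 : e = y'
    · rw [h2] at h3 h4; simp [h2, gy', h3, h4, hlm'.symm]
    rw [jNtgt e l' l h1 h2 h3 h4 jl]
    simp [h1, h2, h3, h4]
  have srl : ∀ e, Q.src e = l' ↔ e = x' ∨ e = y' ∨ (e ≠ x' ∧ e ≠ y' ∧ e ≠ W ∧ R.src (J e) = l) := by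
    intro e
    by_cases h1 : e = x'
    · simp [h1, sx']
    by_cases h2 : e = y'
    · simp [h2, sy']
    by_cases h3 : e = W
    · rw [h3] at h1 h2; simp [h3, h1, h2, hw.2.1, hlm'.symm]
    rw [jNsrc e l' l h1 h2 h3 jl]
    simp [h1, h2, h3]
  have cm' : Q.concls m' = {W} := by
    refine concls_of fun e => ?_
    rw [Finset.mem_singleton]
    constructor
    · intro h
      by_contra h3
      by_cases h1 : e = x'
      · rw [h1, sx'] at h; exact hlm' h
      by_cases h2 : e = y'
      · rw [h2, sy'] at h; exact hlm' h
      exact Jne e h1 h2 (conm _ ((jNsrc e m' m h1 h2 h3 jm).1 h))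
    · rintro rfl; exact hw.2.1
  have pm'' : Q.prems m' = {x', y'} := by
    refine prems_of fun e => ?_
    simp only [Finset.mem_insert, Finset.mem_singleton]
    constructor
    · intro h
      by_contra h1
      push Not at h1
      have h3 : e ≠ X := by rintro rfl; rw [hx.2.2.1] at h; exact hlm' (Option.some.inj h)
      have h4 : e ≠ Y := by rintro rfl; rw [hy.2.2.1] at h; exact hlm' (Option.some.inj h)
      have := (pm' _).1 ((jNtgt e m' m h1.1 h1.2 h3 h4 jm).1 h)
      exact this.elim (fun h => h3 (JXi e h1.1 h1.2 h)) (fun h => h4 (JYi e h1.1 h1.2 h))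
    · rintro (rfl | rfl) <;> assumption
  have sl' : Q.sort l' = .sync := (hSort _ _ jl).trans sl
  have sm' := hSort _ _ jm
  let up : Q.Edge → R.Edge := fun e => if e = W then z else J e
  let lo : Q.Edge → R.Edge := fun e => if e = x' then x else if e = y' then y else J e
  have hlo : ∀ e, e ≠ x' → e ≠ y' → lo e = J e := fun e h1 h2 => by simp [lo, h1, h2]
  have lox' : lo x' = x := by simp [lo]
  have loy' : lo y' = y := by simp [lo, hx'y'.symm]
  have hup : ∀ e, e ≠ W → up e = J e := fun e h1 => by simp [up, h1]
  have upW : up W = z := by simp [up]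
  clear_value up lo
  have hloc : ∀ n mm, jN n = some mm → mm ≠ l → Loc Q R up lo n mm := by
    intro n mm hn hml
    have hnl : n ≠ l' := by rintro rfl; rw [jl] at hn; exact hml (Option.some.inj hn).symm
    have nx : ∀ e, Q.src e = n → e ≠ x' ∧ e ≠ y' := by
      intro e he
      constructor
      · rintro rfl; exact hnl (he.symm.trans sx')
      · rintro rfl; exact hnl (he.symm.trans sy')
    have nX : ∀ e, Q.tgt e = some n → e ≠ X ∧ e ≠ Y := by
      intro e he
      constructor
      · rintro rfl; rw [hx.2.2.1] at he; exact hnl (Option.some.inj he).symm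
      · rintro rfl; rw [hy.2.2.1] at he; exact hnl (Option.some.inj he).symm
    refine Loc.build iN.1 hn (hSort _ _ hn) ?_ ?_ ?_ ?_ ?_ ?_ ?_
    · intro e he
      obtain ⟨h1, h2⟩ := nx e he
      by_cases h3 : e = W
      · rw [h3, upW, hw.2.1, jm, srcz, hw.1, typw]; simp
      · rw [hup e h3]; exact ⟨hSrc e h1 h2 h3, hTyp e h1 h2⟩
    · intro hs e he
      obtain ⟨h1, h2⟩ := nx e he
      by_cases h3 : e = W
      · rw [h3, hw.2.1] at he
        rw [← he, jm] at hn
        rw [← Option.some.inj hn] at hs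
        rw [hs] at sm; simp at sm
      · rw [hup e h3]; exact hCi e h1 h2
    · intro e e' he he' hee
      obtain ⟨h1, h2⟩ := nx e he
      obtain ⟨h1', h2'⟩ := nx e' he'
      by_cases h3 : e = W <;> by_cases h3' : e' = W
      · rw [h3, h3']
      · rw [h3, upW, hup e' h3'] at hee; exact absurd hee.symm (Jne e' h1' h2')
      · rw [h3', upW, hup e h3] at hee; exact absurd hee (Jne e h1 h2)
      · rw [hup e h3, hup e' h3'] at hee; exact Jinj e e' h1 h2 h1' h2' hee
    · intro f hf
      by_cases hfz : f = z
      · exact ⟨W, by rw [hw.2.1, jm, hfz, srcz], by rw [upW, hfz]⟩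
      · obtain ⟨e, h1, h2, rfl⟩ := Jsurj f hfz
        have h3 : e ≠ W := by rintro rfl; rw [JW, srcw] at hf; exact hml hf.symm
        exact ⟨e, hSrc e h1 h2 h3, hup e h3⟩
    · intro e he
      obtain ⟨h3, h4⟩ := nX e he
      by_cases h1 : e = x'
      · rw [h1, lox', gx', tgx, tx', ppx', px]; simpa using jm
      by_cases h2 : e = y'
      · rw [h2, loy', gy', tgy, ty', ppy', py]; simpa using jm
      rw [hlo e h1 h2]
      exact ⟨(hTgt e h1 h2 h3 h4).1, hTyp e h1 h2, (hTgt e h1 h2 h3 h4).2⟩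
    · intro e e' he he' hee
      obtain ⟨h3, h4⟩ := nX e he
      obtain ⟨h3', h4'⟩ := nX e' he'
      have cs : ∀ e, e = x' ∨ e = y' ∨ (e ≠ x' ∧ e ≠ y') := fun e => by tauto
      rcases cs e with h | h | ⟨h1, h2⟩ <;> rcases cs e' with h' | h' | ⟨h1', h2'⟩
      · rw [h, h']
      · rw [h, h', lox', loy'] at hee; exact absurd hee hxy
      · rw [h, lox', hlo e' h1' h2'] at hee; exact absurd (JXi e' h1' h2' hee.symm) h3'
      · rw [h, h', lox', loy'] at hee; exact absurd hee.symm hxy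
      · rw [h, h']
      · rw [h, loy', hlo e' h1' h2'] at hee; exact absurd (JYi e' h1' h2' hee.symm) h4'
      · rw [h', lox', hlo e h1 h2] at hee; exact absurd (JXi e h1 h2 hee) h3
      · rw [h', loy', hlo e h1 h2] at hee; exact absurd (JYi e h1 h2 hee) h4
      · rw [hlo e h1 h2, hlo e' h1' h2'] at hee; exact Jinj e e' h1 h2 h1' h2' hee
    · intro f hf
      by_cases hfx : f = x
      · exact ⟨x', by rw [gx', hfx, tgx]; exact jm, by rw [lox', hfx]⟩
      by_cases hfy : f = y
      · exact ⟨y', by rw [gy', hfy, tgy]; exact jm, by rw [loy', hfy]⟩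
      have hfz : f ≠ z := by rintro rfl; rw [tgtz] at hf; exact hml (Option.some.inj hf).symm
      obtain ⟨e, h1, h2, rfl⟩ := Jsurj f hfz
      exact ⟨e, (hTgt e h1 h2 (fun h => hfx (h ▸ JX)) (fun h => hfy (h ▸ JY))).1, hlo e h1 h2⟩
  have mne : m ≠ l := hlm.symm
  refine ⟨⟨?_, ?_⟩, ?_⟩
  · -- GoodAt
    intro n
    by_cases hnl : n = l'
    · rw [hnl]
      have gs : (∀ e, Q.tgt e = some l' → (Q.typ e).Polarized) ∧
        (∀ e, Q.tgt e = some l' → ∃ f, Q.src f = l' ∧ Q.cIdx f = Q.pIdx e) ∧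
        (∀ f, Q.src f = l' → ∃ e, Q.tgt e = some l' ∧ Q.pIdx e = Q.cIdx f) ∧
        (∀ e e', Q.tgt e = some l' → Q.tgt e' = some l' → Q.pIdx e = Q.pIdx e' → e = e') ∧
        (∀ f f', Q.src f = l' → Q.src f' = l' → Q.cIdx f = Q.cIdx f' → f = f') ∧
        (∀ e f, Q.tgt e = some l' → Q.src f = l' → Q.cIdx f = Q.pIdx e → Q.typ f = Q.typ e) := by
        have hX4 := hx.2.2.2.1
        have hY4 := hy.2.2.2.1
        refine ⟨?_, ?_, ?_, ?_, ?_, ?_⟩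
        · intro e he
          rcases (tgl e).1 he with rfl | rfl | ⟨h1, h2, h3, h4, h5⟩
          · rw [hx.1]; rcases hpol with h | h
            · exact .inl h.2.2.1
            · exact .inr h.2.2.1
          · rw [hy.1]; rcases hpol with h | h
            · exact .inl h.2.2.2
            · exact .inr h.2.2.2
          · rw [hTyp e h1 h2]; exact g1 _ h5
        · intro e he
          rcases (tgl e).1 he with rfl | rfl | ⟨h1, h2, h3, h4, h5⟩
          · exact ⟨x', sx', by rw [cx', hX4]⟩
          · exact ⟨y', sy', by rw [cy', hY4]⟩
          · obtain ⟨f, hf, hc⟩ := g2 _ h5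
            have hfz : f ≠ z := by rintro rfl; exact hlm (hf.symm.trans srcz)
            obtain ⟨f, k1, k2, rfl⟩ := Jsurj f hfz
            have k3 : f ≠ W := by
              rintro rfl
              rw [JW, cw] at hc
              exact Jne e h1 h2 (g4 _ _ tgtz h5 hc).symm
            exact ⟨f, (srl f).2 (.inr (.inr ⟨k1, k2, k3, hf⟩)),
              by rw [hCi f k1 k2, hc, (hTgt e h1 h2 h3 h4).2]⟩
        · intro f hf
          rcases (srl f).1 hf with rfl | rfl | ⟨h1, h2, h3, h5⟩
          · exact ⟨X, hx.2.2.1, by rw [hX4, cx']⟩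
          · exact ⟨Y, hy.2.2.1, by rw [hY4, cy']⟩
          · obtain ⟨e, he, hc⟩ := g3 _ h5
            have hez : e ≠ z := by
              rintro rfl
              rw [← cw] at hc
              exact h3 (JWi f h1 h2 (g5 _ _ h5 srcw hc.symm))
            obtain ⟨e, k1, k2, rfl⟩ := Jsurj e hez
            have k3 : e ≠ X := by rintro rfl; rw [JX, tgx] at he; exact hlm (Option.some.inj he).symm
            have k4 : e ≠ Y := by rintro rfl; rw [JY, tgy] at he; exact hlm (Option.some.inj he).symm
            exact ⟨e, (tgl e).2 (.inr (.inr ⟨k1, k2, k3, k4, he⟩)),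
              by rw [(hTgt e k1 k2 k3 k4).2, hc, hCi f h1 h2]⟩
        · intro e e' he he' hp
          rcases (tgl e).1 he with h | h | ⟨h1, h2, h3, h4, h5⟩ <;>
          rcases (tgl e').1 he' with h' | h' | ⟨h1', h2', h3', h4', h5'⟩
          · rw [h, h']
          · rw [h, h', hX4, hY4] at hp; exact absurd hp hi
          · rw [h, hX4, (hTgt e' h1' h2' h3' h4').2] at hp; exact absurd hp.symm (hip _ h5').1
          · rw [h, h', hX4, hY4] at hp; exact absurd hp.symm hi
          · rw [h, h']
          · rw [h, hY4, (hTgt e' h1' h2' h3' h4').2] at hp; exact absurd hp.symm (hip _ h5').2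
          · rw [h', hX4, (hTgt e h1 h2 h3 h4).2] at hp; exact absurd hp (hip _ h5).1
          · rw [h', hY4, (hTgt e h1 h2 h3 h4).2] at hp; exact absurd hp (hip _ h5).2
          · rw [(hTgt e h1 h2 h3 h4).2, (hTgt e' h1' h2' h3' h4').2] at hp
            exact Jinj _ _ h1 h2 h1' h2' (g4 _ _ h5 h5' hp)
        · intro e e' he he' hp
          rcases (srl e).1 he with h | h | ⟨h1, h2, h3, h5⟩ <;>
          rcases (srl e').1 he' with h' | h' | ⟨h1', h2', h3', h5'⟩
          · rw [h, h']
          · rw [h, h', cx', cy'] at hp; exact absurd hp hi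
          · rw [h, cx', hCi e' h1' h2'] at hp; exact absurd hp.symm (hic _ h5').1
          · rw [h, h', cx', cy'] at hp; exact absurd hp.symm hi
          · rw [h, h']
          · rw [h, cy', hCi e' h1' h2'] at hp; exact absurd hp.symm (hic _ h5').2
          · rw [h', cx', hCi e h1 h2] at hp; exact absurd hp (hic _ h5).1
          · rw [h', cy', hCi e h1 h2] at hp; exact absurd hp (hic _ h5).2
          · rw [hCi e h1 h2, hCi e' h1' h2'] at hp
            exact Jinj _ _ h1 h2 h1' h2' (g5 _ _ h5 h5' hp)
        · intro e f he hf hp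
          rcases (tgl e).1 he with h | h | ⟨h1, h2, h3, h4, h5⟩ <;>
          rcases (srl f).1 hf with h' | h' | ⟨h1', h2', h3', h5'⟩
          · rw [h, h', tx', hx.1]
          · rw [h, h', cy', hX4] at hp; exact absurd hp.symm hi
          · rw [h, hX4, hCi f h1' h2'] at hp; exact absurd hp (hic _ h5').1
          · rw [h, h', cx', hY4] at hp; exact absurd hp hi
          · rw [h, h', ty', hy.1]
          · rw [h, hY4, hCi f h1' h2'] at hp; exact absurd hp (hic _ h5').2
          · rw [h', cx', (hTgt e h1 h2 h3 h4).2] at hp; exact absurd hp.symm (hip _ h5).1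
          · rw [h', cy', (hTgt e h1 h2 h3 h4).2] at hp; exact absurd hp.symm (hip _ h5).2
          · rw [(hTgt e h1 h2 h3 h4).2, hCi f h1' h2'] at hp
            rw [hTyp e h1 h2, hTyp f h1' h2']
            exact g6 _ _ h5 h5' hp
      constructor <;> intro hs
      all_goals first | exact gs | (rw [sl'] at hs; cases hs)
    · obtain ⟨mm, hm⟩ := Option.ne_none_iff_exists'.1 (tN n)
      exact (hloc n mm hm fun h => hnl (iN.1 _ _ _ (h ▸ hm) jl)).good (hG mm)
  · -- GC
    intro c hL hO
    have em := (hO m').even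
    rw [bd_eq, cm', pm'', Finset.sum_singleton, Finset.sum_pair hx'y'] at em
    have hatm : c x' ≠ 0 → c y' ≠ 0 → False := by
      intro h1 h2
      rcases hpol with ⟨s, -, p1, p2⟩ | ⟨s, -, p1, p2⟩
      · exact hx'y' ((hO l').syn sl' x' y' ⟨sl', .inl ⟨sx', tx' ▸ p1⟩⟩ ⟨sl', .inl ⟨sy', ty' ▸ p2⟩⟩ h1 h2)
      · exact hx'y' ((hO m').par (sm'.trans s) x' y' gx' gy' h1 h2)
    have : ∀ f, ∃ v : ZMod 2, (∀ e, e ≠ x' → e ≠ y' → J e = f → v = c e) ∧ (f = z → v = c X + c Y) := by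
      intro f
      by_cases hf : f = z
      · exact ⟨_, fun e h1 h2 h => absurd (h.trans hf) (Jne e h1 h2), fun _ => rfl⟩
      · obtain ⟨e, h1, h2, he⟩ := Jsurj f hf
        exact ⟨c e, fun e' h1' h2' he' => by rw [Jinj e e' h1 h2 h1' h2' (he.trans he'.symm)],
          fun h => absurd h hf⟩
    choose K hK1 hK2 using this
    have hKJ : ∀ e, e ≠ x' → e ≠ y' → K (J e) = c e := fun e h1 h2 => hK1 _ e h1 h2 rfl
    have Kx : K x = c X := by rw [← JX]; exact hKJ X X1 X2
    have Ky : K y = c Y := by rw [← JY]; exact hKJ Y Y1 Y2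
    have Kw : K w = c W := by rw [← JW]; exact hKJ W W1 W2
    have Kz : K z = c X + c Y := hK2 z rfl
    have hLK : Live R K := by
      intro f hf
      by_cases hfz : f = z
      · exact ⟨l, hfz ▸ tgtz, not_dead_sort (by simp [sl])⟩
      by_cases hfx : f = x
      · exact ⟨m, hfx ▸ tgx, not_dead_sort (by rcases sm with h | h <;> simp [h])⟩
      by_cases hfy : f = y
      · exact ⟨m, hfy ▸ tgy, not_dead_sort (by rcases sm with h | h <;> simp [h])⟩
      obtain ⟨e, h1, h2, rfl⟩ := Jsurj f hfz
      have h3 : e ≠ X := fun h => hfx (h ▸ JX)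
      have h4 : e ≠ Y := fun h => hfy (h ▸ JY)
      rw [hKJ e h1 h2] at hf
      obtain ⟨t, ht, hd⟩ := hL e hf
      obtain ⟨mm, hm⟩ := Option.ne_none_iff_exists'.1 (tN t)
      refine ⟨mm, (jNtgt e t mm h1 h2 h3 h4 hm).1 ht, ?_⟩
      by_cases hml : mm = l
      · rw [hml]; exact not_dead_sort (by simp [sl])
      · exact fun h => hd ((hloc t mm hm hml).dead.2 h)
    have hOK : ∀ mm, mm ≠ l → OKat R K mm := by
      intro mm hml
      by_cases hmm : mm = m
      · subst hmm
        refine ⟨?_, ?_, ?_⟩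
        · rw [bd_eq, pm, concls_of (s := {z}) (by intro e; simp; exact ⟨conm e, fun h => h ▸ srcz⟩),
            Finset.sum_singleton, Finset.sum_pair hxy, Kx, Ky, Kz, z2_self]
        · intro hs e f he hf hKe hKf
          rw [pm'] at he hf
          by_contra hne
          have hXY' : c X ≠ 0 ∧ c Y ≠ 0 := by
            rcases he with rfl | rfl <;> rcases hf with rfl | rfl
            · exact absurd rfl hne
            · exact ⟨Kx ▸ hKe, Ky ▸ hKf⟩
            · exact ⟨Kx ▸ hKf, Ky ▸ hKe⟩
            · exact absurd rfl hne
          rcases hpol with ⟨s, -, p1, p2⟩ | ⟨s, -, p1, p2⟩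
          · rw [s] at hs; cases hs
          · exact hXY ((hO l').syn sl' X Y ⟨sl', .inr ⟨hx.2.2.1, hx.1 ▸ p1⟩⟩
              ⟨sl', .inr ⟨hy.2.2.1, hy.1 ▸ p2⟩⟩ hXY'.1 hXY'.2)
        · intro hs; rw [hs] at sm; simp at sm
      · obtain ⟨n, hn⟩ := iN.2.2 mm trivial
        have hnl : n ≠ l' := by rintro rfl; rw [jl] at hn; exact hml (Option.some.inj hn).symm
        have hnm : n ≠ m' := by rintro rfl; rw [jm] at hn; exact hmm (Option.some.inj hn).symm
        refine (hloc n mm hn hml).ok c _ ?_ ?_ (hO n)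
        · intro e he
          have h1 : e ≠ x' := by rintro rfl; exact hnl (he.symm.trans sx')
          have h2 : e ≠ y' := by rintro rfl; exact hnl (he.symm.trans sy')
          have h3 : e ≠ W := by rintro rfl; exact hnm (he.symm.trans hw.2.1)
          rw [hup e h3, hKJ e h1 h2]
        · intro e he
          have h1 : e ≠ x' := by rintro rfl; rw [gx'] at he; exact hnm (Option.some.inj he).symm
          have h2 : e ≠ y' := by rintro rfl; rw [gy'] at he; exact hnm (Option.some.inj he).symm
          rw [hlo e h1 h2, hKJ e h1 h2]
    have key := hC K hLK ?_
    · have k0 : ∀ e, e ≠ x' → e ≠ y' → c e = 0 := fun e h1 h2 => by rw [← hKJ e h1 h2]; exact key _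
      rw [k0 W W1 W2, zero_add] at em
      have h2 : c x' = 0 := by
        by_contra h
        refine hatm h fun h' => ?_
        rw [h', add_zero] at em
        exact h em
      rw [h2, zero_add] at em
      intro e
      by_cases h1 : e = x'
      · rw [h1, h2]
      by_cases h2 : e = y'
      · rw [h2, em]
      exact k0 e h1 h2
    · intro mm
      by_cases hml : mm = l
      swap
      · exact hOK mm hml
      rw [hml]
      refine ⟨bd_last hLK l fun n hn => (hOK n hn).even, fun h => (by rw [sl] at h; cases h), ?_⟩
      intro _
      have aux : ∀ ψ : Q.Edge → R.Edge, (∀ f, R.OutEdgeOf l f → K f ≠ 0 → ∃ e, Q.OutEdgeOf l' e ∧ c e ≠ 0 ∧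
          ψ e = f) → ∀ e f, R.OutEdgeOf l e → R.OutEdgeOf l f → K e ≠ 0 → K f ≠ 0 → e = f := by
        intro ψ hψ e f he hf ke kf
        obtain ⟨e1, he1, ke1, h1⟩ := hψ e he ke
        obtain ⟨f1, hf1, kf1, h2⟩ := hψ f hf kf
        rw [← h1, ← h2, (hO l').syn sl' e1 f1 he1 hf1 ke1 kf1]
      have old : ∀ e, e ≠ x' → e ≠ y' → e ≠ W → R.OutEdgeOf l (J e) → Q.OutEdgeOf l' e := by
        rintro e h1 h2 h3 ⟨_, h | h⟩
        · exact ⟨sl', .inl ⟨(srl e).2 (.inr (.inr ⟨h1, h2, h3, h.1⟩)), hTyp e h1 h2 ▸ h.2⟩⟩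
        · have k3 : e ≠ X := by rintro rfl; rw [JX, tgx] at h; exact hlm (Option.some.inj h.1).symm
          have k4 : e ≠ Y := by rintro rfl; rw [JY, tgy] at h; exact hlm (Option.some.inj h.1).symm
          exact ⟨sl', .inr ⟨(tgl e).2 (.inr (.inr ⟨h1, h2, k3, k4, h.1⟩)), hTyp e h1 h2 ▸ h.2⟩⟩
      rcases hpol with ⟨s, p0, p1, p2⟩ | ⟨s, p0, p1, p2⟩
      · refine aux (fun e => if e = x' ∨ e = y' then w else J e) ?_
        intro f hf kf
        have hfz : f ≠ z := by
          rintro rfl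
          rcases hf.2 with h | h
          · exact hlm (h.1.symm.trans srcz)
          · exact pos_not_neg p0 h.2
        by_cases hfw : f = w
        · rw [hfw, Kw] at kf
          by_cases h1 : c x' = 0
          · refine ⟨y', ⟨sl', .inl ⟨sy', ty' ▸ p2⟩⟩, ?_, by simp [hfw]⟩
            intro h2; rw [h1, h2] at em; simp at em; exact kf em
          · exact ⟨x', ⟨sl', .inl ⟨sx', tx' ▸ p1⟩⟩, h1, by simp [hfw]⟩
        obtain ⟨e, h1, h2, rfl⟩ := Jsurj f hfz
        have h3 : e ≠ W := fun h => hfw (h ▸ JW)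
        exact ⟨e, old e h1 h2 h3 hf, hKJ e h1 h2 ▸ kf, by simp [h1, h2]⟩
      · refine aux (fun e => if e = X ∨ e = Y then z else J e) ?_
        intro f hf kf
        have hfw : f ≠ w := by
          rintro rfl
          rcases hf.2 with h | h
          · rw [typw] at h; exact pos_not_neg h.2 p0
          · exact no_loop hC srcw h.1 (not_dead_sort (by simp [sl]))
        by_cases hfz : f = z
        · rw [hfz, Kz] at kf
          by_cases h1 : c X = 0
          · refine ⟨Y, ⟨sl', .inr ⟨hy.2.2.1, hy.1 ▸ p2⟩⟩, ?_, by simp [hfz]⟩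
            intro h2; rw [h1, h2] at kf; simp at kf
          · exact ⟨X, ⟨sl', .inr ⟨hx.2.2.1, hx.1 ▸ p1⟩⟩, h1, by simp [hfz]⟩
        obtain ⟨e, h1, h2, rfl⟩ := Jsurj f hfz
        have h3 : e ≠ W := fun h => hfw (h ▸ JW)
        have k3 : e ≠ X := by
          rintro rfl; rw [JX] at hf
          rcases hf.2 with h | h
          · exact pos_not_neg h.2 p1
          · rw [tgx] at h; exact hlm (Option.some.inj h.1).symm
        have k4 : e ≠ Y := by
          rintro rfl; rw [JY] at hf
          rcases hf.2 with h | h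
          · exact pos_not_neg h.2 p2
          · rw [tgy] at h; exact hlm (Option.some.inj h.1).symm
        exact ⟨e, old e h1 h2 h3 hf, hKJ e h1 h2 ▸ kf, by simp [k3, k4]⟩
  · intro g hM
    refine ⟨fun e => g (lo e), ?_, ?_⟩
    · intro n
      by_cases hnl : n = l'
      · rw [hnl]
        have old : ∀ e f, Q.tgt e = some l' → Q.src f = l' → Q.cIdx f = Q.pIdx e →
            lo e = lo f ∨ (lo e = J e ∧ lo f = J f ∧ Q.typ e = R.typ (J e) ∧ Q.typ f = R.typ (J f) ∧
              R.tgt (J e) = some l ∧ R.src (J f) = l ∧ R.cIdx (J f) = R.pIdx (J e)) := by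
          intro e f he hf hp
          have hX4 := hx.2.2.2.1
          have hY4 := hy.2.2.2.1
          rcases (tgl e).1 he with h | h | ⟨h1, h2, h3, h4, h5⟩ <;>
          rcases (srl f).1 hf with h' | h' | ⟨h1', h2', h3', h5'⟩
          · left; rw [h, h', lox', hlo X X1 X2, JX]
          · rw [h, h', cy', hX4] at hp; exact absurd hp.symm hi
          · rw [h, hX4, hCi f h1' h2'] at hp; exact absurd hp (hic _ h5').1
          · rw [h, h', cx', hY4] at hp; exact absurd hp hi
          · left; rw [h, h', loy', hlo Y Y1 Y2, JY]
          · rw [h, hY4, hCi f h1' h2'] at hp; exact absurd hp (hic _ h5').2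
          · rw [h', cx', (hTgt e h1 h2 h3 h4).2] at hp; exact absurd hp.symm (hip _ h5).1
          · rw [h', cy', (hTgt e h1 h2 h3 h4).2] at hp; exact absurd hp.symm (hip _ h5).2
          · rw [(hTgt e h1 h2 h3 h4).2, hCi f h1' h2'] at hp
            exact .inr ⟨hlo e h1 h2, hlo f h1' h2', hTyp e h1 h2, hTyp f h1' h2', h5, h5', hp⟩
        constructor <;> intro hs
        · rw [sl'] at hs; cases hs
        · rw [sl'] at hs; cases hs
        · rw [sl'] at hs; cases hs
        · rw [sl'] at hs; cases hs
        · intro e f he hf hp pe pf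
          rcases old e f he hf hp with h | ⟨h1, h2, t1, t2, h3, h4, h5⟩
          · simp [h]
          · simp only [h1, h2]
            exact (hM l).sp sl _ _ h3 h4 h5 (t1 ▸ pe) (t2 ▸ pf)
        · intro e f he hf hp pe pf
          rcases old e f he hf hp with h | ⟨h1, h2, t1, t2, h3, h4, h5⟩
          · simp [h]
          · simp only [h1, h2]
            exact (hM l).sn sl _ _ h3 h4 h5 (t1 ▸ pe) (t2 ▸ pf)
      · obtain ⟨mm, hm⟩ := Option.ne_none_iff_exists'.1 (tN n)
        refine (hloc n mm hm fun h => hnl (iN.1 _ _ _ (h ▸ hm) jl)).model g _ ?_ ?_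
          (fun _ _ _ => le_rfl) (fun _ _ _ => le_rfl) (fun _ _ _ => le_rfl) (hM mm)
        · intro e he pe
          have h1 : e ≠ x' := by rintro rfl; exact hnl (he.symm.trans sx')
          have h2 : e ≠ y' := by rintro rfl; exact hnl (he.symm.trans sy')
          simp only [hlo e h1 h2]
          by_cases h3 : e = W
          · rw [h3, hw.1] at pe
            rw [h3, upW, JW]
            exact (hM l).sp sl z w tgtz srcw cw (typw ▸ pe) pe
          · rw [hup e h3]
        · intro e he pe
          have h1 : e ≠ x' := by rintro rfl; exact hnl (he.symm.trans sx')
          have h2 : e ≠ y' := by rintro rfl; exact hnl (he.symm.trans sy')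
          simp only [hlo e h1 h2]
          by_cases h3 : e = W
          · rw [h3, hw.1] at pe
            rw [h3, upW, JW]
            exact (hM l).sn sl z w tgtz srcw cw (typw ▸ pe) pe
          · rw [hup e h3]
    · have hs1 : ∀ e, e ≠ x' → e ≠ y' → e ≠ W → Q.sort (Q.src e) = .sync → R.sort (R.src (J e)) = .sync :=
        fun e h1 h2 h3 h => by rw [← hSort _ _ (hSrc e h1 h2 h3)]; exact h
      have hs2 : ∀ e, e ≠ x' → e ≠ y' → e ≠ X → e ≠ Y → ∀ t, Q.tgt e = some t → Q.sort t = .sync →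
          ∃ t, R.tgt (J e) = some t ∧ R.sort t = .sync := by
        intro e h1 h2 h3 h4 t ht hs
        obtain ⟨mm, hm⟩ := Option.ne_none_iff_exists'.1 (tN t)
        exact ⟨mm, (jNtgt e t mm h1 h2 h3 h4 hm).1 ht, by rw [← hSort _ _ hm]; exact hs⟩
      rcases hpol with ⟨s, p0, p1, p2⟩ | ⟨s, p0, p1, p2⟩
      · refine wt_lt J {x', y', W} w ?_ ?_ ?_ ?_
        · intro e e' he he'
          simp only [Finset.mem_insert, Finset.mem_singleton, not_or] at he he'
          exact Jinj e e' he.1 he.2.1 he'.1 he'.2.1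
        · intro e he
          simp only [Finset.mem_insert, Finset.mem_singleton, not_or] at he
          exact fun h => he.2.2 (JWi e he.1 he.2.1 h)
        · intro e he
          simp only [Finset.mem_insert, Finset.mem_singleton, not_or] at he
          obtain ⟨h1, h2, h3⟩ := he
          refine phi_le (hTyp e h1 h2) (by simp only [hlo e h1 h2]) (fun _ => hs1 e h1 h2 h3) ?_
          intro ne
          refine hs2 e h1 h2 ?_ ?_
          · rintro rfl; rw [hx.1] at ne; exact pos_not_neg p1 ne
          · rintro rfl; rw [hy.1] at ne; exact pos_not_neg p2 ne
        · have q1 := phi_le_self Q (fun e => g (lo e)) x'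
          have q2 := phi_le_self Q (fun e => g (lo e)) y'
          simp only [lox', loy', tx', ty'] at q1 q2
          have q3 : phi Q (fun e => g (lo e)) W = 0 :=
            phi_pos_zero (by rw [hw.1, typw]; exact p0) (by rw [hw.2.1, sm', s]; simp)
          have q4 : phi R g w = (g w + 1) * (fsz (R.typ x) + fsz (R.typ y) + 1) := by
            rw [← hfsz, ← typw]; exact phi_pos_src (by rw [typw]; exact p0) (by rw [srcw, sl])
          have q5 := (hM l).sp sl z w tgtz srcw cw p0 (typw ▸ p0)
          have q6 := (hM m).tens s z x srcz tgx p0 p1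
          have q7 := (hM m).tens s z y srcz tgy p0 p2
          rw [Finset.sum_insert (by simp [hx'y', W1.symm]), Finset.sum_insert (by simp [W2.symm]),
            Finset.sum_singleton, q3, add_zero]
          exact mult_aux q1 q2 (q6.trans q5) (q7.trans q5) q4
      · refine wt_lt J {x', y', X, Y} z ?_ ?_ ?_ ?_
        · intro e e' he he'
          simp only [Finset.mem_insert, Finset.mem_singleton, not_or] at he he'
          exact Jinj e e' he.1 he.2.1 he'.1 he'.2.1
        · intro e he
          simp only [Finset.mem_insert, Finset.mem_singleton, not_or] at he
          exact Jne e he.1 he.2.1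
        · intro e he
          simp only [Finset.mem_insert, Finset.mem_singleton, not_or] at he
          obtain ⟨h1, h2, h3, h4⟩ := he
          refine phi_le (hTyp e h1 h2) (by simp only [hlo e h1 h2]) ?_ (fun _ => hs2 e h1 h2 h3 h4)
          intro ne
          refine hs1 e h1 h2 ?_
          rintro rfl; rw [hw.1, typw] at ne; exact pos_not_neg ne p0
        · have q1 := phi_le_self Q (fun e => g (lo e)) X
          have q2 := phi_le_self Q (fun e => g (lo e)) Y
          simp only [hlo X X1 X2, hlo Y Y1 Y2, JX, JY, hx.1, hy.1] at q1 q2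
          have q3 : phi Q (fun e => g (lo e)) x' = 0 :=
            phi_neg_zero (by rw [tx']; exact p1) gx' (by rw [sm', s]; simp)
          have q3' : phi Q (fun e => g (lo e)) y' = 0 :=
            phi_neg_zero (by rw [ty']; exact p2) gy' (by rw [sm', s]; simp)
          have q4 : phi R g z = (g z + 1) * (fsz (R.typ x) + fsz (R.typ y) + 1) := by
            rw [← hfsz]; exact phi_neg_tgt p0 tgtz sl
          have q6 := (hM m).parr s x tgx p1
          have q7 := (hM m).parr s y tgy p2
          rw [Finset.sum_insert (by simp [hx'y', X1.symm, Y1.symm]),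
            Finset.sum_insert (by simp [X2.symm, Y2.symm]), Finset.sum_pair hXY, q3, q3', zero_add, zero_add]
          exact mult_aux q1 q2 (by omega) (by omega) q4

theorem pos_dual {A : Formula} (h : A.Positive) : A.dual.Negative := by
  induction h with
  | one => exact .bot
  | tens _ _ h1 h2 => exact .parr h1 h2

theorem neg_dual {A : Formula} (h : A.Negative) : A.dual.Positive := by
  induction h with
  | bot => exact .one
  | parr _ _ h1 h2 => exact .tens h1 h2

structure Swap (R Q : Struct) (jN : Q.Node → Option R.Node) (up lo : Q.Edge → R.Edge)
    (l : R.Node) (l' : Q.Node) (p0 c0 : R.Edge) (p1 c1 : Q.Edge) (j : ℕ) : Prop where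
  sl : R.sort l = .sync
  tp0 : R.tgt p0 = some l
  sc0 : R.src c0 = l
  ic : R.cIdx c0 = R.pIdx p0
  jp : ∀ e, R.tgt e = some l → R.pIdx e ≠ j
  jc : ∀ e, R.src e = l → R.cIdx e ≠ j
  tN : ∀ n, jN n ≠ none
  iN : ∀ a a' b, jN a = some b → jN a' = some b → a = a'
  jl : jN l' = some l
  sort : ∀ n m, jN n = some m → Q.sort n = R.sort m
  us : ∀ e, e ≠ c1 → jN (Q.src e) = some (R.src (up e)) ∧ Q.typ e = R.typ (up e) ∧
    Q.cIdx e = R.cIdx (up e)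
  ls : ∀ e, e ≠ p1 → (Q.tgt e).bind jN = R.tgt (lo e) ∧ Q.typ e = R.typ (lo e) ∧
    Q.pIdx e = R.pIdx (lo e)
  un : ∀ e, e ≠ c1 → up e ≠ c0
  ui : ∀ e e', e ≠ c1 → e' ≠ c1 → up e = up e' → e = e'
  uS : ∀ f, f ≠ c0 → ∃ e, e ≠ c1 ∧ up e = f
  ln : ∀ e, e ≠ p1 → lo e ≠ p0
  li : ∀ e e', e ≠ p1 → e' ≠ p1 → lo e = lo e' → e = e'
  lS : ∀ f, f ≠ p0 → ∃ e, e ≠ p1 ∧ lo e = f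
  sc1 : Q.src c1 = l'
  cc1 : Q.cIdx c1 = j
  tp1 : Q.tgt p1 = some l'
  cp1 : Q.pIdx p1 = j
  ty : Q.typ c1 = Q.typ p1
  pol : (Q.typ p1).Polarized

namespace Swap

variable {R Q : Struct} {jN : Q.Node → Option R.Node} {up lo : Q.Edge → R.Edge}
    {l : R.Node} {l' : Q.Node} {p0 c0 : R.Edge} {p1 c1 : Q.Edge} {j : ℕ}

theorem jtgt (h : Swap R Q jN up lo l l' p0 c0 p1 c1 j) {e : Q.Edge} {n : Q.Node} {m : R.Node}
    (he : e ≠ p1) (hn : jN n = some m) : Q.tgt e = some n ↔ R.tgt (lo e) = some m := by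
  rw [← (h.ls e he).1]
  constructor
  · intro h; rw [h]; exact hn
  · intro h'
    obtain ⟨k, hk, hk'⟩ := Option.bind_eq_some_iff.1 h'
    rw [hk, h.iN _ _ _ hk' hn]

theorem jsrc (h : Swap R Q jN up lo l l' p0 c0 p1 c1 j) {e : Q.Edge} {n : Q.Node} {m : R.Node}
    (he : e ≠ c1) (hn : jN n = some m) : Q.src e = n ↔ R.src (up e) = m := by
  have := (h.us e he).1
  constructor
  · intro h; rw [h, hn] at this; exact (Option.some.inj this).symm
  · intro h'; rw [h'] at this; exact h.iN _ _ _ this hn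

theorem sl1 (h : Swap R Q jN up lo l l' p0 c0 p1 c1 j) : Q.sort l' = .sync := (h.sort _ _ h.jl).trans h.sl

theorem loc (h : Swap R Q jN up lo l l' p0 c0 p1 c1 j) {n : Q.Node} {m : R.Node}
    (hn : jN n = some m) (hm : m ≠ l) : Loc Q R up lo n m := by
  have hnl : n ≠ l' := by rintro rfl; rw [h.jl] at hn; exact hm (Option.some.inj hn).symm
  have n1 : ∀ e, Q.src e = n → e ≠ c1 := by
    rintro e he rfl; exact hnl (he.symm.trans h.sc1)
  have n2 : ∀ e, Q.tgt e = some n → e ≠ p1 := by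
    rintro e he rfl; rw [h.tp1] at he; exact hnl (Option.some.inj he).symm
  refine Loc.build h.iN hn (h.sort _ _ hn) ?_ ?_ ?_ ?_ ?_ ?_ ?_
  · exact fun e he => ⟨(h.us e (n1 e he)).1, (h.us e (n1 e he)).2.1⟩
  · exact fun _ e he => (h.us e (n1 e he)).2.2
  · exact fun e e' he he' => h.ui e e' (n1 e he) (n1 e' he')
  · intro f hf
    obtain ⟨e, he, rfl⟩ := h.uS f (by rintro rfl; exact hm (hf.symm.trans h.sc0))
    exact ⟨e, (h.us e he).1, rfl⟩
  · exact fun e he => h.ls e (n2 e he)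
  · exact fun e e' he he' => h.li e e' (n2 e he) (n2 e' he')
  · intro f hf
    obtain ⟨e, he, rfl⟩ := h.lS f (by rintro rfl; rw [h.tp0] at hf; exact hm (Option.some.inj hf).symm)
    exact ⟨e, (h.ls e he).1, rfl⟩

theorem good (h : Swap R Q jN up lo l l' p0 c0 p1 c1 j) (hG : ∀ n, GoodAt R n) (n : Q.Node) :
    GoodAt Q n := by
  by_cases hnl : n = l'
  swap
  · obtain ⟨mm, hm⟩ := Option.ne_none_iff_exists'.1 (h.tN n)
    exact (h.loc hm fun h' => hnl (h.iN _ _ _ (h' ▸ hm) h.jl)).good (hG mm)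
  rw [hnl]
  obtain ⟨g1, g2, g3, g4, g5, g6⟩ := (hG l).sync h.sl
  have gs : (∀ e, Q.tgt e = some l' → (Q.typ e).Polarized) ∧
    (∀ e, Q.tgt e = some l' → ∃ f, Q.src f = l' ∧ Q.cIdx f = Q.pIdx e) ∧
    (∀ f, Q.src f = l' → ∃ e, Q.tgt e = some l' ∧ Q.pIdx e = Q.cIdx f) ∧
    (∀ e e', Q.tgt e = some l' → Q.tgt e' = some l' → Q.pIdx e = Q.pIdx e' → e = e') ∧
    (∀ f f', Q.src f = l' → Q.src f' = l' → Q.cIdx f = Q.cIdx f' → f = f') ∧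
    (∀ e f, Q.tgt e = some l' → Q.src f = l' → Q.cIdx f = Q.pIdx e → Q.typ f = Q.typ e) := by
    refine ⟨?_, ?_, ?_, ?_, ?_, ?_⟩
    · intro e he
      by_cases h1 : e = p1
      · rw [h1]; exact h.pol
      · rw [(h.ls e h1).2.1]; exact g1 _ ((h.jtgt h1 h.jl).1 he)
    · intro e he
      by_cases h1 : e = p1
      · rw [h1]; exact ⟨c1, h.sc1, h.cc1.trans h.cp1.symm⟩
      · have h5 := (h.jtgt h1 h.jl).1 he
        obtain ⟨f, hf, hc⟩ := g2 _ h5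
        obtain ⟨f, k1, rfl⟩ := h.uS f (by
          rintro rfl
          rw [h.ic] at hc
          exact h.ln e h1 (g4 _ _ h.tp0 h5 hc).symm)
        exact ⟨f, (h.jsrc k1 h.jl).2 hf, by rw [(h.us f k1).2.2, hc, (h.ls e h1).2.2]⟩
    · intro f hf
      by_cases h1 : f = c1
      · rw [h1]; exact ⟨p1, h.tp1, h.cp1.trans h.cc1.symm⟩
      · have h5 := (h.jsrc h1 h.jl).1 hf
        obtain ⟨e, he, hc⟩ := g3 _ h5
        obtain ⟨e, k1, rfl⟩ := h.lS e (by
          rintro rfl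
          rw [← h.ic] at hc
          exact h.un f h1 (g5 _ _ h5 h.sc0 hc.symm))
        exact ⟨e, (h.jtgt k1 h.jl).2 he, by rw [(h.us f h1).2.2, (h.ls e k1).2.2, hc]⟩
    · intro e e' he he' hp
      by_cases h1 : e = p1 <;> by_cases h2 : e' = p1
      · rw [h1, h2]
      · rw [h1, h.cp1, (h.ls e' h2).2.2] at hp
        exact absurd hp.symm (h.jp _ ((h.jtgt h2 h.jl).1 he'))
      · rw [h2, h.cp1, (h.ls e h1).2.2] at hp
        exact absurd hp (h.jp _ ((h.jtgt h1 h.jl).1 he))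
      · rw [(h.ls e h1).2.2, (h.ls e' h2).2.2] at hp
        exact h.li _ _ h1 h2 (g4 _ _ ((h.jtgt h1 h.jl).1 he) ((h.jtgt h2 h.jl).1 he') hp)
    · intro e e' he he' hp
      by_cases h1 : e = c1 <;> by_cases h2 : e' = c1
      · rw [h1, h2]
      · rw [h1, h.cc1, (h.us e' h2).2.2] at hp
        exact absurd hp.symm (h.jc _ ((h.jsrc h2 h.jl).1 he'))
      · rw [h2, h.cc1, (h.us e h1).2.2] at hp
        exact absurd hp (h.jc _ ((h.jsrc h1 h.jl).1 he))
      · rw [(h.us e h1).2.2, (h.us e' h2).2.2] at hp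
        exact h.ui _ _ h1 h2 (g5 _ _ ((h.jsrc h1 h.jl).1 he) ((h.jsrc h2 h.jl).1 he') hp)
    · intro e f he hf hp
      by_cases h1 : e = p1 <;> by_cases h2 : f = c1
      · rw [h1, h2, h.ty]
      · rw [h1, h.cp1, (h.us f h2).2.2] at hp
        exact absurd hp (h.jc _ ((h.jsrc h2 h.jl).1 hf))
      · rw [h2, h.cc1, (h.ls e h1).2.2] at hp
        exact absurd hp.symm (h.jp _ ((h.jtgt h1 h.jl).1 he))
      · rw [(h.ls e h1).2.2, (h.us f h2).2.2] at hp
        rw [(h.ls e h1).2.1, (h.us f h2).2.1]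
        exact g6 _ _ ((h.jtgt h1 h.jl).1 he) ((h.jsrc h2 h.jl).1 hf) hp
  have sl' := h.sl1
  constructor <;> intro hs
  all_goals first | exact gs | (rw [sl'] at hs; cases hs)

theorem syn (h : Swap R Q jN up lo l l' p0 c0 p1 c1 j) (hG : ∀ n, GoodAt R n)
    {c : Q.Edge → ZMod 2} {K : R.Edge → ZMod 2} (hO : OKat Q c l')
    (k1 : ∀ e, Q.src e = l' → e ≠ c1 → K (up e) = c e)
    (k2 : ∀ e, Q.tgt e = some l' → e ≠ p1 → K (lo e) = c e)
    (hsp : ((R.typ c0).Positive ∧ (Q.typ p1).Negative ∧ K c0 = c p1) ∨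
      ((R.typ c0).Negative ∧ (Q.typ c1).Positive ∧ K p0 = c c1)) :
    ∀ e f, R.OutEdgeOf l e → R.OutEdgeOf l f → K e ≠ 0 → K f ≠ 0 → e = f := by
  have ht : R.typ c0 = R.typ p0 := ((hG l).sync h.sl).2.2.2.2.2 _ _ h.tp0 h.sc0 h.ic
  have key : ∃ Rel : R.Edge → Q.Edge → Prop,
      (∀ f, R.OutEdgeOf l f → K f ≠ 0 → ∃ e, Q.OutEdgeOf l' e ∧ c e ≠ 0 ∧ Rel f e) ∧
      (∀ f f' e, Rel f e → Rel f' e → f = f') := by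
    have sl' := h.sl1
    rcases hsp with ⟨s1, s2, s3⟩ | ⟨s1, s2, s3⟩
    · refine ⟨fun f e => ((Q.typ e).Positive ∧ e ≠ c1 ∧ up e = f) ∨ ((Q.typ e).Negative ∧
        ((e = p1 ∧ f = c0) ∨ (e ≠ p1 ∧ lo e = f))), ?_, ?_⟩
      · rintro f ⟨_, ⟨hf, pf⟩ | ⟨hf, pf⟩⟩ kf
        · by_cases hc : f = c0
          · subst hc
            exact ⟨p1, ⟨sl', .inr ⟨h.tp1, s2⟩⟩, s3 ▸ kf, .inr ⟨s2, .inl ⟨rfl, rfl⟩⟩⟩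
          · obtain ⟨e, he, rfl⟩ := h.uS f hc
            rw [← (h.us e he).2.1] at pf
            have := (h.jsrc he h.jl).2 hf
            exact ⟨e, ⟨sl', .inl ⟨this, pf⟩⟩, k1 e this he ▸ kf, .inl ⟨pf, he, rfl⟩⟩
        · have hc : f ≠ p0 := by rintro rfl; rw [← ht] at pf; exact pos_not_neg s1 pf
          obtain ⟨e, he, rfl⟩ := h.lS f hc
          rw [← (h.ls e he).2.1] at pf
          have := (h.jtgt he h.jl).2 hf
          exact ⟨e, ⟨sl', .inr ⟨this, pf⟩⟩, k2 e this he ▸ kf, .inr ⟨pf, .inr ⟨he, rfl⟩⟩⟩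
      · rintro f f' e (⟨p, h1, h2⟩ | ⟨p, h1⟩) (⟨p', h1', h2'⟩ | ⟨p', h1'⟩)
        · rw [← h2, ← h2']
        · exact absurd p' (pos_not_neg p)
        · exact absurd p (pos_not_neg p')
        · rcases h1 with ⟨h1, h2⟩ | ⟨h1, h2⟩ <;> rcases h1' with ⟨h1', h2'⟩ | ⟨h1', h2'⟩
          · rw [h2, h2']
          · exact absurd h1 h1'
          · exact absurd h1' h1
          · rw [← h2, ← h2']
    · refine ⟨fun f e => ((Q.typ e).Negative ∧ e ≠ p1 ∧ lo e = f) ∨ ((Q.typ e).Positive ∧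
        ((e = c1 ∧ f = p0) ∨ (e ≠ c1 ∧ up e = f))), ?_, ?_⟩
      · rintro f ⟨_, ⟨hf, pf⟩ | ⟨hf, pf⟩⟩ kf
        · have hc : f ≠ c0 := by rintro rfl; exact pos_not_neg pf s1
          obtain ⟨e, he, rfl⟩ := h.uS f hc
          rw [← (h.us e he).2.1] at pf
          have := (h.jsrc he h.jl).2 hf
          exact ⟨e, ⟨sl', .inl ⟨this, pf⟩⟩, k1 e this he ▸ kf, .inr ⟨pf, .inr ⟨he, rfl⟩⟩⟩
        · by_cases hc : f = p0
          · subst hc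
            exact ⟨c1, ⟨sl', .inl ⟨h.sc1, s2⟩⟩, s3 ▸ kf, .inr ⟨s2, .inl ⟨rfl, rfl⟩⟩⟩
          · obtain ⟨e, he, rfl⟩ := h.lS f hc
            rw [← (h.ls e he).2.1] at pf
            have := (h.jtgt he h.jl).2 hf
            exact ⟨e, ⟨sl', .inr ⟨this, pf⟩⟩, k2 e this he ▸ kf, .inl ⟨pf, he, rfl⟩⟩
      · rintro f f' e (⟨p, h1, h2⟩ | ⟨p, h1⟩) (⟨p', h1', h2'⟩ | ⟨p', h1'⟩)
        · rw [← h2, ← h2']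
        · exact absurd p (pos_not_neg p')
        · exact absurd p' (pos_not_neg p)
        · rcases h1 with ⟨h1, h2⟩ | ⟨h1, h2⟩ <;> rcases h1' with ⟨h1', h2'⟩ | ⟨h1', h2'⟩
          · rw [h2, h2']
          · exact absurd h1 h1'
          · exact absurd h1' h1
          · rw [← h2, ← h2']
  obtain ⟨Rel, r1, r2⟩ := key
  intro e f he hf ke kf
  obtain ⟨a, a1, a2, a3⟩ := r1 e he ke
  obtain ⟨b, b1, b2, b3⟩ := r1 f hf kf
  obtain rfl := hO.syn h.sl1 a b a1 b1 a2 b2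
  exact r2 _ _ _ a3 b3

theorem model (h : Swap R Q jN up lo l l' p0 c0 p1 c1 j)
    {g : R.Edge → ℕ} {k : Q.Edge → ℕ} (hM : ModelAt R g l)
    (k1 : ∀ e, Q.src e = l' → e ≠ c1 → k e = g (up e))
    (k2 : ∀ e, Q.tgt e = some l' → e ≠ p1 → k e = g (lo e))
    (k3 : k p1 = k c1) : ModelAt Q k l' := by
  have old : ∀ e f, Q.tgt e = some l' → Q.src f = l' → Q.cIdx f = Q.pIdx e →
      k e = k f ∨ (k e = g (lo e) ∧ k f = g (up f) ∧ Q.typ e = R.typ (lo e) ∧ Q.typ f = R.typ (up f) ∧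
        R.tgt (lo e) = some l ∧ R.src (up f) = l ∧ R.cIdx (up f) = R.pIdx (lo e)) := by
    intro e f he hf hp
    by_cases h1 : e = p1 <;> by_cases h2 : f = c1
    · left; rw [h1, h2, k3]
    · rw [h1, h.cp1, (h.us f h2).2.2] at hp
      exact absurd hp (h.jc _ ((h.jsrc h2 h.jl).1 hf))
    · rw [h2, h.cc1, (h.ls e h1).2.2] at hp
      exact absurd hp.symm (h.jp _ ((h.jtgt h1 h.jl).1 he))
    · rw [(h.ls e h1).2.2, (h.us f h2).2.2] at hp
      exact .inr ⟨k2 e he h1, k1 f hf h2, (h.ls e h1).2.1, (h.us f h2).2.1,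
        (h.jtgt h1 h.jl).1 he, (h.jsrc h2 h.jl).1 hf, hp⟩
  have sl' := h.sl1
  constructor <;> intro hs
  · rw [sl'] at hs; cases hs
  · rw [sl'] at hs; cases hs
  · rw [sl'] at hs; cases hs
  · rw [sl'] at hs; cases hs
  · intro e f he hf hp pe pf
    rcases old e f he hf hp with h' | ⟨h1, h2, t1, t2, h3, h4, h5⟩
    · rw [h']
    · rw [h1, h2]
      exact hM.sp h.sl _ _ h3 h4 h5 (t1 ▸ pe) (t2 ▸ pf)
  · intro e f he hf hp pe pf
    rcases old e f he hf hp with h' | ⟨h1, h2, t1, t2, h3, h4, h5⟩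
    · rw [h']
    · rw [h1, h2]
      exact hM.sn h.sl _ _ h3 h4 h5 (t1 ▸ pe) (t2 ▸ pf)

end Swap

theorem one_aux {m1 m3 a gx gw : ℕ} (h1 : m1 ≤ (gx + 1) * a) (hx : gx < gw) (ha : 0 < a)
    (h3 : m3 = (gw + 1) * a) : m1 < m3 := by
  have := Nat.mul_lt_mul_of_pos_right (Nat.succ_lt_succ hx) ha
  simp only [Nat.succ_eq_add_one] at *
  omega

theorem comm_ax {R Q : Struct} (hI : SInv R) (h : SyncAxStep R Q) :
    SInv Q ∧ ∀ g, Model R g → ∃ k, Model Q k ∧ wt Q k < wt R g := by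
  obtain ⟨l, a, u, u', v, j, sl, sa, -, -, pu, huv, ca, tgu, su', cu', hu'u, hu'v, jp, jc,
    jN, jE, l', a', v', tN, iN, iE, jl, ja, jv', jnone, hA, hU, hV, ⟨tv', sv', cv', gv', ppv'⟩⟩ := h
  obtain ⟨hG, hC⟩ := hI
  have ca' := fun e => concls_iff ca e
  simp only [Finset.mem_insert, Finset.mem_singleton] at ca'
  have hla : l ≠ a := by rintro rfl; rw [sl] at sa; simp at sa
  have hla' : l' ≠ a' := by rintro rfl; rw [jl] at ja; exact hla (Option.some.inj ja)
  have sru : R.src u = a := (ca' u).2 (.inl rfl)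
  have srv : R.src v = a := (ca' v).2 (.inr rfl)
  have tyv : R.typ v = (R.typ u).dual := ((hG a).ax sa).2 u v sru srv huv
  have tyu' : R.typ u' = R.typ u := ((hG l).sync sl).2.2.2.2.2 _ _ tgu su' cu'
  have nv : (R.typ v).Negative := tyv ▸ pos_dual pu
  let J : Q.Edge → R.Edge := fun e => (jE e).getD u
  have hJ : ∀ e, e ≠ v' → jE e = some (J e) := by
    intro e h1
    obtain ⟨b, hb⟩ := Option.ne_none_iff_exists'.1 (fun h => h1 (jnone e h))
    simp [J, hb]
  have Jne : ∀ e, e ≠ v' → J e ≠ u := fun e h1 => iE.2.1 _ _ (hJ e h1)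
  have Jinj : ∀ e e', e ≠ v' → e' ≠ v' → J e = J e' → e = e' :=
    fun e e' h1 h3 h => iE.1 _ _ _ (hJ e h1) (h ▸ hJ e' h3)
  have Jsurj : ∀ y, y ≠ u → ∃ e, e ≠ v' ∧ J e = y := by
    intro y hy
    obtain ⟨e, he⟩ := iE.2.2 y hy
    refine ⟨e, ?_, by simp [J, he]⟩
    rintro rfl; rw [jv'] at he; cases he
  clear_value J
  obtain ⟨U, U1, JU⟩ := Jsurj u' hu'u
  obtain ⟨V, V1, JV⟩ := Jsurj v huv.symm
  obtain ⟨U2, U3, U4, U5, U6⟩ := hU U (JU ▸ hJ U U1)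
  obtain ⟨V2, V3, V4, V5, V6⟩ := hV V (JV ▸ hJ V V1)
  have hUV : U ≠ V := by rintro rfl; exact hu'v (JU.symm.trans JV)
  have JUi : ∀ e, e ≠ v' → J e = u' → e = U := fun e h1 h => Jinj _ _ h1 U1 (h.trans JU.symm)
  have JVi : ∀ e, e ≠ v' → J e = v → e = V := fun e h1 h => Jinj _ _ h1 V1 (h.trans JV.symm)
  have hA1 : ∀ e, e ≠ v' → e ≠ U → e ≠ V → Q.typ e = R.typ (J e) ∧
      jN (Q.src e) = some (R.src (J e)) ∧ (Q.tgt e).bind jN = R.tgt (J e) ∧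
      Q.pIdx e = R.pIdx (J e) ∧ Q.cIdx e = R.cIdx (J e) := by
    intro e h1 h2 h3
    refine hA.1 e _ (hJ e h1) ?_
    simp only [Set.mem_insert_iff, Set.mem_singleton_iff, not_or]
    exact ⟨fun h => h2 (JUi e h1 h), fun h => h3 (JVi e h1 h)⟩
  have hSort : ∀ n mm, jN n = some mm → Q.sort n = R.sort mm := fun n mm hn => (hA.2 _ _ hn (by simp)).1
  let up : Q.Edge → R.Edge := fun e => if e = U then u else J e
  let lo : Q.Edge → R.Edge := fun e => if e = v' then v else J e
  have hlo : ∀ e, e ≠ v' → lo e = J e := fun e h1 => by simp [lo, h1]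
  have lov' : lo v' = v := by simp [lo]
  have hup : ∀ e, e ≠ U → up e = J e := fun e h1 => by simp [up, h1]
  have upU : up U = u := by simp [up]
  clear_value up lo
  have SW : Swap R Q jN up lo l l' u u' V v' j := by
    refine ⟨sl, tgu, su', cu', jp, jc, tN, iN.1, jl, hSort, ?_, ?_, ?_, ?_, ?_, ?_, ?_, ?_,
      sv', cv', V5, V6, tv'.trans V2.symm, .inr (V2 ▸ nv)⟩
    · intro e h1
      by_cases h2 : e = U
      · rw [h2, upU, U3, ja, sru, U2, tyu', U4]; simp
      rw [hup e h2]
      by_cases h3 : e = V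
      · rw [h3, JV, V3, ja, srv, V2, V4]; simp
      exact ⟨(hA1 e h1 h2 h3).2.1, (hA1 e h1 h2 h3).1, (hA1 e h1 h2 h3).2.2.2.2⟩
    · intro e h3
      by_cases h1 : e = v'
      · rw [h1, lov']; exact ⟨gv', tv', ppv'⟩
      rw [hlo e h1]
      by_cases h2 : e = U
      · rw [h2, JU]; exact ⟨U5, U2, U6⟩
      exact ⟨(hA1 e h1 h2 h3).2.2.1, (hA1 e h1 h2 h3).1, (hA1 e h1 h2 h3).2.2.2.1⟩
    · intro e h1
      by_cases h2 : e = U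
      · rw [h2, upU]; exact hu'u.symm
      rw [hup e h2]; exact fun h => h2 (JUi e h1 h)
    · intro e e' h1 h1' hee
      by_cases h2 : e = U <;> by_cases h2' : e' = U
      · rw [h2, h2']
      · rw [h2, upU, hup _ h2'] at hee; exact absurd hee.symm (Jne _ h1')
      · rw [h2', upU, hup _ h2] at hee; exact absurd hee (Jne _ h1)
      · rw [hup _ h2, hup _ h2'] at hee; exact Jinj _ _ h1 h1' hee
    · intro f hf
      by_cases h : f = u
      · exact ⟨U, U1, by rw [upU, h]⟩
      · obtain ⟨e, h1, rfl⟩ := Jsurj f h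
        exact ⟨e, h1, hup e (by rintro rfl; exact hf JU)⟩
    · intro e h3
      by_cases h1 : e = v'
      · rw [h1, lov']; exact huv.symm
      rw [hlo e h1]; exact Jne e h1
    · intro e e' h1 h1' hee
      by_cases h2 : e = v' <;> by_cases h2' : e' = v'
      · rw [h2, h2']
      · rw [h2, lov', hlo _ h2'] at hee; exact absurd (JVi _ h2' hee.symm) h1'
      · rw [h2', lov', hlo _ h2] at hee; exact absurd (JVi _ h2 hee) h1
      · rw [hlo _ h2, hlo _ h2'] at hee; exact Jinj _ _ h2 h2' hee
    · intro f hf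
      by_cases h : f = v
      · exact ⟨v', V1.symm, by rw [lov', h]⟩
      · obtain ⟨e, h1, rfl⟩ := Jsurj f hf
        exact ⟨e, by rintro rfl; exact h JV, hlo e h1⟩
  have typL : ∀ e, Q.typ e = R.typ (lo e) := by
    intro e
    by_cases h : e = V
    · rw [h, V2, hlo V V1, JV]
    · exact (SW.ls e h).2.1
  have hca' : Q.concls a' = {U, V} := by
    refine concls_of fun e => ?_
    simp only [Finset.mem_insert, Finset.mem_singleton]
    constructor
    · intro he
      have h1 : e ≠ v' := by rintro rfl; exact hla' (sv'.symm.trans he)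
      by_contra hh
      push Not at hh
      have := (ca' _).1 ((SW.jsrc h1 ja).1 he)
      rw [hup e hh.1] at this
      exact this.elim (Jne e h1) (fun h => hh.2 (JVi e h1 h))
    · rintro (rfl | rfl) <;> assumption
  have hpa' : Q.prems a' = ∅ := by
    refine prems_of fun e => ?_
    simp only [Finset.notMem_empty, iff_false]
    intro he
    have h1 : e ≠ V := by rintro rfl; rw [V5] at he; exact hla' (Option.some.inj he)
    exact ((hG a).ax sa).1 _ ((SW.jtgt h1 ja).1 he)
  refine ⟨⟨SW.good hG, ?_⟩, ?_⟩
  · intro c hL hO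
    have em := (hO a').even
    rw [bd_eq, hca', hpa', Finset.sum_empty, Finset.sum_pair hUV, add_zero] at em
    have hUVc : c U = c V := by
      have := congrArg (· + c V) em
      simpa [add_assoc, z2_self] using this
    have : ∀ f, ∃ w : ZMod 2, (∀ e, e ≠ V → lo e = f → w = c e) ∧ (f = u → w = c v') := by
      intro f
      by_cases hf : f = u
      · exact ⟨_, fun e h1 h => absurd (h.trans hf) (SW.ln e h1), fun _ => rfl⟩
      · obtain ⟨e, h1, he⟩ := SW.lS f hf
        exact ⟨c e, fun e' h1' he' => by rw [SW.li e e' h1 h1' (he.trans he'.symm)],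
          fun h => absurd h hf⟩
    choose K hK1 hK2 using this
    have hKL : ∀ e, e ≠ V → K (lo e) = c e := fun e h1 => hK1 _ e h1 rfl
    have Ku : K u = c v' := hK2 u rfl
    have Kv : K v = c v' := by rw [← lov']; exact hKL v' V1.symm
    have Ku' : K u' = c U := by rw [← JU, ← hlo U U1]; exact hKL U hUV
    have hKU : ∀ e, e ≠ v' → Q.src e ≠ a' → K (up e) = c e := by
      intro e h1 h2
      have h3 : e ≠ U := by rintro rfl; exact h2 U3
      have h4 : e ≠ V := by rintro rfl; exact h2 V3
      rw [hup e h3, ← hlo e h1, hKL e h4]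
    have hLK : Live R K := by
      intro f hf
      by_cases hfu : f = u
      · exact ⟨l, hfu ▸ tgu, not_dead_sort (by simp [sl])⟩
      obtain ⟨e, h1, rfl⟩ := SW.lS f hfu
      rw [hKL e h1] at hf
      obtain ⟨t, ht, hd⟩ := hL e hf
      obtain ⟨mm, hm⟩ := Option.ne_none_iff_exists'.1 (tN t)
      refine ⟨mm, (SW.jtgt h1 hm).1 ht, ?_⟩
      by_cases hml : mm = l
      · rw [hml]; exact not_dead_sort (by simp [sl])
      · exact fun h => hd ((SW.loc hm hml).dead.2 h)
    have hOK : ∀ mm, mm ≠ l → OKat R K mm := by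
      intro mm hml
      by_cases hma : mm = a
      · rw [hma]
        refine ok_trivial ?_ (by simp [sa]) (by simp [sa])
        rw [bd_eq, ca, Finset.sum_pair huv, prems_of (s := ∅) (by intro e; simp; exact ((hG a).ax sa).1 e),
          Ku, Kv, Finset.sum_empty, add_zero, z2_self]
      · obtain ⟨n, hn⟩ := iN.2.2 mm trivial
        have hnl : n ≠ l' := by rintro rfl; rw [jl] at hn; exact hml (Option.some.inj hn).symm
        have hna : n ≠ a' := by rintro rfl; rw [ja] at hn; exact hma (Option.some.inj hn).symm
        refine (SW.loc hn hml).ok c _ ?_ ?_ (hO n)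
        · intro e he
          exact (hKU e (by rintro rfl; exact hnl (he.symm.trans sv')) (he ▸ hna)).symm
        · intro e he
          exact (hKL e (by rintro rfl; rw [V5] at he; exact hnl (Option.some.inj he).symm)).symm
    have key := hC K hLK ?_
    · have k0 : ∀ e, e ≠ V → c e = 0 := fun e h1 => by rw [← hKL e h1]; exact key _
      intro e
      by_cases h1 : e = V
      · rw [h1, ← hUVc]; exact k0 U hUV
      · exact k0 e h1
    · intro mm
      by_cases hml : mm = l
      swap
      · exact hOK mm hml
      rw [hml]
      refine ⟨bd_last hLK l fun n hn => (hOK n hn).even, fun h => (by rw [sl] at h; cases h), fun _ => ?_⟩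
      refine SW.syn hG (hO l') ?_ ?_ (.inl ⟨tyu' ▸ pu, V2 ▸ nv, Ku'.trans hUVc⟩)
      · intro e he h1; exact hKU e h1 (he ▸ hla')
      · intro e _ h1; exact hKL e h1
  · intro g hM
    have guu' : g u ≤ g u' := (hM l).sp sl u u' tgu su' cu' pu (tyu' ▸ pu)
    refine ⟨fun e => g (lo e), ?_, ?_⟩
    · intro n
      by_cases hnl : n = l'
      · rw [hnl]
        refine SW.model (hM l) ?_ (fun _ _ _ => rfl) ?_
        · intro e he h1
          have h3 : e ≠ U := by rintro rfl; exact hla' (he.symm.trans U3)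
          simp only [hlo e h1, hup e h3]
        · simp only [lov', hlo V V1, JV]
      · obtain ⟨mm, hm⟩ := Option.ne_none_iff_exists'.1 (tN n)
        refine (SW.loc hm fun h => hnl (iN.1 _ _ _ (h ▸ hm) jl)).model g _ ?_ ?_
          (fun _ _ _ => le_rfl) (fun _ _ _ => le_rfl) (fun _ _ _ => le_rfl) (hM mm)
        · intro e he pe
          have h1 : e ≠ v' := by rintro rfl; exact hnl (he.symm.trans sv')
          simp only [hlo e h1]
          by_cases h3 : e = U
          · rw [h3, upU, JU]; exact guu'
          · rw [hup e h3]
        · intro e he pe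
          have h1 : e ≠ v' := by rintro rfl; exact hnl (he.symm.trans sv')
          simp only [hlo e h1]
          by_cases h3 : e = U
          · rw [h3, U2, tyu'] at pe; exact absurd pe (pos_not_neg pu)
          · rw [hup e h3]
    · refine wt_lt lo {U, V} u' ?_ ?_ ?_ ?_
      · intro e e' he he'
        simp only [Finset.mem_insert, Finset.mem_singleton, not_or] at he he'
        exact SW.li e e' he.2 he'.2
      · intro e he h
        simp only [Finset.mem_insert, Finset.mem_singleton, not_or] at he
        by_cases h1 : e = v'
        · rw [h1, lov'] at h; exact hu'v h.symm
        · rw [hlo e h1] at h; exact he.1 (JUi e h1 h)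
      · intro e he
        simp only [Finset.mem_insert, Finset.mem_singleton, not_or] at he
        refine phi_le (typL e) rfl ?_ ?_
        · intro pe hs
          have h1 : e ≠ v' := by rintro rfl; rw [tv'] at pe; exact pos_not_neg pe nv
          have := (SW.us e h1).1
          rw [hup e he.1, ← hlo e h1] at this
          rw [← hSort _ _ this]; exact hs
        · intro _ t ht hs
          obtain ⟨mm, hm⟩ := Option.ne_none_iff_exists'.1 (tN t)
          exact ⟨mm, (SW.jtgt he.2 hm).1 ht, by rw [← hSort _ _ hm]; exact hs⟩
      · have q1 := phi_le_self Q (fun e => g (lo e)) V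
        simp only [hlo V V1, JV, V2, tyv, fsz_dual] at q1
        have q3 : phi Q (fun e => g (lo e)) U = 0 :=
          phi_pos_zero (by rw [U2, tyu']; exact pu) (by rw [U3, hSort _ _ ja, sa]; simp)
        have q4 : phi R g u' = (g u' + 1) * fsz (R.typ u) := by
          rw [← tyu']; exact phi_pos_src (by rw [tyu']; exact pu) (by rw [su', sl])
        have q5 := (hM a).ax sa u v sru srv pu nv
        rw [Finset.sum_pair hUV, q3, zero_add]
        exact one_aux q1 (lt_of_lt_of_le q5 guu') (fsz_pos _) q4

theorem comm_cut {R Q : Struct} (hI : SInv R) (h : SyncCutStep R Q) :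
    SInv Q ∧ ∀ g, Model R g → ∃ k, Model Q k ∧ wt Q k < wt R g := by
  obtain ⟨l, x, d, d', q, j, sl, sx, -, -, nd', sd', tgd', tgd, cd', hd'q, hdq, hdd', px, jp, jc,
    jN, jE, l', x', q', tN, iN, iE, jl, jx, jq', jnone, hA, hD, hV, ⟨tq', sq', cq', gq', ppq'⟩⟩ := h
  obtain ⟨hG, hC⟩ := hI
  have px' := fun e => prems_iff px e
  simp only [Finset.mem_insert, Finset.mem_singleton] at px'
  have hlx : l ≠ x := by rintro rfl; rw [sl] at sx; simp at sx
  have hlx' : l' ≠ x' := by rintro rfl; rw [jl] at jx; exact hlx (Option.some.inj jx)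
  have tgq : R.tgt q = some x := (px' q).2 (.inr rfl)
  have ndx : ¬ Dead R x := not_dead_pair px
  have tyq : R.typ q = (R.typ d').dual := ((hG x).cut sx).2 ndx d' q tgd' tgq hd'q
  have tyd : R.typ d' = R.typ d := ((hG l).sync sl).2.2.2.2.2 _ _ tgd sd' cd'.symm
  have pq : (R.typ q).Positive := tyq ▸ neg_dual nd'
  have nd : (R.typ d).Negative := tyd ▸ nd'
  let J : Q.Edge → R.Edge := fun e => (jE e).getD d'
  have hJ : ∀ e, e ≠ q' → jE e = some (J e) := by
    intro e h1
    obtain ⟨b, hb⟩ := Option.ne_none_iff_exists'.1 (fun h => h1 (jnone e h))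
    simp [J, hb]
  have Jq' : J q' = d' := by simp [J, jq']
  have Jne : ∀ e, e ≠ q' → J e ≠ d' := fun e h1 => iE.2.1 _ _ (hJ e h1)
  have Jinj : ∀ e e', e ≠ q' → e' ≠ q' → J e = J e' → e = e' :=
    fun e e' h1 h3 h => iE.1 _ _ _ (hJ e h1) (h ▸ hJ e' h3)
  have Jsurj : ∀ y, y ≠ d' → ∃ e, e ≠ q' ∧ J e = y := by
    intro y hy
    obtain ⟨e, he⟩ := iE.2.2 y hy
    refine ⟨e, ?_, by simp [J, he]⟩
    rintro rfl; rw [jq'] at he; cases he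
  clear_value J
  obtain ⟨D, D1, JD⟩ := Jsurj d hdd'
  obtain ⟨V, V1, JV⟩ := Jsurj q hd'q.symm
  obtain ⟨D2, D3, D4, D5, D6⟩ := hD D (JD ▸ hJ D D1)
  obtain ⟨V2, V3, V4, V5, V6⟩ := hV V (JV ▸ hJ V V1)
  have hDV : D ≠ V := by rintro rfl; exact hdq (JD.symm.trans JV)
  have JDi : ∀ e, e ≠ q' → J e = d → e = D := fun e h1 h => Jinj _ _ h1 D1 (h.trans JD.symm)
  have JVi : ∀ e, e ≠ q' → J e = q → e = V := fun e h1 h => Jinj _ _ h1 V1 (h.trans JV.symm)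
  have hA1 : ∀ e, e ≠ q' → e ≠ D → e ≠ V → Q.typ e = R.typ (J e) ∧
      jN (Q.src e) = some (R.src (J e)) ∧ (Q.tgt e).bind jN = R.tgt (J e) ∧
      Q.pIdx e = R.pIdx (J e) ∧ Q.cIdx e = R.cIdx (J e) := by
    intro e h1 h2 h3
    refine hA.1 e _ (hJ e h1) ?_
    simp only [Set.mem_insert_iff, Set.mem_singleton_iff, not_or]
    exact ⟨fun h => h2 (JDi e h1 h), fun h => h3 (JVi e h1 h)⟩
  have hSort : ∀ n mm, jN n = some mm → Q.sort n = R.sort mm := fun n mm hn => (hA.2 _ _ hn (by simp)).1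
  let lo : Q.Edge → R.Edge := fun e => if e = q' then q else if e = D then d' else J e
  have hlo : ∀ e, e ≠ q' → e ≠ D → lo e = J e := fun e h1 h2 => by simp [lo, h1, h2]
  have loq' : lo q' = q := by simp [lo]
  have loD : lo D = d' := by simp [lo, D1]
  clear_value lo
  have SW : Swap R Q jN J lo l l' d d' V q' j := by
    refine ⟨sl, tgd, sd', cd'.symm, jp, jc, tN, iN.1, jl, hSort, ?_, ?_, Jne, Jinj, Jsurj, ?_, ?_, ?_,
      sq', cq', V5, V6, tq'.trans V2.symm, .inl (V2 ▸ pq)⟩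
    · intro e h1
      by_cases h2 : e = D
      · rw [h2, JD]; exact ⟨D3, D2, D4⟩
      by_cases h3 : e = V
      · rw [h3, JV]; exact ⟨V3, V2, V4⟩
      exact ⟨(hA1 e h1 h2 h3).2.1, (hA1 e h1 h2 h3).1, (hA1 e h1 h2 h3).2.2.2.2⟩
    · intro e h3
      by_cases h1 : e = q'
      · rw [h1, loq', gq', tgq]; exact ⟨jx, tq', ppq'⟩
      by_cases h2 : e = D
      · rw [h2, loD, D5, tgd']; exact ⟨jx, D2.trans tyd.symm, D6⟩
      rw [hlo e h1 h2]
      exact ⟨(hA1 e h1 h2 h3).2.2.1, (hA1 e h1 h2 h3).1, (hA1 e h1 h2 h3).2.2.2.1⟩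
    · intro e h3
      by_cases h1 : e = q'
      · rw [h1, loq']; exact hdq.symm
      by_cases h2 : e = D
      · rw [h2, loD]; exact hdd'.symm
      rw [hlo e h1 h2]; exact fun h => h2 (JDi e h1 h)
    · have cs : ∀ e, e = q' ∨ e = D ∨ (e ≠ q' ∧ e ≠ D) := fun e => by tauto
      intro e e' h3 h3' hee
      rcases cs e with h | h | ⟨h1, h2⟩ <;> rcases cs e' with h' | h' | ⟨h1', h2'⟩
      · rw [h, h']
      · rw [h, h', loq', loD] at hee; exact absurd hee.symm hd'q
      · rw [h, loq', hlo _ h1' h2'] at hee; exact absurd (JVi _ h1' hee.symm) h3'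
      · rw [h, h', loq', loD] at hee; exact absurd hee hd'q
      · rw [h, h']
      · rw [h, loD, hlo _ h1' h2'] at hee; exact absurd hee.symm (Jne _ h1')
      · rw [h', loq', hlo _ h1 h2] at hee; exact absurd (JVi _ h1 hee) h3
      · rw [h', loD, hlo _ h1 h2] at hee; exact absurd hee (Jne _ h1)
      · rw [hlo _ h1 h2, hlo _ h1' h2'] at hee; exact Jinj _ _ h1 h1' hee
    · intro f hf
      by_cases h : f = q
      · exact ⟨q', V1.symm, by rw [loq', h]⟩
      by_cases h' : f = d'
      · exact ⟨D, hDV, by rw [loD, h']⟩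
      · obtain ⟨e, h1, rfl⟩ := Jsurj f h'
        exact ⟨e, by rintro rfl; exact h JV, hlo e h1 (by rintro rfl; exact hf JD)⟩
  have hpx' : Q.prems x' = {D, q'} := by
    refine prems_of fun e => ?_
    simp only [Finset.mem_insert, Finset.mem_singleton]
    constructor
    · intro he
      have h1 : e ≠ V := by rintro rfl; rw [V5] at he; exact hlx' (Option.some.inj he)
      by_contra hh
      push Not at hh
      have := (px' _).1 ((SW.jtgt h1 jx).1 he)
      rw [hlo e hh.2 hh.1] at this
      exact this.elim (Jne e hh.2) (fun h => h1 (JVi e hh.2 h))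
    · rintro (rfl | rfl) <;> assumption
  have hcx' : Q.concls x' = ∅ := by
    refine concls_of fun e => ?_
    simp only [Finset.notMem_empty, iff_false]
    intro he
    have h1 : e ≠ q' := by rintro rfl; exact hlx' (sq'.symm.trans he)
    exact ((hG x).cut sx).1 _ ((SW.jsrc h1 jx).1 he)
  refine ⟨⟨SW.good hG, ?_⟩, ?_⟩
  · intro c hL hO
    have em := (hO x').even
    rw [bd_eq, hcx', hpx', Finset.sum_empty, Finset.sum_pair D1, zero_add] at em
    have hDq : c D = c q' := by
      have := congrArg (· + c q') em
      simpa [add_assoc, z2_self] using this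
    have : ∀ f, ∃ w : ZMod 2, (∀ e, e ≠ q' → J e = f → w = c e) ∧ (f = d' → w = c V) := by
      intro f
      by_cases hf : f = d'
      · exact ⟨_, fun e h1 h => absurd (h.trans hf) (Jne e h1), fun _ => rfl⟩
      · obtain ⟨e, h1, he⟩ := Jsurj f hf
        exact ⟨c e, fun e' h1' he' => by rw [Jinj e e' h1 h1' (he.trans he'.symm)],
          fun h => absurd h hf⟩
    choose K hK1 hK2 using this
    have hKJ : ∀ e, e ≠ q' → K (J e) = c e := fun e h1 => hK1 _ e h1 rfl
    have Kd' : K d' = c V := hK2 d' rfl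
    have Kq : K q = c V := by rw [← JV]; exact hKJ V V1
    have Kd : K d = c D := by rw [← JD]; exact hKJ D D1
    have hKL : ∀ e, e ≠ V → Q.tgt e ≠ some x' → K (lo e) = c e := by
      intro e h1 h2
      have h3 : e ≠ D := by rintro rfl; exact h2 D5
      have h4 : e ≠ q' := by rintro rfl; exact h2 gq'
      rw [hlo e h4 h3, hKJ e h4]
    have hLK : Live R K := by
      intro f hf
      by_cases hfd : f = d
      · exact ⟨l, hfd ▸ tgd, not_dead_sort (by simp [sl])⟩
      by_cases hfd' : f = d'
      · exact ⟨x, hfd' ▸ tgd', ndx⟩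
      by_cases hfq : f = q
      · exact ⟨x, hfq ▸ tgq, ndx⟩
      obtain ⟨e, h1, rfl⟩ := Jsurj f hfd'
      have h2 : e ≠ D := by rintro rfl; exact hfd JD
      have h3 : e ≠ V := by rintro rfl; exact hfq JV
      rw [hKJ e h1] at hf
      obtain ⟨t, ht, hd⟩ := hL e hf
      obtain ⟨mm, hm⟩ := Option.ne_none_iff_exists'.1 (tN t)
      refine ⟨mm, by rw [← hlo e h1 h2]; exact (SW.jtgt h3 hm).1 ht, ?_⟩
      by_cases hml : mm = l
      · rw [hml]; exact not_dead_sort (by simp [sl])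
      · exact fun h => hd ((SW.loc hm hml).dead.2 h)
    have hOK : ∀ mm, mm ≠ l → OKat R K mm := by
      intro mm hml
      by_cases hma : mm = x
      · rw [hma]
        refine ok_trivial ?_ (by simp [sx]) (by simp [sx])
        rw [bd_eq, px, Finset.sum_pair hd'q, concls_of (s := ∅) (by intro e; simp; exact ((hG x).cut sx).1 e),
          Kd', Kq, Finset.sum_empty, zero_add, z2_self]
      · obtain ⟨n, hn⟩ := iN.2.2 mm trivial
        have hnl : n ≠ l' := by rintro rfl; rw [jl] at hn; exact hml (Option.some.inj hn).symm
        have hna : n ≠ x' := by rintro rfl; rw [jx] at hn; exact hma (Option.some.inj hn).symm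
        refine (SW.loc hn hml).ok c _ ?_ ?_ (hO n)
        · intro e he
          exact (hKJ e (by rintro rfl; exact hnl (he.symm.trans sq'))).symm
        · intro e he
          exact (hKL e (by rintro rfl; rw [V5] at he; exact hnl (Option.some.inj he).symm)
            (by rw [he]; exact fun h => hna (Option.some.inj h))).symm
    have key := hC K hLK ?_
    · have k0 : ∀ e, e ≠ q' → c e = 0 := fun e h1 => by rw [← hKJ e h1]; exact key _
      intro e
      by_cases h1 : e = q'
      · rw [h1, ← hDq]; exact k0 D D1
      · exact k0 e h1
    · intro mm
      by_cases hml : mm = l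
      swap
      · exact hOK mm hml
      rw [hml]
      refine ⟨bd_last hLK l fun n hn => (hOK n hn).even, fun h => (by rw [sl] at h; cases h), fun _ => ?_⟩
      refine SW.syn hG (hO l') ?_ ?_ (.inr ⟨nd', tq' ▸ pq, Kd.trans hDq⟩)
      · intro e he h1; exact hKJ e h1
      · intro e he h1; exact hKL e h1 (by rw [he]; exact fun h => hlx' (Option.some.inj h))
  · intro g hM
    have gdd' : g d' ≤ g d := (hM l).sn sl d d' tgd sd' cd'.symm nd nd'
    let k : Q.Edge → ℕ := fun e => if e = q' then g q else g (J e)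
    have kq' : k q' = g q := by simp [k]
    have hk : ∀ e, e ≠ q' → k e = g (J e) := fun e h => by simp [k, h]
    clear_value k
    refine ⟨k, ?_, ?_⟩
    · intro n
      by_cases hnl : n = l'
      · rw [hnl]
        refine SW.model (hM l) ?_ ?_ ?_
        · intro e he h1; exact hk e h1
        · intro e he h1
          have h3 : e ≠ D := by rintro rfl; rw [D5] at he; exact hlx' (Option.some.inj he).symm
          have h4 : e ≠ q' := by rintro rfl; rw [gq'] at he; exact hlx' (Option.some.inj he).symm
          rw [hk e h4, hlo e h4 h3]
        · rw [kq', hk V V1, JV]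
      · obtain ⟨mm, hm⟩ := Option.ne_none_iff_exists'.1 (tN n)
        have e1 : ∀ e, Q.src e = n → k e = g (J e) := by
          intro e he
          exact hk e (by rintro rfl; exact hnl (he.symm.trans sq'))
        have e2 : ∀ e, e ≠ D → k e = g (lo e) := by
          intro e h1
          by_cases h4 : e = q'
          · rw [h4, kq', loq']
          · rw [hk e h4, hlo e h4 h1]
        refine (SW.loc hm fun h => hnl (iN.1 _ _ _ (h ▸ hm) jl)).model g _ (fun e he _ => (e1 e he).ge)
          (fun e he _ => (e1 e he).le) ?_ ?_ ?_ (hM mm)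
        · intro e he pe
          exact (e2 e (by rintro rfl; rw [D2] at pe; exact pos_not_neg pe nd)).le
        · intro e he pe
          by_cases h1 : e = D
          · rw [h1, loD, hk D D1, JD]; exact gdd'
          · exact (e2 e h1).ge
        · intro hs e he
          refine (e2 e ?_).le
          rintro rfl
          rw [D5] at he
          rw [← Option.some.inj he, hSort _ _ jx, sx] at hs
          cases hs
    · refine wt_lt J {D, q'} d ?_ ?_ ?_ ?_
      · intro e e' he he'
        simp only [Finset.mem_insert, Finset.mem_singleton, not_or] at he he'
        exact Jinj e e' he.2 he'.2
      · intro e he h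
        simp only [Finset.mem_insert, Finset.mem_singleton, not_or] at he
        exact he.1 (JDi e he.2 h)
      · intro e he
        simp only [Finset.mem_insert, Finset.mem_singleton, not_or] at he
        refine phi_le (SW.us e he.2).2.1 (hk e he.2) ?_ ?_
        · intro _ hs
          rw [← hSort _ _ (SW.us e he.2).1]; exact hs
        · intro ne t ht hs
          have h1 : e ≠ V := by rintro rfl; rw [V2] at ne; exact pos_not_neg pq ne
          obtain ⟨mm, hm⟩ := Option.ne_none_iff_exists'.1 (tN t)
          exact ⟨mm, by rw [← hlo e he.2 he.1]; exact (SW.jtgt h1 hm).1 ht, by rw [← hSort _ _ hm]; exact hs⟩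
      · have q1 := phi_le_self Q k q'
        rw [kq', tq', tyq, fsz_dual, tyd] at q1
        have q3 : phi Q k D = 0 :=
          phi_neg_zero (by rw [D2]; exact nd) D5 (by rw [hSort _ _ jx, sx]; simp)
        have q4 : phi R g d = (g d + 1) * fsz (R.typ d) := phi_neg_tgt nd tgd sl
        have q5 := (hM x).cut sx ndx d' q tgd' tgq nd' pq
        rw [Finset.sum_pair D1, q3, zero_add]
        exact one_aux q1 (lt_of_lt_of_le q5 gdd') (fsz_pos _) q4

namespace SNFinal

theorem card_le {α β : Type} [Fintype α] [Fintype β] {j : α → Option β} {X : Set β}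
    (ht : JTotal j) (h : PInjOnto j X) : Fintype.card α ≤ Fintype.card β := by
  choose f hf using fun a => Option.ne_none_iff_exists'.1 (ht a)
  exact Fintype.card_le_of_injective f fun a b hab =>
    h.1 a b (f a) (hf a) (by rw [hf b, hab])

theorem card_lt {α β : Type} [Fintype α] [Fintype β] {j : α → Option β} {X : Set β}
    (ht : JTotal j) (h : PInjOnto j X) {p : β} (hp : p ∉ X) :
    Fintype.card α < Fintype.card β := by
  choose f hf using fun a => Option.ne_none_iff_exists'.1 (ht a)
  refine Fintype.card_lt_of_injective_of_notMem f (b := p) (fun a b hab =>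
    h.1 a b (f a) (hf a) (by rw [hf b, hab])) ?_
  rintro ⟨a, rfl⟩
  exact hp (h.2.1 a _ (hf a))

theorem card_lt_one {α β : Type} [Fintype α] [Fintype β] {j : α → Option β} {X : Set β}
    {c : α} (ht : ∀ a, j a = none → a = c) (h : PInjOnto j X) {p t : β} (hp : p ∉ X)
    (htX : t ∉ X) (hpt : t ≠ p) :
    Fintype.card α < Fintype.card β := by
  have key : ∀ a, (j a = none ∧ (j a).getD t = t) ∨ (j a = some ((j a).getD t)) := by
    intro a
    cases j a <;> simp
  refine Fintype.card_lt_of_injective_of_notMem (fun a => (j a).getD t) (b := p) ?_ ?_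
  · intro a b hab
    simp only at hab
    rcases key a with ⟨ha, ha'⟩ | ha <;> rcases key b with ⟨hb, hb'⟩ | hb
    · rw [ht a ha, ht b hb]
    · exact absurd (h.2.1 b _ hb) (by rw [← hab, ha']; exact htX)
    · exact absurd (h.2.1 a _ ha) (by rw [hab, hb']; exact htX)
    · exact h.1 a b _ ha (by rw [hab]; exact hb)
  · rintro ⟨a, ha0⟩
    simp only at ha0
    rcases key a with ⟨ha, ha'⟩ | ha
    · exact hpt (ha'.symm.trans ha0)
    · exact hp (by have := h.2.1 a _ ha; rwa [ha0] at this)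

theorem card_axcut {R Q : Struct} (h : AxCutStep R Q) :
    Fintype.card Q.Node < Fintype.card R.Node := by
  obtain ⟨a, c, v, u, q, _, _, _, _, _, _, _, _, _, jN, jE, h1, _, h2, _⟩ := h
  exact card_lt h1 h2 (p := a) (by simp)

theorem card_elim {R Q : Struct} (h : SyncElimStep R Q) :
    Fintype.card Q.Node < Fintype.card R.Node := by
  obtain ⟨l, _, _, _, jN, jE, h1, _, h2, _⟩ := h
  exact card_lt h1 h2 (p := l) (by simp)

theorem card_onebot {R Q : Struct} (h : OneBotStep R Q) :
    Fintype.card Q.Node < Fintype.card R.Node := by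
  obtain ⟨c, n, b, o, k, _, _, _, _, _, _, _, _, _, _, jN, jE, h1, _, h2, _⟩ := h
  exact card_lt h1 h2 (p := c) (by simp)

theorem card_tensparr {R Q : Struct} (h : TensParrStep R Q) :
    Fintype.card Q.Node < Fintype.card R.Node := by
  obtain ⟨c, t, p, s, s', a1, a2, b1, b2, _, ht, hp, _, _, _, _, _, _, _, _, _, _, _, _, _, _, _,
    jN, jE, c', _, h2, _, _, h3, _⟩ := h
  refine card_lt_one h3 h2 (p := p) (t := t) (by simp) (by simp) ?_
  rintro rfl
  rw [ht] at hp
  cases hp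

theorem card_mult {R Q : Struct} (h : SyncMultStep R Q) :
    Fintype.card Q.Node ≤ Fintype.card R.Node := by
  obtain ⟨l, m, z, w, x, y, i, i', _, _, _, _, _, _, _, _, _, _, _, _, _, _, _,
    jN, jE, _, _, _, _, h1, h2, _⟩ := h
  exact card_le h1 h2

theorem card_ax {R Q : Struct} (h : SyncAxStep R Q) :
    Fintype.card Q.Node ≤ Fintype.card R.Node := by
  obtain ⟨l, a, u, u', v, j, _, _, _, _, _, _, _, _, _, _, _, _, _, _,
    jN, jE, _, _, _, h1, h2, _⟩ := h
  exact card_le h1 h2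

theorem card_cut {R Q : Struct} (h : SyncCutStep R Q) :
    Fintype.card Q.Node ≤ Fintype.card R.Node := by
  obtain ⟨l, a, u, u', v, j, _, _, _, _, _, _, _, _, _, _, _, _, _, _, _,
    jN, jE, _, _, _, h1, h2, _⟩ := h
  exact card_le h1 h2

theorem step_measure {R Q : Struct} (hI : SInv R) (h : Step R Q) :
    SInv Q ∧ (Fintype.card Q.Node < Fintype.card R.Node ∨
      (Fintype.card Q.Node ≤ Fintype.card R.Node ∧
        ∀ g, Model R g → ∃ k, Model Q k ∧ wt Q k < wt R g)) := by
  rcases h with h | h | (h | h | h | h) | h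
  · exact ⟨inv_axcut hI h, Or.inl (card_axcut h)⟩
  · exact ⟨inv_tensparr hI h, Or.inl (card_tensparr h)⟩
  · exact ⟨(comm_mult hI h).1, Or.inr ⟨card_mult h, (comm_mult hI h).2⟩⟩
  · exact ⟨(comm_ax hI h).1, Or.inr ⟨card_ax h, (comm_ax hI h).2⟩⟩
  · exact ⟨(comm_cut hI h).1, Or.inr ⟨card_cut h, (comm_cut hI h).2⟩⟩
  · exact ⟨inv_syncelim hI h, Or.inl (card_elim h)⟩
  · exact ⟨inv_onebot hI h, Or.inl (card_onebot h)⟩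

theorem no_inf : ∀ (N : ℕ) (W : ℕ) (f : ℕ → Struct) (g : _),
    SInv (f 0) → Model (f 0) g → Fintype.card (f 0).Node ≤ N → wt (f 0) g ≤ W →
    (∀ n, Step (f n) (f (n + 1))) → False := by
  intro N
  induction N using Nat.strong_induction_on with
  | _ N ihN =>
  intro W
  induction W using Nat.strong_induction_on with
  | _ W ihW =>
  intro f g hI hg hN hW hs
  obtain ⟨hQ, h⟩ := step_measure hI (hs 0)
  rcases h with h | ⟨h, hk⟩
  · obtain ⟨k, hk⟩ := model_exists hQ.2
    exact ihN _ (lt_of_lt_of_le h hN) _ (fun n => f (n + 1)) k hQ hk le_rfl le_rfl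
      (fun n => hs (n + 1))
  · obtain ⟨k, hk, hlt⟩ := hk g hg
    exact ihW _ (lt_of_lt_of_le hlt hW) (fun n => f (n + 1)) k hQ hk (h.trans hN) le_rfl
      (fun n => hs (n + 1))

end SNFinal

/-- **Strong Normalization.**  The reduction relation `→` on SMLL nets is
strongly normalizing: there is no infinite sequence of `→` reduction steps
starting from an SMLL net. -/
theorem smll_strong_normalization (f : ℕ → Struct) (hWF : (f 0).WF)
    (hC : (f 0).Correct) : ¬ ∀ n : ℕ, Step (f n) (f (n + 1)) := by
  intro hs
  have hI := sinv_init hWF hC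
  obtain ⟨g, hg⟩ := model_exists hI.2
  exact SNFinal.no_inf _ _ f g hI hg le_rfl le_rfl hs
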